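/- arXiv:1606.04479 — 3 statements merged into one kernel-verified Lean document; each statement's English description precedes it below -/
import Mathlib

section
/- Let β > 0 and let F : ℕ → [0,∞) satisfy F(N)/N → 0 as N → ∞. Then there exist a constant C > 0 and N₀ ∈ ℕ such that for all N ≥ N₀ and all integers 1 ≤ k ≤ N, the quantity 1 − (F(N)/(2βN))·(k/N − 1/2) is positive and | N·m_k(N, F(N)) / (1 − (F(N)/(2βN))·(k/N − 1/2)) − 1 | ≤ C·( F(N)²/N² + (log N)/√N ). In particular the conditional mean spacing satisfies m_k(N,F(N)) = (1/N)(1 − (F(N)/(2βN))(k/N − 1/2))·(1 + O(F(N)²/N²) + O(log N/√N)) uniformly in k. -/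
open MeasureTheory Filter

noncomputable section

/-- The `k`-th spacing coordinate (for `1 ≤ k ≤ N`): for `k ≤ N-1` it is the
`k`-th coordinate of `x`, and for `k = N` it is `1 - (x_1 + ⋯ + x_{N-1})`. -/
def coulombCoord (N k : ℕ) (x : Fin (N - 1) → ℝ) : ℝ :=
  if h : k - 1 < N - 1 then x ⟨k - 1, h⟩ else 1 - ∑ i, x i

/-- The open simplex `T_N ⊆ (0,1)^{N-1}`. -/
def coulombDomain (N : ℕ) : Set (Fin (N - 1) → ℝ) :=
  {x | (∀ i, 0 < x i ∧ x i < 1) ∧ ∑ i, x i < 1}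

/-- `I_N[g] = ∫_{T_N} g · exp(−Σ_{i=1}^N (β/x_i + F·i·x_i))`. -/
def coulombInt (β F : ℝ) (N : ℕ) (g : (Fin (N - 1) → ℝ) → ℝ) : ℝ :=
  ∫ x in coulombDomain N,
    g x * Real.exp (-(∑ k ∈ Finset.Icc 1 N,
      (β / coulombCoord N k x + F * (k : ℝ) * coulombCoord N k x)))

/-- Conditional mean `m_k(N,F)` of the `k`-th spacing. -/
def condMean (β : ℝ) (N : ℕ) (F : ℝ) (k : ℕ) : ℝ :=
  coulombInt β F N (coulombCoord N k) / coulombInt β F N (fun _ => 1)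

/-- Conditional variance `v_k(N,F)` of the `k`-th spacing. -/
def condVar (β : ℝ) (N : ℕ) (F : ℝ) (k : ℕ) : ℝ :=
  coulombInt β F N (fun x => coulombCoord N k x ^ 2) / coulombInt β F N (fun _ => 1)
    - condMean β N F k ^ 2

/-- One-site weight `exp(-β/t - p t)` for `t > 0`, extended by zero. -/
def psi (β p t : ℝ) : ℝ := expNegInvGlue (t / β) * Real.exp (-(p * t))

lemma psi_nonneg (β p t : ℝ) : 0 ≤ psi β p t :=
  mul_nonneg (expNegInvGlue.nonneg _) (Real.exp_pos _).le

lemma psi_of_pos {β t : ℝ} (hβ : 0 < β) (p : ℝ) (ht : 0 < t) :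
    psi β p t = Real.exp (-(β / t + p * t)) := by
  have h : ¬ (t / β ≤ 0) := not_le.2 (div_pos ht hβ)
  rw [psi, expNegInvGlue, if_neg h, ← Real.exp_add]
  congr 1
  rw [inv_div]; ring

lemma psi_of_nonpos {β t : ℝ} (hβ : 0 < β) (p : ℝ) (ht : t ≤ 0) : psi β p t = 0 := by
  rw [psi, expNegInvGlue.zero_of_nonpos (div_nonpos_of_nonpos_of_nonneg ht hβ.le), zero_mul]

lemma psi_differentiable (β p : ℝ) : Differentiable ℝ (psi β p) := by
  have h : Differentiable ℝ expNegInvGlue :=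
    (expNegInvGlue.contDiff (n := 1)).differentiable (by norm_num)
  unfold psi
  fun_prop

lemma psi_hasDerivAt {β : ℝ} (hβ : 0 < β) (p t : ℝ) :
    HasDerivAt (psi β p) (psi β p t * (β / t ^ 2 - p)) t := by
  rcases le_or_gt t 0 with ht | ht
  · have h0 := psi_of_nonpos hβ p ht
    have hd := (psi_differentiable β p t).hasDerivAt
    have hm : IsLocalMin (psi β p) t := by
      refine Filter.Eventually.of_forall fun s => ?_
      rw [h0]; exact psi_nonneg _ _ _
    rw [hm.hasDerivAt_eq_zero hd] at hd
    simpa [h0] using hd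
  · have h1 : HasDerivAt (fun s : ℝ => Real.exp (-(β / s + p * s)))
        (Real.exp (-(β / t + p * t)) * (β / t ^ 2 - p)) t := by
      have h2 : HasDerivAt (fun s : ℝ => -(β / s + p * s)) (β / t ^ 2 - p) t := by
        have h3 : HasDerivAt (fun s : ℝ => β / s) (-(β / t ^ 2)) t := by
          have := (hasDerivAt_inv ht.ne').const_mul β
          simp only [← div_eq_mul_inv, mul_neg] at this
          exact this
        have h4 := (h3.add ((hasDerivAt_id t).const_mul p)).neg
        refine h4.congr_deriv ?_
        ring
      exact h2.exp
    rw [psi_of_pos hβ p ht]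
    refine h1.congr_of_eventuallyEq ?_
    filter_upwards [lt_mem_nhds ht] with s hs
    exact psi_of_pos hβ p hs

lemma psi_le_one {β p : ℝ} (hβ : 0 < β) (hp : 0 ≤ p) (t : ℝ) : psi β p t ≤ 1 := by
  rcases le_or_gt t 0 with ht | ht
  · rw [psi_of_nonpos hβ p ht]; exact zero_le_one
  · rw [psi_of_pos hβ p ht, Real.exp_le_one_iff]
    have : 0 ≤ β / t + p * t := by positivity
    linarith

lemma psi_div_sq_le {β p : ℝ} (hβ : 0 < β) (hp : 0 ≤ p) (t : ℝ) :
    psi β p t * (β / t ^ 2) ≤ 2 / β := by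
  rcases le_or_gt t 0 with ht | ht
  · rw [psi_of_nonpos hβ p ht, zero_mul]; positivity
  · rw [psi_of_pos hβ p ht, Real.exp_neg]
    have h1 : (β / t) ^ 2 / 2 ≤ Real.exp (β / t + p * t) := by
      have h2 := Real.quadratic_le_exp_of_nonneg (x := β / t) (by positivity)
      have h3 : Real.exp (β / t) ≤ Real.exp (β / t + p * t) := by
        apply Real.exp_le_exp.2
        have : 0 ≤ p * t := by positivity
        linarith
      have : 0 < β / t := by positivity
      linarith
    rw [inv_mul_le_iff₀ (Real.exp_pos _)]
    calc β / t ^ 2 = (β / t) ^ 2 / 2 * (2 / β) := by field_simp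
      _ ≤ _ := by gcongr

/-- All `n+1` spacings from the first `n`. -/
def crd {n : ℕ} (x : Fin n → ℝ) (j : Fin (n + 1)) : ℝ :=
  Fin.snoc (α := fun _ => ℝ) x (1 - ∑ i, x i) j

@[simp] lemma crd_castSucc {n : ℕ} (x : Fin n → ℝ) (i : Fin n) : crd x i.castSucc = x i := by
  simp [crd]

@[simp] lemma crd_last {n : ℕ} (x : Fin n → ℝ) : crd x (Fin.last n) = 1 - ∑ i, x i := by
  simp [crd]

lemma crd_sum {n : ℕ} (x : Fin n → ℝ) : ∑ j, crd x j = 1 := by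
  rw [Fin.sum_univ_castSucc]; simp

lemma crd_continuous {n : ℕ} (j : Fin (n + 1)) : Continuous (fun x : Fin n → ℝ => crd x j) := by
  refine Fin.lastCases ?_ (fun i => ?_) j
  · simp only [crd_last]; fun_prop
  · simp only [crd_castSucc]; fun_prop

lemma crd_measurable {n : ℕ} (j : Fin (n + 1)) : Measurable (fun x : Fin n → ℝ => crd x j) :=
  (crd_continuous j).measurable

/-- Derivative of coordinate `l` in direction `e_i`. -/
def dcrd {n : ℕ} (i : Fin n) (l : Fin (n + 1)) : ℝ :=
  (if l = i.castSucc then 1 else 0) - (if l = Fin.last n then 1 else 0)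

lemma crd_add {n : ℕ} (x : Fin n → ℝ) (i : Fin n) (t : ℝ) (l : Fin (n + 1)) :
    crd (x + t • Pi.single i 1) l = crd x l + t * dcrd i l := by
  refine Fin.lastCases ?_ (fun k => ?_) l
  · have : Fin.last n ≠ i.castSucc := (Fin.castSucc_lt_last i).ne'
    simp [dcrd, this, Finset.sum_add_distrib, ← Finset.mul_sum]
    ring
  · have : k.castSucc ≠ Fin.last n := (Fin.castSucc_lt_last k).ne
    simp [dcrd, this, Pi.single_apply]

/-- The Gibbs weight, extended by zero off the simplex. -/
def gw (β F : ℝ) {n : ℕ} (x : Fin n → ℝ) : ℝ :=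
  ∏ j : Fin (n + 1), psi β (F * ((j : ℝ) + 1)) (crd x j)

lemma gw_nonneg (β F : ℝ) {n : ℕ} (x : Fin n → ℝ) : 0 ≤ gw β F x :=
  Finset.prod_nonneg fun _ _ => psi_nonneg _ _ _

lemma gw_continuous (β F : ℝ) {n : ℕ} : Continuous (fun x : Fin n → ℝ => gw β F x) := by
  unfold gw
  refine continuous_finsetProd _ fun j _ => ?_
  exact (psi_differentiable _ _).continuous.comp (crd_continuous j)

lemma gw_ne_zero {β F : ℝ} (hβ : 0 < β) {n : ℕ} {x : Fin n → ℝ} :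
    gw β F x ≠ 0 ↔ ∀ j, 0 < crd x j := by
  rw [gw, Finset.prod_ne_zero_iff]
  constructor
  · intro h j
    by_contra hc
    exact h j (Finset.mem_univ _) (psi_of_nonpos hβ _ (not_lt.1 hc))
  · intro h j _
    rw [psi_of_pos hβ _ (h j)]; exact (Real.exp_pos _).ne'

lemma gw_le_one {β F : ℝ} (hβ : 0 < β) (hF : 0 ≤ F) {n : ℕ} (x : Fin n → ℝ) : gw β F x ≤ 1 :=
  Finset.prod_le_one (fun _ _ => psi_nonneg _ _ _)
    (fun j _ => psi_le_one hβ (by positivity) _)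

lemma gw_div_sq_le {β F : ℝ} (hβ : 0 < β) (hF : 0 ≤ F) {n : ℕ} (x : Fin n → ℝ)
    (j : Fin (n + 1)) : gw β F x * (β / crd x j ^ 2) ≤ 2 / β := by
  rw [gw, ← Finset.mul_prod_erase _ _ (Finset.mem_univ j)]
  have h1 : ∏ k ∈ Finset.univ.erase j, psi β (F * ((k : ℝ) + 1)) (crd x k) ≤ 1 :=
    Finset.prod_le_one (fun _ _ => psi_nonneg _ _ _)
      (fun j _ => psi_le_one hβ (by positivity) _)
  have h2 := psi_div_sq_le (p := F * ((j : ℝ) + 1)) hβ (by positivity) (crd x j)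
  have h3 : 0 ≤ psi β (F * ((j : ℝ) + 1)) (crd x j) * (β / crd x j ^ 2) :=
    mul_nonneg (psi_nonneg _ _ _) (by positivity)
  calc _ = (psi β (F * ((j : ℝ) + 1)) (crd x j) * (β / crd x j ^ 2)) *
      ∏ k ∈ Finset.univ.erase j, psi β (F * ((k : ℝ) + 1)) (crd x k) := by ring
    _ ≤ _ * 1 := by gcongr
    _ ≤ _ := by rw [mul_one]; exact h2

lemma crd_le_one {n : ℕ} {x : Fin n → ℝ} (h : ∀ j, 0 < crd x j) (j : Fin (n + 1)) :
    crd x j ≤ 1 := by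
  rw [← crd_sum x]
  exact Finset.single_le_sum (f := fun j => crd x j) (fun k _ => (h k).le) (Finset.mem_univ j)

lemma gw_integrable {β F : ℝ} (hβ : 0 < β) {n : ℕ} {q : (Fin n → ℝ) → ℝ}
    (hq : Measurable q) (C : ℝ) (hC : ∀ x, (∀ j, 0 < crd x j) → |q x * gw β F x| ≤ C) :
    Integrable (fun x => q x * gw β F x) := by
  have hm : Measurable (fun x => q x * gw β F x) := hq.mul (gw_continuous β F).measurable
  have h1 : IntegrableOn (fun x => q x * gw β F x) (Set.Icc (0 : Fin n → ℝ) 1) := by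
    refine IntegrableOn.of_bound ?_ hm.aestronglyMeasurable (max C 0) (Eventually.of_forall ?_)
    · exact (isCompact_Icc).measure_lt_top
    · intro x
      by_cases hx : gw β F x = 0
      · simp [hx]
      · exact (hC x ((gw_ne_zero hβ).1 hx)).trans (le_max_left _ _)
  rwa [integrableOn_iff_integrable_of_support_subset] at h1
  intro x hx
  have hx' : gw β F x ≠ 0 := by
    intro h; apply hx; simp [h]
  have hp := (gw_ne_zero hβ).1 hx'
  constructor
  · intro i; simpa using (hp i.castSucc).le
  · intro i; simpa using crd_le_one hp i.castSucc

lemma gw_hasLineDerivAt {β F : ℝ} (hβ : 0 < β) {n : ℕ} (i : Fin n) (x : Fin n → ℝ) :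
    HasLineDerivAt ℝ (fun x => gw β F x)
      ((∑ j : Fin (n + 1), dcrd i j * (β / crd x j ^ 2 - F * ((j : ℝ) + 1))) * gw β F x)
      x (Pi.single i 1) := by
  unfold HasLineDerivAt
  have h0 : ∀ j : Fin (n + 1), HasDerivAt
      (fun t : ℝ => psi β (F * ((j : ℝ) + 1)) (crd (x + t • Pi.single i 1) j))
      (psi β (F * ((j : ℝ) + 1)) (crd x j) * (β / crd x j ^ 2 - F * ((j : ℝ) + 1)) * dcrd i j) 0 := by
    intro j
    simp only [crd_add]
    have h1 : HasDerivAt (fun t : ℝ => crd x j + t * dcrd i j) (dcrd i j) 0 := by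
      simpa using ((hasDerivAt_id (0 : ℝ)).mul_const (dcrd i j)).const_add (crd x j)
    have h2 := psi_hasDerivAt hβ (F * ((j : ℝ) + 1)) (crd x j)
    have h3 : crd x j = crd x j + 0 * dcrd i j := by ring
    rw [h3] at h2
    have := HasDerivAt.comp (0 : ℝ) h2 h1
    rw [← h3] at this
    exact this
  have h := HasDerivAt.fun_finsetProd (u := Finset.univ) (fun j _ => h0 j)
  unfold gw
  refine h.congr_deriv ?_
  symm
  rw [Finset.sum_mul]
  refine Finset.sum_congr rfl fun j _ => ?_
  rw [← Finset.mul_prod_erase _ _ (Finset.mem_univ j)]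
  simp only [zero_smul, add_zero, smul_eq_mul]
  ring

/-- Displacement from the critical point. -/
def dsp {n : ℕ} (b : Fin (n + 1) → ℝ) (l : Fin (n + 1)) (x : Fin n → ℝ) : ℝ := crd x l - b l

/-- Increment of the force. -/
def frc (β : ℝ) {n : ℕ} (b : Fin (n + 1) → ℝ) (l : Fin (n + 1)) (x : Fin n → ℝ) : ℝ :=
  β / b l ^ 2 - β / crd x l ^ 2

lemma dsp_measurable {n : ℕ} (b : Fin (n + 1) → ℝ) (l : Fin (n + 1)) : Measurable (dsp b l) :=
  (crd_measurable l).sub_const _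

lemma frc_measurable (β : ℝ) {n : ℕ} (b : Fin (n + 1) → ℝ) (l : Fin (n + 1)) :
    Measurable (frc β b l) := by
  have := crd_measurable l
  unfold frc
  fun_prop

lemma dsp_abs_le {n : ℕ} {b : Fin (n + 1) → ℝ} (hb : ∀ j, 0 < b j)
    (hb1 : ∀ j, b j ≤ 1) (l : Fin (n + 1)) {x : Fin n → ℝ} (hx : ∀ j, 0 < crd x j) :
    |dsp b l x| ≤ 1 := by
  rw [dsp, abs_le]
  have := crd_le_one hx l
  have := hx l
  have := hb l
  have := hb1 l
  constructor <;> linarith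

lemma frc_gw_abs_le {β F : ℝ} (hβ : 0 < β) (hF : 0 ≤ F) {n : ℕ} (b : Fin (n + 1) → ℝ)
    (l : Fin (n + 1)) (x : Fin n → ℝ) :
    |frc β b l x * gw β F x| ≤ β / b l ^ 2 + 2 / β := by
  have h1 := gw_div_sq_le hβ hF x l
  have h2 := gw_le_one hβ hF x
  have h3 := gw_nonneg β F x
  have h4 : 0 ≤ β / b l ^ 2 := by positivity
  have h5 : 0 ≤ β / crd x l ^ 2 := by positivity
  have h6 : frc β b l x * gw β F x = β / b l ^ 2 * gw β F x - gw β F x * (β / crd x l ^ 2) := by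
    rw [frc]; ring
  rw [h6, abs_le]
  have h7 : β / b l ^ 2 * gw β F x ≤ β / b l ^ 2 := mul_le_of_le_one_right h4 h2
  have h8 : 0 ≤ β / b l ^ 2 * gw β F x := mul_nonneg h4 h3
  have h9 : 0 ≤ gw β F x * (β / crd x l ^ 2) := mul_nonneg h3 h5
  constructor <;> linarith

lemma int_bdd {β F : ℝ} (hβ : 0 < β) (hF : 0 ≤ F) {n : ℕ} {q : (Fin n → ℝ) → ℝ}
    (hq : Measurable q) (C : ℝ) (hC : ∀ x, (∀ j, 0 < crd x j) → |q x| ≤ C) :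
    Integrable (fun x => q x * gw β F x) := by
  refine gw_integrable hβ hq C fun x hx => ?_
  rw [abs_mul, abs_of_nonneg (gw_nonneg β F x)]
  exact (mul_le_of_le_one_right (abs_nonneg _) (gw_le_one hβ hF x)).trans (hC x hx)

lemma int_frc {β F : ℝ} (hβ : 0 < β) (hF : 0 ≤ F) {n : ℕ} (b : Fin (n + 1) → ℝ)
    (j : Fin (n + 1)) :
    Integrable (fun x => frc β b j x * gw β F x) :=
  gw_integrable hβ (frc_measurable β b j) _ fun x _ => frc_gw_abs_le hβ hF b j x

lemma int_dsp_frc {β F : ℝ} (hβ : 0 < β) (hF : 0 ≤ F) {n : ℕ} {b : Fin (n + 1) → ℝ}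
    (hb : ∀ j, 0 < b j) (hb1 : ∀ j, b j ≤ 1) (l j : Fin (n + 1)) :
    Integrable (fun x => dsp b l x * frc β b j x * gw β F x) := by
  refine gw_integrable hβ ((dsp_measurable b l).mul (frc_measurable β b j))
    (β / b j ^ 2 + 2 / β) fun x hx => ?_
  rw [mul_assoc, abs_mul]
  have h1 := dsp_abs_le hb hb1 l hx
  have h2 := frc_gw_abs_le hβ hF b j x
  calc _ ≤ 1 * |frc β b j x * gw β F x| := by gcongr
    _ ≤ _ := by rw [one_mul]; exact h2

lemma ibp {β F : ℝ} (hβ : 0 < β) (hF : 0 ≤ F) {n : ℕ} {b : Fin (n + 1) → ℝ}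
    (hb : ∀ j, 0 < b j) (hb1 : ∀ j, b j ≤ 1) (lam : ℝ)
    (hcrit : ∀ j : Fin (n + 1), β / b j ^ 2 = lam + F * ((j : ℝ) + 1))
    (l : Fin (n + 1)) (i : Fin n) :
    (∫ x : Fin n → ℝ, dsp b l x * frc β b i.castSucc x * gw β F x)
      - ∫ x : Fin n → ℝ, dsp b l x * frc β b (Fin.last n) x * gw β F x
      = dcrd i l * ∫ x : Fin n → ℝ, gw β F x := by
  have hI1 := int_dsp_frc hβ hF hb hb1 l i.castSucc
  have hI2 := int_dsp_frc hβ hF hb hb1 l (Fin.last n)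
  have hder : ∀ x : Fin n → ℝ,
      dsp b l x * ((∑ j : Fin (n + 1), dcrd i j * (β / crd x j ^ 2 - F * ((j : ℝ) + 1))) * gw β F x)
      = dsp b l x * frc β b (Fin.last n) x * gw β F x
        - dsp b l x * frc β b i.castSucc x * gw β F x := by
    intro x
    have h1 : ∑ j : Fin (n + 1), dcrd i j * (β / crd x j ^ 2 - F * ((j : ℝ) + 1))
        = (β / crd x i.castSucc ^ 2 - F * (((i.castSucc : Fin (n + 1)) : ℝ) + 1))
          - (β / crd x (Fin.last n) ^ 2 - F * (((Fin.last n : Fin (n + 1)) : ℝ) + 1)) := by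
      simp only [dcrd, sub_mul, Finset.sum_sub_distrib, ite_mul, one_mul, zero_mul,
        Finset.sum_ite_eq', Finset.mem_univ, if_true]
    rw [h1]
    simp only [frc]
    rw [hcrit i.castSucc, hcrit (Fin.last n)]
    ring
  have hlin : ∀ x : Fin n → ℝ, HasLineDerivAt ℝ (dsp b l) (dcrd i l) x (Pi.single i 1) := by
    intro x
    unfold HasLineDerivAt dsp
    simp only [crd_add]
    simpa using (((hasDerivAt_id (0 : ℝ)).mul_const (dcrd i l)).const_add (crd x l)).sub_const (b l)
  have key := integral_bilinear_hasLineDerivAt_right_eq_neg_left_of_integrable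
    (μ := (volume : Measure (Fin n → ℝ))) (B := ContinuousLinearMap.mul ℝ ℝ)
    (f := dsp b l) (f' := fun _ => dcrd i l) (g := fun x => gw β F x)
    (g' := fun x => (∑ j : Fin (n + 1), dcrd i j * (β / crd x j ^ 2 - F * ((j : ℝ) + 1))) * gw β F x)
    (v := Pi.single i 1) ?_ ?_ ?_ (fun x _ => hlin x) (fun x _ => gw_hasLineDerivAt hβ i x)
  · simp only [ContinuousLinearMap.mul_apply'] at key
    simp only [hder] at key
    rw [integral_sub hI2 hI1, integral_const_mul] at key
    linarith
  · simp only [ContinuousLinearMap.mul_apply']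
    exact int_bdd hβ hF measurable_const |dcrd i l| fun _ _ => le_rfl
  · simp only [ContinuousLinearMap.mul_apply']
    simp only [hder]
    exact hI2.sub hI1
  · simp only [ContinuousLinearMap.mul_apply']
    exact int_bdd hβ hF (dsp_measurable b l) 1 fun x hx => dsp_abs_le hb hb1 l hx

lemma gw_integral_pos {β F : ℝ} (hβ : 0 < β) (hF : 0 ≤ F) (n : ℕ) :
    0 < ∫ x : Fin n → ℝ, gw β F x := by
  have hi : Integrable (fun x : Fin n → ℝ => gw β F x) := by
    have := int_bdd (n := n) hβ hF (q := fun _ => 1) measurable_const 1 (fun _ _ => by simp)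
    simpa using this
  rw [integral_pos_iff_support_of_nonneg (fun x => gw_nonneg β F x) hi]
  have ho : IsOpen (Function.support (fun x : Fin n → ℝ => gw β F x)) :=
    (gw_continuous β F).isOpen_support
  refine ho.measure_pos _ ⟨fun _ => 1 / ((n : ℝ) + 1), ?_⟩
  rw [Function.mem_support, gw_ne_zero hβ]
  intro j
  refine Fin.lastCases ?_ (fun i => ?_) j
  · simp only [crd_last, Finset.sum_const, Finset.card_univ, Fintype.card_fin, nsmul_eq_mul]
    have : (1 : ℝ) - n * (1 / ((n : ℝ) + 1)) = 1 / ((n : ℝ) + 1) := by field_simp; ring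
    rw [this]; positivity
  · simp only [crd_castSucc]; positivity

/-- Pointwise identity and bounds. -/
lemma pt_frc {β a x : ℝ} (ha : 0 < a) (hx : 0 < x) :
    (x - a) * (β / a ^ 2 - β / x ^ 2) = β * (x - a) ^ 2 * (x + a) / (a ^ 2 * x ^ 2) := by
  field_simp; ring

lemma pt_S {β a x M : ℝ} (hβ : 0 < β) (ha : 0 < a) (hx : 0 < x) (hM : a ≤ M) :
    2 * β * (x - a) - 2 * M ^ 2 * ((x - a) * (β / a ^ 2 - β / x ^ 2))
      ≤ a ^ 3 * (β / a ^ 2 - β / x ^ 2)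
    ∧ a ^ 3 * (β / a ^ 2 - β / x ^ 2) ≤ 2 * β * (x - a) := by
  have h1 : a ^ 3 * (β / a ^ 2 - β / x ^ 2)
      = 2 * β * (x - a) - β * (x - a) ^ 2 * (a + 2 * x) / x ^ 2 := by
    field_simp; ring
  have h0 : 0 ≤ (x - a) * (β / a ^ 2 - β / x ^ 2) := by rw [pt_frc ha hx]; positivity
  have h2 : 2 * a ^ 2 * ((x - a) * (β / a ^ 2 - β / x ^ 2))
      = β * (x - a) ^ 2 * (2 * x + 2 * a) / x ^ 2 := by
    rw [pt_frc ha hx]; field_simp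
  have h3 : β * (x - a) ^ 2 * (a + 2 * x) / x ^ 2 ≤ β * (x - a) ^ 2 * (2 * x + 2 * a) / x ^ 2 := by
    gcongr ?_ * ?_ / _
    linarith
  have h4 : 2 * a ^ 2 * ((x - a) * (β / a ^ 2 - β / x ^ 2))
      ≤ 2 * M ^ 2 * ((x - a) * (β / a ^ 2 - β / x ^ 2)) := by gcongr
  have h5 : 0 ≤ β * (x - a) ^ 2 * (a + 2 * x) / x ^ 2 := by positivity
  rw [h1]
  constructor <;> linarith

/-- `|x-a| ≤ ε (1 + (11/β) (x-a) D)` with `ε = R^{-3}`, `R = √N`. -/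
lemma pt_abs {β a x R : ℝ} (hβ : 0 < β) (ha : 0 < a) (hx : 0 < x) (hR : 1 ≤ R)
    (haR : a ≤ 2 / R ^ 2) :
    |x - a| ≤ 1 / R ^ 3 * (1 + 11 / β * ((x - a) * (β / a ^ 2 - β / x ^ 2))) := by
  have hR0 : 0 < R := by linarith
  rw [pt_frc ha hx]
  have haR' : a * R ^ 2 ≤ 2 := by rwa [le_div_iff₀ (by positivity)] at haR
  have hE : 11 / β * (β * (x - a) ^ 2 * (x + a) / (a ^ 2 * x ^ 2))
      = 11 * ((x - a) ^ 2 * ((x + a) / (a ^ 2 * x ^ 2))) := by field_simp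
  rw [hE]
  rw [one_div, ← div_eq_inv_mul, le_div_iff₀ (by positivity)]
  rcases le_or_gt x (2 * a) with h | h
  · have h1 : 3 / (4 * a ^ 3) ≤ (x + a) / (a ^ 2 * x ^ 2) := by
      rw [div_le_div_iff₀ (by positivity) (by positivity)]
      have : 3 * x ^ 2 ≤ (x + a) * (4 * a) := by nlinarith
      calc 3 * (a ^ 2 * x ^ 2) = a ^ 2 * (3 * x ^ 2) := by ring
        _ ≤ a ^ 2 * ((x + a) * (4 * a)) := by gcongr
        _ = _ := by ring
    have h2 : 3 / 32 * R ^ 6 ≤ 3 / (4 * a ^ 3) := by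
      rw [le_div_iff₀ (by positivity)]
      have : (a * R ^ 2) ^ 3 ≤ 2 ^ 3 := by gcongr
      nlinarith
    have h3 : (x - a) ^ 2 * (3 / 32 * R ^ 6) ≤ (x - a) ^ 2 * ((x + a) / (a ^ 2 * x ^ 2)) := by
      gcongr; exact h2.trans h1
    have h4 : |x - a| * R ^ 3 ≤ 1 + (|x - a| * R ^ 3) ^ 2 := by nlinarith [sq_nonneg (|x - a| * R ^ 3 - 1)]
    have h5 : (|x - a| * R ^ 3) ^ 2 = (x - a) ^ 2 * R ^ 6 := by rw [mul_pow, sq_abs]; ring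
    have : 0 ≤ (x - a) ^ 2 * R ^ 6 := by positivity
    linarith
  · have hxa : 0 < x - a := by linarith
    rw [abs_of_pos hxa]
    have h1 : R ^ 4 / 8 ≤ (x - a) * ((x + a) / (a ^ 2 * x ^ 2)) := by
      rw [← mul_div_assoc, div_le_div_iff₀ (by positivity) (by positivity)]
      have h2 : (a * R ^ 2) ^ 2 ≤ 2 ^ 2 := by gcongr
      have h3 : x ^ 2 ≤ 2 * ((x - a) * (x + a)) := by nlinarith
      calc R ^ 4 * (a ^ 2 * x ^ 2) = (a * R ^ 2) ^ 2 * x ^ 2 := by ring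
        _ ≤ 2 ^ 2 * (2 * ((x - a) * (x + a))) := by gcongr
        _ = _ := by ring
    have h4 : R ^ 3 ≤ R ^ 4 := pow_le_pow_right₀ hR (by norm_num)
    calc (x - a) * R ^ 3 ≤ (x - a) * R ^ 4 := by gcongr
      _ = (x - a) * (8 * (R ^ 4 / 8)) := by ring
      _ ≤ (x - a) * (8 * ((x - a) * ((x + a) / (a ^ 2 * x ^ 2)))) := by gcongr
      _ ≤ 1 + 11 * ((x - a) ^ 2 * ((x + a) / (a ^ 2 * x ^ 2))) := by
        have : 0 ≤ (x - a) ^ 2 * ((x + a) / (a ^ 2 * x ^ 2)) := by positivity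
        nlinarith

lemma dsp_sum {n : ℕ} {b : Fin (n + 1) → ℝ} (hbs : ∑ j, b j = 1) (x : Fin n → ℝ) :
    ∑ j, dsp b j x = 0 := by
  simp only [dsp, Finset.sum_sub_distrib, crd_sum, hbs, sub_self]

lemma energy_le {β F : ℝ} (hβ : 0 < β) (hF : 0 ≤ F) {n : ℕ} {b : Fin (n + 1) → ℝ}
    (hb : ∀ j, 0 < b j) (hbs : ∑ j, b j = 1) (lam : ℝ)
    (hcrit : ∀ j : Fin (n + 1), β / b j ^ 2 = lam + F * ((j : ℝ) + 1))
    (hlo : ∀ j, 1 / (2 * ((n : ℝ) + 1)) ≤ b j) (hhi : ∀ j, b j ≤ 2 / ((n : ℝ) + 1))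
    (l : Fin (n + 1)) :
    ∫ x : Fin n → ℝ, dsp b l x * frc β b l x * gw β F x ≤ 129 * ∫ x : Fin n → ℝ, gw β F x := by
  have hb1 : ∀ j, b j ≤ 1 := by
    intro j
    rw [← hbs]
    exact Finset.single_le_sum (fun k _ => (hb k).le) (Finset.mem_univ j)
  set Z := ∫ x : Fin n → ℝ, gw β F x with hZ
  have hZ0 : 0 < Z := gw_integral_pos hβ hF n
  have hI := int_dsp_frc hβ hF hb hb1
  obtain ⟨J, hJ⟩ : ∃ J : Fin (n + 1) → Fin (n + 1) → ℝ,
    ∀ l j, J l j = ∫ x : Fin n → ℝ, dsp b l x * frc β b j x * gw β F x := ⟨_, fun _ _ => rfl⟩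
  have hJK : ∃ K : Fin (n + 1) → ℝ, ∀ l j, J l j = K l + if j = l then Z else 0 := by
    refine ⟨fun l => J l (Fin.last n) - if l = Fin.last n then Z else 0, fun l j => ?_⟩
    refine Fin.lastCases ?_ (fun i => ?_) j
    · simp only [eq_comm (a := Fin.last n)]; ring
    · have h := ibp hβ hF hb hb1 lam hcrit l i
      rw [← hJ, ← hJ, ← hZ] at h
      have h2 : dcrd i l * Z = (if i.castSucc = l then Z else 0) - if l = Fin.last n then Z else 0 := by
        simp only [dcrd, sub_mul, ite_mul, one_mul, zero_mul, eq_comm (a := l) (b := i.castSucc)]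
      linarith
  obtain ⟨K, hK⟩ := hJK
  have hcol : ∀ j, ∑ l, J l j = 0 := by
    intro j
    simp only [hJ]
    rw [← integral_finsetSum _ (fun l _ => hI l j)]
    simp only [← Finset.sum_mul, dsp_sum hbs, zero_mul, integral_zero]
  have hKs : ∑ l, K l = -Z := by
    have := hcol l
    simp only [hK, Finset.sum_add_distrib, Finset.sum_ite_eq, Finset.mem_univ, if_true] at this
    linarith
  have htr : ∑ j, J j j = n * Z := by
    simp only [hK, Finset.sum_add_distrib, hKs, if_true, Finset.sum_const, Finset.card_univ,
      Fintype.card_fin, nsmul_eq_mul]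
    push_cast
    ring
  set N : ℝ := (n : ℝ) + 1 with hN
  have hN0 : 0 < N := by positivity
  have hrow : ∑ j, b j ^ 3 * J l j = (∑ j, b j ^ 3) * K l + b l ^ 3 * Z := by
    simp only [hK, mul_add, Finset.sum_add_distrib, mul_ite, mul_zero, Finset.sum_ite_eq',
      Finset.mem_univ, if_true, Finset.sum_mul]
  set M : ℝ := 2 / N with hM
  have hle : ∑ j, b j ^ 3 * J l j ≤ b l * (2 * M ^ 2) * ∑ j, J j j := by
    simp only [hJ, ← integral_const_mul]
    rw [← integral_finsetSum _ (fun j _ => (hI l j).const_mul _),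
      ← integral_finsetSum _ (fun j _ => hI j j), ← integral_const_mul]
    refine integral_mono (integrable_finsetSum _ (fun j _ => (hI l j).const_mul _))
      ((integrable_finsetSum _ (fun j _ => hI j j)).const_mul _) fun x => ?_
    by_cases hx : gw β F x = 0
    · simp [hx]
    have hp := (gw_ne_zero hβ).1 hx
    have hw := gw_nonneg β F x
    have e1 : ∑ j, b j ^ 3 * (dsp b l x * frc β b j x * gw β F x)
        = dsp b l x * (∑ j, b j ^ 3 * frc β b j x) * gw β F x := by
      rw [Finset.mul_sum, Finset.sum_mul]
      exact Finset.sum_congr rfl fun j _ => by ring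
    have e2 : b l * (2 * M ^ 2) * ∑ j, dsp b j x * frc β b j x * gw β F x
        = b l * (2 * M ^ 2 * ∑ j, dsp b j x * frc β b j x) * gw β F x := by
      rw [← Finset.sum_mul]; ring
    have hS := fun j => pt_S hβ (hb j) (hp j) (hhi j)
    have hS1 : ∑ j, b j ^ 3 * frc β b j x ≤ 0 := by
      calc _ ≤ ∑ j, 2 * β * dsp b j x := Finset.sum_le_sum fun j _ => (hS j).2
        _ = 0 := by rw [← Finset.mul_sum, dsp_sum hbs, mul_zero]
    have hS2 : -(2 * M ^ 2 * ∑ j, dsp b j x * frc β b j x) ≤ ∑ j, b j ^ 3 * frc β b j x := by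
      calc _ = ∑ j, (2 * β * dsp b j x - 2 * M ^ 2 * (dsp b j x * frc β b j x)) := by
            rw [Finset.sum_sub_distrib, ← Finset.mul_sum, ← Finset.mul_sum, dsp_sum hbs]; ring
        _ ≤ _ := Finset.sum_le_sum fun j _ => (hS j).1
    have hd : -b l ≤ dsp b l x := by
      rw [dsp]; have := hp l; linarith
    simp only
    rw [e1, e2]
    refine mul_le_mul_of_nonneg_right ?_ hw
    have hbl := hb l
    nlinarith
  rw [htr, hrow] at hle
  set B := ∑ j, b j ^ 3 with hB
  have hBlo : 1 / (8 * N ^ 2) ≤ B := by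
    calc 1 / (8 * N ^ 2) = ∑ j : Fin (n + 1), (1 / (2 * N)) ^ 3 := by
          simp only [Finset.sum_const, Finset.card_univ, Fintype.card_fin, nsmul_eq_mul]
          push_cast
          rw [← hN]; field_simp; norm_num
      _ ≤ B := Finset.sum_le_sum fun j _ => by
          have := hlo j
          gcongr
  have hB0 : 0 < B := lt_of_lt_of_le (by positivity) hBlo
  have hfin : b l * (2 * M ^ 2) * (n * Z) ≤ 128 * B * Z := by
    have h1 : b l * (2 * M ^ 2) * (n * Z) ≤ M * (2 * M ^ 2) * (N * Z) := by
      have : (n : ℝ) ≤ N := by rw [hN]; linarith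
      have := hhi l
      gcongr
    have h2 : M * (2 * M ^ 2) * (N * Z) = 128 * (1 / (8 * N ^ 2)) * Z := by
      rw [hM]; field_simp; norm_num
    rw [h2] at h1
    refine h1.trans ?_
    gcongr
  have hJl : J l l = K l + Z := by rw [hK]; simp
  rw [← hJ, hJl]
  have h3 : 0 ≤ b l ^ 3 * Z := by have := hb l; positivity
  have h4 : B * (K l + Z) ≤ B * (129 * Z) := by nlinarith
  exact le_of_mul_le_mul_left h4 hB0

lemma mean_est {β F : ℝ} (hβ : 0 < β) (hF : 0 ≤ F) {n : ℕ} {b : Fin (n + 1) → ℝ}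
    (hb : ∀ j, 0 < b j) (hbs : ∑ j, b j = 1) (lam : ℝ)
    (hcrit : ∀ j : Fin (n + 1), β / b j ^ 2 = lam + F * ((j : ℝ) + 1))
    (hlo : ∀ j, 1 / (2 * ((n : ℝ) + 1)) ≤ b j) (hhi : ∀ j, b j ≤ 2 / ((n : ℝ) + 1))
    (l : Fin (n + 1)) :
    |(∫ x : Fin n → ℝ, crd x l * gw β F x) / (∫ x : Fin n → ℝ, gw β F x) - b l|
      ≤ 1 / Real.sqrt ((n : ℝ) + 1) ^ 3 * (1 + 11 / β * 129) := by
  have hen := energy_le hβ hF hb hbs lam hcrit hlo hhi l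
  have hb1 : ∀ j, b j ≤ 1 := by
    intro j
    rw [← hbs]
    exact Finset.single_le_sum (fun k _ => (hb k).le) (Finset.mem_univ j)
  have hZ0 : 0 < ∫ x : Fin n → ℝ, gw β F x := gw_integral_pos hβ hF n
  have hI := int_dsp_frc hβ hF hb hb1 l l
  have hIg : Integrable (fun x : Fin n → ℝ => gw β F x) := by
    have := int_bdd (n := n) hβ hF (q := fun _ => 1) measurable_const 1 (fun _ _ => by simp)
    simpa using this
  have hIc : Integrable (fun x : Fin n → ℝ => crd x l * gw β F x) :=
    int_bdd hβ hF (crd_measurable l) 1 fun x hx => by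
      rw [abs_of_pos (hx l)]; exact crd_le_one hx l
  have hId : Integrable (fun x : Fin n → ℝ => |dsp b l x| * gw β F x) :=
    int_bdd hβ hF (dsp_measurable b l).abs 1 fun x hx => by
      rw [abs_abs]; exact dsp_abs_le hb hb1 l hx
  set Z := ∫ x : Fin n → ℝ, gw β F x with hZ
  set R := Real.sqrt ((n : ℝ) + 1) with hR
  have hR2 : R ^ 2 = (n : ℝ) + 1 := Real.sq_sqrt (by positivity)
  have hR1 : 1 ≤ R := by
    rw [hR, Real.one_le_sqrt]
    have : (0 : ℝ) ≤ n := Nat.cast_nonneg n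
    linarith
  have hR0 : 0 < R := by linarith
  have e1 : (∫ x : Fin n → ℝ, crd x l * gw β F x) / Z - b l
      = (∫ x : Fin n → ℝ, dsp b l x * gw β F x) / Z := by
    have : ∫ x : Fin n → ℝ, dsp b l x * gw β F x
        = (∫ x : Fin n → ℝ, crd x l * gw β F x) - b l * Z := by
      rw [hZ, ← integral_const_mul, ← integral_sub hIc (hIg.const_mul _)]
      refine integral_congr_ae (Eventually.of_forall fun x => ?_)
      simp only [dsp]; ring
    rw [this]; field_simp
  rw [e1, abs_div, abs_of_pos hZ0, div_le_iff₀ hZ0]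
  have e2 : |∫ x : Fin n → ℝ, dsp b l x * gw β F x| ≤ ∫ x : Fin n → ℝ, |dsp b l x| * gw β F x := by
    refine (abs_integral_le_integral_abs).trans (le_of_eq ?_)
    refine integral_congr_ae (Eventually.of_forall fun x => ?_)
    simp only [abs_mul, abs_of_nonneg (gw_nonneg β F x)]
  refine e2.trans ?_
  have e3 : ∫ x : Fin n → ℝ, |dsp b l x| * gw β F x
      ≤ ∫ x : Fin n → ℝ, (1 / R ^ 3 * gw β F x
        + 1 / R ^ 3 * (11 / β) * (dsp b l x * frc β b l x * gw β F x)) := by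
    refine integral_mono hId ((hIg.const_mul _).add (hI.const_mul _)) fun x => ?_
    by_cases hx : gw β F x = 0
    · simp [hx]
    have hp := (gw_ne_zero hβ).1 hx
    have hw := gw_nonneg β F x
    have h := pt_abs hβ (hb l) (hp l) hR1 (by rw [hR2]; exact hhi l)
    have h2 := mul_le_mul_of_nonneg_right h hw
    refine h2.trans (le_of_eq ?_)
    simp only [dsp, frc]; ring
  refine e3.trans ?_
  rw [integral_add (hIg.const_mul _) (hI.const_mul _), integral_const_mul, integral_const_mul, ← hZ]
  calc _ ≤ 1 / R ^ 3 * Z + 1 / R ^ 3 * (11 / β) * (129 * Z) := by gcongr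
    _ = _ := by ring

lemma coulombCoord_eq {n : ℕ} (x : Fin n → ℝ) (j : Fin (n + 1)) :
    coulombCoord (n + 1) ((j : ℕ) + 1) x = crd x j := by
  refine Fin.lastCases ?_ (fun i => ?_) j
  · simp [coulombCoord]
  · simp [coulombCoord]

lemma coulombDomain_iff {n : ℕ} (x : Fin n → ℝ) :
    x ∈ coulombDomain (n + 1) ↔ ∀ j, 0 < crd x j := by
  constructor
  · rintro ⟨h1, h2⟩ j
    refine Fin.lastCases ?_ (fun i => ?_) j
    · simp only [crd_last]
      have h2' : ∑ i : Fin n, x i < 1 := h2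
      linarith
    · simpa using (h1 i).1
  · intro h
    have hl : ∑ i : Fin n, x i < 1 := by
      have := h (Fin.last n)
      simp only [crd_last] at this
      linarith
    refine ⟨fun i => ?_, hl⟩
    have hpos : ∀ i : Fin n, 0 < x i := fun i => by simpa using h (Fin.castSucc i)
    refine ⟨hpos i, lt_of_le_of_lt ?_ hl⟩
    exact Finset.single_le_sum (f := fun i : Fin n => x i) (fun k _ => (hpos k).le) (Finset.mem_univ i)

lemma coulombInt_eq {β : ℝ} (hβ : 0 < β) (F : ℝ) (n : ℕ) (g : (Fin n → ℝ) → ℝ) :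
    coulombInt β F (n + 1) g = ∫ x : Fin n → ℝ, g x * gw β F x := by
  have hD : MeasurableSet (coulombDomain (n + 1)) := by
    have : coulombDomain (n + 1) = ⋂ j, {x : Fin n → ℝ | 0 < crd x j} := by
      ext x
      rw [Set.mem_iInter]
      exact coulombDomain_iff x
    rw [this]
    exact MeasurableSet.iInter fun j => measurableSet_lt measurable_const (crd_measurable j)
  unfold coulombInt
  rw [← integral_indicator hD]
  refine integral_congr_ae (Eventually.of_forall fun x => ?_)
  simp only
  by_cases hx : x ∈ coulombDomain (n + 1)
  · rw [Set.indicator_of_mem hx]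
    have hp := (coulombDomain_iff x).1 hx
    congr 1
    rw [gw]
    simp only [psi_of_pos hβ _ (hp _)]
    rw [← Real.exp_sum, Finset.sum_neg_distrib]
    congr 2
    have h1 : Finset.Icc 1 (n + 1) = Finset.Ico 1 (n + 2) := by
      ext; simp; omega
    rw [h1, Finset.sum_Ico_eq_sum_range]
    have h2 : n + 2 - 1 = n + 1 := by omega
    rw [h2, Finset.sum_range]
    refine Finset.sum_congr rfl fun j _ => ?_
    rw [add_comm 1 (j : ℕ), coulombCoord_eq]
    push_cast
    ring
  · rw [Set.indicator_of_notMem hx]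
    have : gw β F x = 0 := by
      by_contra hc
      exact hx ((coulombDomain_iff x).2 ((gw_ne_zero hβ).1 hc))
    rw [this, mul_zero]

lemma condMean_eq {β : ℝ} (hβ : 0 < β) (F : ℝ) (n : ℕ) (j : Fin (n + 1)) :
    condMean β (n + 1) F ((j : ℕ) + 1)
      = (∫ x : Fin n → ℝ, crd x j * gw β F x) / ∫ x : Fin n → ℝ, gw β F x := by
  unfold condMean
  rw [coulombInt_eq hβ, coulombInt_eq hβ]
  simp only [one_mul]
  congr 2

lemma inv_sqrt_taylor {z : ℝ} (hz : -(1 / 2) ≤ z) :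
    0 ≤ 1 / Real.sqrt (1 + z) - 1 + z / 2 ∧ 1 / Real.sqrt (1 + z) - 1 + z / 2 ≤ z ^ 2 := by
  set r := Real.sqrt (1 + z) with hr
  have hr2 : r ^ 2 = 1 + z := Real.sq_sqrt (by linarith)
  have hr0 : 7 / 10 ≤ r := by
    rw [hr]; apply Real.le_sqrt_of_sq_le; norm_num; linarith
  have hrp : 0 < r := by linarith
  have hz' : z = r ^ 2 - 1 := by linarith
  have e : 1 / r - 1 + z / 2 = (r - 1) ^ 2 * ((r + 2) / (2 * r)) := by
    rw [hz']; field_simp; ring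
  have e2 : z ^ 2 = (r - 1) ^ 2 * (r + 1) ^ 2 := by rw [hz']; ring
  rw [e, e2]
  refine ⟨by positivity, ?_⟩
  gcongr
  rw [div_le_iff₀ (by positivity)]
  nlinarith [mul_nonneg (sub_nonneg.2 hr0) hrp.le, mul_nonneg (mul_nonneg (sub_nonneg.2 hr0) hrp.le) hrp.le]

lemma crit_exists {β γ : ℝ} (hβ : 0 < β) (hγ0 : 0 ≤ γ) (hγ : γ ≤ 1 / 2) (n : ℕ) :
    ∃ (b : Fin (n + 1) → ℝ) (lam : ℝ), (∀ j, 0 < b j) ∧ ∑ j, b j = 1 ∧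
      (∀ j : Fin (n + 1), β / b j ^ 2 = lam + β * ((n : ℝ) + 1) * γ * ((j : ℝ) + 1)) ∧
      (∀ j, 1 / (2 * ((n : ℝ) + 1)) ≤ b j) ∧ (∀ j, b j ≤ 2 / ((n : ℝ) + 1)) ∧
      ∀ j : Fin (n + 1), |((n : ℝ) + 1) * b j -
        (1 - γ / 2 * (((j : ℝ) + 1) / ((n : ℝ) + 1) - 1 / 2))| ≤ γ ^ 2 + 1 / ((n : ℝ) + 1) := by
  set N : ℝ := (n : ℝ) + 1 with hN
  have hN0 : 0 < N := by positivity
  obtain ⟨s, hs⟩ : ∃ s : Fin (n + 1) → ℝ, ∀ j, s j = ((j : ℝ) + 1) / N := ⟨_, fun _ => rfl⟩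
  have hs0 : ∀ j, 0 ≤ s j := fun j => by rw [hs]; positivity
  have hs1 : ∀ j, s j ≤ 1 := fun j => by
    rw [hs, div_le_one hN0, hN]
    have : ((j : ℕ) : ℝ) ≤ n := by exact_mod_cast Nat.lt_succ_iff.1 j.2
    linarith
  have hg0 : ∀ j, 0 ≤ γ * s j := fun j => mul_nonneg hγ0 (hs0 j)
  have hg1 : ∀ j, γ * s j ≤ γ := fun j => mul_le_of_le_one_right hγ0 (hs1 j)
  have hcard : ∑ _j : Fin (n + 1), (1 : ℝ) = N := by simp [hN]
  have hssum : ∑ j, s j = (N + 1) / 2 := by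
    simp only [hs, ← Finset.sum_div]
    rw [div_eq_iff hN0.ne', Finset.sum_add_distrib, hcard]
    have h := Finset.sum_range_id_mul_two (n + 1)
    have h2 : (∑ i : Fin (n + 1), ((i : ℕ) : ℝ)) * 2 = N * n := by
      rw [← Finset.sum_range (fun i => (i : ℝ)), hN]
      rw [Nat.add_sub_cancel] at h
      have h' : (((∑ i ∈ Finset.range (n + 1), i) * 2 : ℕ) : ℝ) = (((n + 1) * n : ℕ) : ℝ) := by rw [h]
      push_cast at h'
      exact h'
    have h3 : (n : ℝ) = N - 1 := by rw [hN]; ring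
    rw [h3] at h2
    linarith
  have hivt : ∃ μ ∈ Set.Icc (1 - γ) 1, ∑ j, 1 / Real.sqrt (μ + γ * s j) = N := by
    have hc : ContinuousOn (fun μ => ∑ j, 1 / Real.sqrt (μ + γ * s j)) (Set.Icc (1 - γ) 1) := by
      refine continuousOn_finsetSum _ fun j _ => ?_
      refine ContinuousOn.div continuousOn_const (by fun_prop) fun μ hμ => ?_
      have := hg0 j
      have := hμ.1
      exact (Real.sqrt_pos.2 (by linarith)).ne'
    have := intermediate_value_Icc' (by linarith) hc
    refine this ⟨?_, ?_⟩
    · rw [← hcard]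
      refine Finset.sum_le_sum fun j _ => ?_
      have := hg0 j
      rw [div_le_one (Real.sqrt_pos.2 (by linarith)), Real.one_le_sqrt]
      linarith
    · rw [← hcard]
      refine Finset.sum_le_sum fun j _ => ?_
      have := hg0 j
      have := hg1 j
      rw [one_le_div (Real.sqrt_pos.2 (by linarith)), Real.sqrt_le_one]
      linarith
  obtain ⟨μ, ⟨hμ0, hμ1⟩, hμ⟩ := hivt
  have hpos : ∀ j, 1 / 2 ≤ μ + γ * s j := fun j => by have := hg0 j; linarith
  have hle : ∀ j, μ + γ * s j ≤ 3 / 2 := fun j => by have := hg1 j; linarith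
  have hsq : ∀ j, 0 < Real.sqrt (μ + γ * s j) := fun j =>
    Real.sqrt_pos.2 (by have := hpos j; linarith)
  have hT : ∀ j, 0 ≤ 1 / Real.sqrt (μ + γ * s j) - 1 + (μ + γ * s j - 1) / 2 ∧
      1 / Real.sqrt (μ + γ * s j) - 1 + (μ + γ * s j - 1) / 2 ≤ γ ^ 2 := by
    intro j
    have h := inv_sqrt_taylor (z := μ + γ * s j - 1) (by have := hpos j; linarith)
    have e : 1 + (μ + γ * s j - 1) = μ + γ * s j := by ring
    rw [e] at h
    refine ⟨h.1, h.2.trans ?_⟩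
    apply sq_le_sq'
    · have := hg0 j; linarith
    · have := hg1 j; linarith
  have hsum : ∑ j, (1 / Real.sqrt (μ + γ * s j) - 1 + (μ + γ * s j - 1) / 2)
      = N * ((μ - 1) / 2 + γ / 4 + γ / (4 * N)) := by
    have : ∀ j, 1 / Real.sqrt (μ + γ * s j) - 1 + (μ + γ * s j - 1) / 2
      = 1 / Real.sqrt (μ + γ * s j) + ((μ - 1) / 2 - 1) * 1 + γ / 2 * s j := fun j => by ring
    simp only [this]
    rw [Finset.sum_add_distrib, Finset.sum_add_distrib, hμ, ← Finset.mul_sum, ← Finset.mul_sum,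
      hcard, hssum]
    field_simp
    ring
  have hθ0 : 0 ≤ (μ - 1) / 2 + γ / 4 + γ / (4 * N) := by
    have h : 0 ≤ N * ((μ - 1) / 2 + γ / 4 + γ / (4 * N)) := by
      rw [← hsum]; exact Finset.sum_nonneg fun j _ => (hT j).1
    exact nonneg_of_mul_nonneg_right h hN0
  have hθ1 : (μ - 1) / 2 + γ / 4 + γ / (4 * N) ≤ γ ^ 2 := by
    have h : N * ((μ - 1) / 2 + γ / 4 + γ / (4 * N)) ≤ N * γ ^ 2 := by
      rw [← hsum]
      calc _ ≤ ∑ _j : Fin (n + 1), γ ^ 2 := Finset.sum_le_sum fun j _ => (hT j).2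
        _ = _ := by simp [hN]
    exact le_of_mul_le_mul_left h hN0
  refine ⟨fun j => 1 / Real.sqrt (μ + γ * s j) / N, β * N ^ 2 * μ, ?_, ?_, ?_, ?_, ?_, ?_⟩
  · intro j; have := hsq j; positivity
  · rw [← Finset.sum_div, hμ, div_self hN0.ne']
  · intro j
    have h1 := hsq j
    have h2 : Real.sqrt (μ + γ * s j) ^ 2 = μ + γ * s j :=
      Real.sq_sqrt (by have := hpos j; linarith)
    have h3 : β / (1 / Real.sqrt (μ + γ * s j) / N) ^ 2
        = β * N ^ 2 * Real.sqrt (μ + γ * s j) ^ 2 := by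
      field_simp
    rw [h3, h2, hs]
    field_simp
  · intro j
    have h1 : Real.sqrt (μ + γ * s j) ≤ 2 := by
      rw [Real.sqrt_le_left (by norm_num)]; have := hle j; linarith
    have h2 := hsq j
    simp only
    rw [div_div]
    gcongr
  · intro j
    have h1 : 1 / 2 ≤ Real.sqrt (μ + γ * s j) := by
      apply Real.le_sqrt_of_sq_le; have := hpos j; linarith
    simp only
    gcongr
    rw [div_le_iff₀ (hsq j)]
    linarith
  · intro j
    have h0 := hT j
    have h1 : N * (1 / Real.sqrt (μ + γ * s j) / N) = 1 / Real.sqrt (μ + γ * s j) := by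
      field_simp
    simp only
    rw [h1, ← hs]
    have h2 : 0 ≤ γ / (4 * N) := by positivity
    have h3 : γ / (4 * N) ≤ 1 / N := by
      rw [div_le_div_iff₀ (by positivity) hN0]; nlinarith
    rw [abs_le]
    constructor <;> linarith [h0.1, h0.2]

/-- Weak subcritical force: asymptotics of the conditional mean spacing. -/
theorem mean_spacing_weak_subcritical (β : ℝ) (hβ : 0 < β)
    (F : ℕ → ℝ) (hF0 : ∀ N, 0 ≤ F N)
    (hF : Tendsto (fun N : ℕ => F N / N) atTop (nhds 0)) :
    ∃ C > 0, ∃ N₀ : ℕ, ∀ N ≥ N₀, ∀ k : ℕ, 1 ≤ k → k ≤ N →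
      0 < 1 - F N / (2 * β * N) * ((k : ℝ) / N - 1 / 2) ∧
      |(N : ℝ) * condMean β N (F N) k /
          (1 - F N / (2 * β * N) * ((k : ℝ) / N - 1 / 2)) - 1| ≤
        C * ((F N) ^ 2 / (N : ℝ) ^ 2 + Real.log N / Real.sqrt N) := by
  have hev : ∀ᶠ N : ℕ in atTop, F N / N < β / 2 :=
    hF.eventually (gt_mem_nhds (by positivity))
  obtain ⟨N₁, hN₁⟩ := eventually_atTop.1 hev
  set C₀ : ℝ := 1 + 11 / β * 129 with hC₀
  have hC₀0 : 0 < C₀ := by positivity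
  refine ⟨2 * (C₀ + 1) + 2 / β ^ 2, by positivity, max N₁ 3, fun N hN k hk1 hkN => ?_⟩
  have hN1 := hN₁ N ((le_max_left _ _).trans hN)
  have hN3 : 3 ≤ N := (le_max_right _ _).trans hN
  obtain ⟨n, rfl⟩ : ∃ n, N = n + 1 := ⟨N - 1, by omega⟩
  obtain ⟨m, rfl⟩ : ∃ m, k = m + 1 := ⟨k - 1, by omega⟩
  obtain ⟨j, rfl⟩ : ∃ j : Fin (n + 1), m = (j : ℕ) := ⟨⟨m, by omega⟩, rfl⟩
  have hN3' : (3 : ℝ) ≤ ((n + 1 : ℕ) : ℝ) := by exact_mod_cast hN3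
  rw [condMean_eq hβ]
  have hf0 := hF0 (n + 1)
  set f := F (n + 1) with hf
  push_cast at hN1 hN3' ⊢
  obtain ⟨γ, hγd⟩ : ∃ γ, γ = f / (β * ((n : ℝ) + 1)) := ⟨_, rfl⟩
  have hγ0 : 0 ≤ γ := by rw [hγd]; positivity
  have hγ1 : γ ≤ 1 / 2 := by
    have : γ = f / ((n : ℝ) + 1) / β := by rw [hγd, mul_comm, div_div]
    rw [this, div_le_iff₀ hβ]; linarith
  have hfγ : f = β * ((n : ℝ) + 1) * γ := by rw [hγd]; field_simp
  obtain ⟨b, lam, hb, hbs, hcrit, hlo, hhi, hexp⟩ := crit_exists hβ hγ0 hγ1 n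
  rw [← hfγ] at hcrit
  have hm := mean_est hβ hf0 hb hbs lam hcrit hlo hhi j
  have hx := hexp j
  set m := (∫ x : Fin n → ℝ, crd x j * gw β f x) / ∫ x : Fin n → ℝ, gw β f x with hmdef
  have hjn : ((j : ℕ) : ℝ) + 1 ≤ (n : ℝ) + 1 := by exact_mod_cast j.2
  set N : ℝ := (n : ℝ) + 1 with hNd
  have hN0 : 0 < N := by linarith
  have hg2 : f / (2 * β * N) = γ / 2 := by rw [hγd]; field_simp
  have hfN : f ^ 2 / N ^ 2 = β ^ 2 * γ ^ 2 := by rw [hfγ]; field_simp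
  rw [hg2, hfN]
  have hs1 : ((j : ℝ) + 1) / N ≤ 1 := by rw [div_le_one hN0]; exact hjn
  set p := 1 - γ / 2 * (((j : ℝ) + 1) / N - 1 / 2) with hp
  have hp2 : 1 / 2 ≤ p := by rw [hp]; nlinarith
  have hp0 : 0 < p := by linarith
  refine ⟨hp0, ?_⟩
  have hR0 : 0 < Real.sqrt N := Real.sqrt_pos.2 hN0
  have hRR : Real.sqrt N * Real.sqrt N = N := Real.mul_self_sqrt hN0.le
  have hlog : 1 ≤ Real.log N := by
    rw [Real.le_log_iff_exp_le hN0]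
    have := Real.exp_one_lt_d9
    linarith
  have h1 : |N * m - N * b j| ≤ 1 / Real.sqrt N * C₀ := by
    rw [← mul_sub, abs_mul, abs_of_pos hN0]
    calc N * |m - b j| ≤ N * (1 / Real.sqrt N ^ 3 * C₀) := by gcongr
      _ = (Real.sqrt N * Real.sqrt N) * (1 / Real.sqrt N ^ 3 * C₀) := by rw [hRR]
      _ = _ := by field_simp
  have h2 : 1 / N ≤ 1 / Real.sqrt N := by
    apply one_div_le_one_div_of_le hR0
    have : 1 ≤ Real.sqrt N := by rw [Real.one_le_sqrt]; linarith
    nlinarith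
  have h3 : |N * m - p| ≤ 1 / Real.sqrt N * (C₀ + 1) + γ ^ 2 := by
    have := abs_sub_le (N * m) (N * b j) p
    linarith
  have h4 : 1 / Real.sqrt N ≤ Real.log N / Real.sqrt N := by gcongr
  have h5 : |N * m / p - 1| ≤ 2 * |N * m - p| := by
    have : N * m / p - 1 = (N * m - p) / p := by field_simp
    rw [this, abs_div, abs_of_pos hp0, div_le_iff₀ hp0]
    nlinarith [abs_nonneg (N * m - p)]
  have h6 : 0 ≤ Real.log N / Real.sqrt N := by positivity
  have h7 : 1 / Real.sqrt N * (C₀ + 1) ≤ Real.log N / Real.sqrt N * (C₀ + 1) := by gcongr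
  have h8 : (2 * (C₀ + 1) + 2 / β ^ 2) * (β ^ 2 * γ ^ 2 + Real.log N / Real.sqrt N)
      = 2 * (C₀ + 1) * (β ^ 2 * γ ^ 2) + 2 * γ ^ 2
        + 2 * (Real.log N / Real.sqrt N * (C₀ + 1)) + 2 / β ^ 2 * (Real.log N / Real.sqrt N) := by
    field_simp
    ring
  rw [h8]
  have h9 : 0 ≤ 2 * (C₀ + 1) * (β ^ 2 * γ ^ 2) := by positivity
  have h10 : 0 ≤ 2 / β ^ 2 * (Real.log N / Real.sqrt N) := by positivity
  linarith
end
end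

section
/- Let β > 0 and let F : ℕ → [0,∞) satisfy F(N)/N → 0 as N → ∞. Then sup_{1 ≤ k ≤ N} | 2β·N³·v_k(N, F(N)) − 1 | → 0 as N → ∞; that is, the conditional variance of each spacing satisfies v_k(N,F(N)) = (1/(2βN³))(1 + o(1)) uniformly in 1 ≤ k ≤ N. -/
open MeasureTheory Filter

noncomputable section

/-! ### Elementary facts about the spacings -/

lemma cc_sum (n : ℕ) (x : Fin (n + 1 - 1) → ℝ) :
    ∑ k ∈ Finset.Icc 1 (n + 1), coulombCoord (n + 1) k x = 1 := by
  rw [Finset.sum_Icc_succ_top (by omega)]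
  have h1 : coulombCoord (n + 1) (n + 1) x = 1 - ∑ i, x i := by
    simp [coulombCoord]
  have h2 : ∑ k ∈ Finset.Icc 1 n, coulombCoord (n + 1) k x = ∑ i, x i := by
    have : Finset.Icc 1 n = (Finset.range n).image (· + 1) := by
      ext a
      simp only [Finset.mem_Icc, Finset.mem_image, Finset.mem_range]
      constructor
      · intro h
        exact ⟨a - 1, by omega, by omega⟩
      · rintro ⟨b, hb, rfl⟩
        omega
    rw [this, Finset.sum_image (by intro a _ b _ h; simpa using h)]
    rw [← Fin.sum_univ_eq_sum_range (fun k => coulombCoord (n + 1) (k + 1) x) n]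
    refine Finset.sum_congr rfl fun i _ => ?_
    simp [coulombCoord]
  rw [h1, h2]
  ring

lemma cc_sum' {N : ℕ} (hN : 1 ≤ N) (x : Fin (N - 1) → ℝ) :
    ∑ k ∈ Finset.Icc 1 N, coulombCoord N k x = 1 := by
  obtain ⟨n, rfl⟩ : ∃ n, N = n + 1 := ⟨N - 1, by omega⟩
  exact cc_sum n x

lemma cc_mem_iff {N : ℕ} (hN : 2 ≤ N) (x : Fin (N - 1) → ℝ) :
    x ∈ coulombDomain N ↔ ∀ k ∈ Finset.Icc 1 N, 0 < coulombCoord N k x := by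
  constructor
  · rintro ⟨h1, h2⟩ k hk
    unfold coulombCoord
    split_ifs with h
    · exact (h1 _).1
    · linarith
  · intro h
    have hpos : ∀ i : Fin (N - 1), 0 < x i := by
      intro i
      have := h (i + 1) (by simp; omega)
      simpa [coulombCoord] using this
    have hs : ∑ i, x i < 1 := by
      have := h N (by simp; omega)
      simpa [coulombCoord] using this
    refine ⟨fun i => ⟨hpos i, ?_⟩, hs⟩
    have := Finset.single_le_sum (fun j _ => (hpos j).le) (Finset.mem_univ i)
    linarith

/-- The direction moving mass from spacing `j` to spacing `k`. -/
def ccDir (N k j : ℕ) : Fin (N - 1) → ℝ := fun p =>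
  (if (p : ℕ) + 1 = k then 1 else 0) - (if (p : ℕ) + 1 = j then 1 else 0)

lemma cc_sum_ind (N k : ℕ) (hk : 1 ≤ k) (hk' : k ≤ N) :
    ∑ p : Fin (N - 1), (if (p : ℕ) + 1 = k then (1 : ℝ) else 0) = if k = N then 0 else 1 := by
  rw [Fin.sum_univ_eq_sum_range (fun p => if p + 1 = k then (1 : ℝ) else 0) (N - 1)]
  obtain ⟨k, rfl⟩ : ∃ m, k = m + 1 := ⟨k - 1, by omega⟩
  simp only [add_left_inj, Finset.sum_ite_eq', Finset.mem_range]
  split_ifs <;> first | rfl | omega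

lemma cc_dir {N k j i : ℕ} (hk : k ∈ Finset.Icc 1 N) (hj : j ∈ Finset.Icc 1 N)
    (hi : i ∈ Finset.Icc 1 N) (x : Fin (N - 1) → ℝ) (t : ℝ) :
    coulombCoord N i (x + t • ccDir N k j) =
      coulombCoord N i x + t * ((if i = k then 1 else 0) - (if i = j then 1 else 0)) := by
  simp only [Finset.mem_Icc] at hk hj hi
  unfold coulombCoord
  split_ifs with h h1 h2 h2 h1 h2 h2 <;>
  simp only [Pi.add_apply, Pi.smul_apply, smul_eq_mul, ccDir, Finset.sum_add_distrib,
    ← Finset.mul_sum, Finset.sum_sub_distrib, cc_sum_ind N k hk.1 hk.2, cc_sum_ind N j hj.1 hj.2]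
  all_goals (repeat' split_ifs) <;> first | omega | ring

lemma cc_cont (N k : ℕ) : Continuous (coulombCoord N k) := by
  unfold coulombCoord
  split_ifs
  · fun_prop
  · fun_prop

lemma cc_le_one {N : ℕ} (hN : 2 ≤ N) {x : Fin (N - 1) → ℝ} (hx : x ∈ coulombDomain N)
    {k : ℕ} (hk : k ∈ Finset.Icc 1 N) : coulombCoord N k x ≤ 1 := by
  rw [← cc_sum' (by omega) x]
  exact Finset.single_le_sum (f := fun k => coulombCoord N k x)
    (fun j hj => ((cc_mem_iff hN x).1 hx j hj).le) hk

lemma cc_open (N : ℕ) : IsOpen (coulombDomain N) := by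
  have : coulombDomain N = (⋂ i, {x | 0 < x i ∧ x i < 1}) ∩ {x | ∑ i, x i < 1} := by
    ext x; simp [coulombDomain]
  rw [this]
  refine IsOpen.inter (isOpen_iInter_of_finite fun i => ?_) (isOpen_lt (by fun_prop) (by fun_prop))
  rw [Set.ofPred_and]
  exact (isOpen_lt (by fun_prop) (by fun_prop)).inter (isOpen_lt (by fun_prop) (by fun_prop))

lemma cc_vol (N : ℕ) : volume (coulombDomain N) < ⊤ := by
  have : coulombDomain N ⊆ Set.Icc 0 1 := by
    rintro x ⟨h, -⟩
    exact ⟨fun i => (h i).1.le, fun i => (h i).2.le⟩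
  exact (measure_mono this).trans_lt isCompact_Icc.measure_lt_top

/-! ### The Gibbs weight and the Gibbs measure -/

/-- The unrestricted Gibbs weight. -/
def ccE (β F : ℝ) (N : ℕ) (x : Fin (N - 1) → ℝ) : ℝ :=
  Real.exp (-(∑ k ∈ Finset.Icc 1 N,
      (β / coulombCoord N k x + F * (k : ℝ) * coulombCoord N k x)))

lemma ccE_pos (β F : ℝ) (N : ℕ) (x : Fin (N - 1) → ℝ) : 0 < ccE β F N x := Real.exp_pos _

lemma ccE_meas (β F : ℝ) (N : ℕ) : Measurable (ccE β F N) := by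
  unfold ccE
  have h : ∀ k, Measurable (coulombCoord N k) := fun k => (cc_cont N k).measurable
  fun_prop

lemma ccE_le_one {β F : ℝ} (hβ : 0 < β) (hF : 0 ≤ F) {N : ℕ} (hN : 2 ≤ N)
    {x : Fin (N - 1) → ℝ} (hx : x ∈ coulombDomain N) : ccE β F N x ≤ 1 := by
  unfold ccE
  rw [Real.exp_le_one_iff, neg_nonpos]
  refine Finset.sum_nonneg fun k hk => ?_
  have := (cc_mem_iff hN x).1 hx k hk
  positivity

/-- The unnormalised Gibbs measure. -/
def ccM (β F : ℝ) (N : ℕ) : Measure (Fin (N - 1) → ℝ) :=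
  (volume.restrict (coulombDomain N)).withDensity (fun x => ENNReal.ofReal (ccE β F N x))

/-- The Gibbs probability measure. -/
def ccP (β F : ℝ) (N : ℕ) : Measure (Fin (N - 1) → ℝ) :=
  (ccM β F N Set.univ)⁻¹ • ccM β F N

lemma ccM_lt_top {β F : ℝ} (hβ : 0 < β) (hF : 0 ≤ F) {N : ℕ} (hN : 2 ≤ N) :
    ccM β F N Set.univ < ⊤ := by
  unfold ccM
  rw [withDensity_apply _ MeasurableSet.univ, Measure.restrict_univ]
  calc _ ≤ ∫⁻ x in coulombDomain N, 1 := by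
        refine setLIntegral_mono measurable_const fun x hx => ?_
        exact ENNReal.ofReal_le_one.2 (ccE_le_one hβ hF hN hx)
    _ < ⊤ := by simpa using cc_vol N

lemma ccM_pos {β F : ℝ} {N : ℕ} (hN : 2 ≤ N) : ccM β F N Set.univ ≠ 0 := by
  unfold ccM
  rw [withDensity_apply _ MeasurableSet.univ, Measure.restrict_univ]
  rw [← pos_iff_ne_zero, setLIntegral_pos_iff (by have := ccE_meas β F N; fun_prop)]
  have : (Function.support fun x => ENNReal.ofReal (ccE β F N x)) = Set.univ := by
    ext x; simp [ccE_pos]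
  rw [this, Set.univ_inter]
  refine (cc_open N).measure_pos _ ⟨fun _ => 1 / N, ?_⟩
  rw [cc_mem_iff hN]
  have hN0 : (0:ℝ) < N := by positivity
  intro k hk
  unfold coulombCoord
  split_ifs
  · positivity
  · simp
    rw [Nat.cast_sub (by omega), ← div_eq_mul_inv, div_lt_one hN0]
    simp

lemma ccP_prob {β F : ℝ} (hβ : 0 < β) (hF : 0 ≤ F) {N : ℕ} (hN : 2 ≤ N) :
    IsProbabilityMeasure (ccP β F N) := by
  constructor
  simp only [ccP, Measure.smul_apply, smul_eq_mul]
  exact ENNReal.inv_mul_cancel (ccM_pos hN) (ccM_lt_top hβ hF hN).ne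

lemma ccP_ae (β F : ℝ) (N : ℕ) : ∀ᵐ x ∂(ccP β F N), x ∈ coulombDomain N := by
  have h : ∀ᵐ x ∂(ccM β F N), x ∈ coulombDomain N := by
    unfold ccM
    exact (withDensity_absolutelyContinuous _ _).ae_le (ae_restrict_mem (cc_open N).measurableSet)
  exact Measure.ae_smul_measure h _

lemma ccM_int (β F : ℝ) (N : ℕ) (g : (Fin (N - 1) → ℝ) → ℝ) :
    ∫ x, g x ∂(ccM β F N) = coulombInt β F N g := by
  unfold ccM coulombInt
  have := integral_withDensity_eq_integral_toReal_smul (μ := volume.restrict (coulombDomain N))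
    (f := fun x => ENNReal.ofReal (ccE β F N x)) (by have := ccE_meas β F N; fun_prop)
    (by simp) g
  rw [this]
  refine integral_congr_ae (Eventually.of_forall fun x => ?_)
  simp only [ENNReal.toReal_ofReal (ccE_pos β F N x).le, smul_eq_mul]
  rw [mul_comm]; rfl

lemma ccP_int (β F : ℝ) (N : ℕ) (g : (Fin (N - 1) → ℝ) → ℝ) :
    ∫ x, g x ∂(ccP β F N) = coulombInt β F N g / coulombInt β F N (fun _ => 1) := by
  unfold ccP
  rw [integral_smul_measure, ccM_int, ← ccM_int β F N (fun _ => 1)]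
  simp [Measure.real, div_eq_inv_mul]

lemma ccP_int_set (β F : ℝ) (N : ℕ) (g : (Fin (N - 1) → ℝ) → ℝ) :
    ∫ x, g x ∂(ccP β F N) = (∫ x, (coulombDomain N).indicator (fun x => g x * ccE β F N x) x) /
      coulombInt β F N (fun _ => 1) := by
  rw [ccP_int, integral_indicator (cc_open N).measurableSet]
  rfl

/-- Comparison by translation. -/
lemma ccP_shift {β F : ℝ} (hβ : 0 < β) (hF : 0 ≤ F) {N : ℕ} (hN : 2 ≤ N)
    (A : Set (Fin (N - 1) → ℝ)) (hA : MeasurableSet A) (v : Fin (N - 1) → ℝ) (g : ℝ)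
    (h : ∀ x ∈ A, x ∈ coulombDomain N → x + v ∈ coulombDomain N ∧
      ccE β F N x ≤ Real.exp (-g) * ccE β F N (x + v)) :
    (ccP β F N).real A ≤ Real.exp (-g) := by
  have key : ccM β F N A ≤ ENNReal.ofReal (Real.exp (-g)) * ccM β F N Set.univ := by
    unfold ccM
    rw [withDensity_apply _ hA, withDensity_apply _ MeasurableSet.univ, Measure.restrict_univ,
      Measure.restrict_restrict hA, ← lintegral_indicator (hA.inter (cc_open N).measurableSet),
      ← lintegral_indicator (cc_open N).measurableSet,
      ← lintegral_add_right_eq_self (fun x => (coulombDomain N).indicator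
        (fun x => ENNReal.ofReal (ccE β F N x)) x) v, ← lintegral_const_mul']
    · refine lintegral_mono fun x => ?_
      by_cases hx : x ∈ A ∩ coulombDomain N
      · obtain ⟨h1, h2⟩ := h x hx.1 hx.2
        simp only [Set.indicator_of_mem hx, Set.indicator_of_mem h1]
        rw [← ENNReal.ofReal_mul (Real.exp_pos _).le]
        exact ENNReal.ofReal_le_ofReal h2
      · simp [Set.indicator_of_notMem hx]
    · simp
  have h2 : ccP β F N A ≤ ENNReal.ofReal (Real.exp (-g)) := by
    simp only [ccP, Measure.smul_apply, smul_eq_mul]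
    calc _ ≤ (ccM β F N Set.univ)⁻¹ * (ENNReal.ofReal (Real.exp (-g)) * ccM β F N Set.univ) := by
          gcongr
      _ = ENNReal.ofReal (Real.exp (-g)) *
          ((ccM β F N Set.univ)⁻¹ * ccM β F N Set.univ) := by ring
      _ = _ := by rw [ENNReal.inv_mul_cancel (ccM_pos hN) (ccM_lt_top hβ hF hN).ne, mul_one]
  exact ENNReal.toReal_le_of_le_ofReal (Real.exp_pos _).le h2

/-! ### Integration by parts -/

lemma ccP_integrable {β F : ℝ} (hβ : 0 < β) (hF : 0 ≤ F) {N : ℕ} (hN : 2 ≤ N)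
    {g : (Fin (N - 1) → ℝ) → ℝ} (hg : Measurable g) {B : ℝ}
    (hB : ∀ x ∈ coulombDomain N, |g x| ≤ B) : Integrable g (ccP β F N) := by
  have := ccP_prob hβ hF hN
  refine Integrable.of_bound hg.aestronglyMeasurable B ?_
  filter_upwards [ccP_ae β F N] with x hx
  exact hB x hx

lemma cc_integrable {β F : ℝ} (hβ : 0 < β) (hF : 0 ≤ F) {N : ℕ} (hN : 2 ≤ N)
    {g : (Fin (N - 1) → ℝ) → ℝ} (hg : Measurable g) {B : ℝ}
    (hB : ∀ x ∈ coulombDomain N, |g x| ≤ B) :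
    Integrable ((coulombDomain N).indicator (fun x => g x * ccE β F N x)) := by
  rw [integrable_indicator_iff (cc_open N).measurableSet]
  have := ccE_meas β F N
  refine Measure.integrableOn_of_bounded (M := B) (cc_vol N).ne
    (hg.mul this).aestronglyMeasurable ?_
  filter_upwards [ae_restrict_mem (cc_open N).measurableSet] with x hx
  rw [Real.norm_eq_abs, abs_mul, abs_of_pos (ccE_pos β F N x)]
  calc |g x| * ccE β F N x ≤ |g x| * 1 := by
        gcongr; exact ccE_le_one hβ hF hN hx
    _ ≤ B := by simpa using hB x hx

lemma ccE_deriv {β F : ℝ} {N : ℕ} (hN : 2 ≤ N) {k j : ℕ}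
    (hk : k ∈ Finset.Icc 1 N) (hj : j ∈ Finset.Icc 1 N)
    {x : Fin (N - 1) → ℝ} (hx : x ∈ coulombDomain N) :
    HasDerivAt (fun t : ℝ => ccE β F N (x + t • ccDir N k j))
      (-((-β / coulombCoord N k x ^ 2 + F * k) - (-β / coulombCoord N j x ^ 2 + F * j))
        * ccE β F N x) 0 := by
  have h1 : ∀ i ∈ Finset.Icc 1 N, HasDerivAt (fun t : ℝ =>
      β / coulombCoord N i (x + t • ccDir N k j) +
        F * (i : ℝ) * coulombCoord N i (x + t • ccDir N k j))
      ((-β / coulombCoord N i x ^ 2 + F * i) *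
        ((if i = k then 1 else 0) - (if i = j then 1 else 0))) 0 := by
    intro i hi
    have hpos := (cc_mem_iff hN x).1 hx i hi
    set d : ℝ := (if i = k then 1 else 0) - (if i = j then 1 else 0) with hd
    have h2 : (fun t : ℝ => coulombCoord N i (x + t • ccDir N k j)) =
        fun t => coulombCoord N i x + t * d := by
      ext t; exact cc_dir hk hj hi x t
    have h3 : HasDerivAt (fun t : ℝ => coulombCoord N i (x + t • ccDir N k j)) d 0 := by
      rw [h2]
      simpa using ((hasDerivAt_id (0:ℝ)).mul_const d).const_add (coulombCoord N i x)
    have h4 := ((h3.fun_inv (by simpa using hpos.ne')).const_mul β).add (h3.const_mul (F * (i:ℝ)))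
    refine (h4.congr_deriv ?_)
    simp only [zero_smul, add_zero]
    ring
  have h5 := (HasDerivAt.fun_sum h1).neg.exp
  refine HasDerivAt.congr_deriv h5 ?_
  simp only [Pi.neg_apply, zero_smul, add_zero, mul_sub, Finset.sum_sub_distrib, mul_ite, mul_one,
    mul_zero, Finset.sum_ite_eq', hk, hj, if_true]
  unfold ccE
  ring

lemma ccP_ibp {β F : ℝ} (hβ : 0 < β) (hF : 0 ≤ F) {N : ℕ} (hN : 2 ≤ N) {k j : ℕ}
    (hk : k ∈ Finset.Icc 1 N) (hj : j ∈ Finset.Icc 1 N) (hkj : k ≠ j) (m : ℝ)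
    (η : ℝ → ℝ) (hη : Differentiable ℝ η) (C : ℝ) (hC : ∀ y, |deriv η y| ≤ C)
    (hη0 : ∀ y, 0 ≤ η y) (hη1 : ∀ y, η y ≤ 1) (hη2 : ∀ y ≤ 1 / 2, η y = 0)
    (G : Set (Fin (N - 1) → ℝ)) (mG : MeasurableSet G)
    (hG : ∀ x ∈ G, ∀ i ∈ Finset.Icc 1 N, η (N * coulombCoord N i x) = 1 ∧
      deriv η (N * coulombCoord N i x) = 0) :
    |(∫ x in G, (coulombCoord N k x - m) * ((-β / coulombCoord N k x ^ 2 + F * k)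
      - (-β / coulombCoord N j x ^ 2 + F * j)) ∂(ccP β F N)) - 1| ≤
    (1 + (1 + (1 + |m|) * (N * C * 1 + 1 * (N * C))) +
      (1 + |m|) * ((β * (4 * N ^ 2) + F * k) + (β * (4 * N ^ 2) + F * j)))
      * (ccP β F N).real Gᶜ := by
  have hN0 : (0:ℝ) < N := by positivity
  have hC0 : 0 ≤ C := (abs_nonneg _).trans (hC 0)
  set q : (Fin (N - 1) → ℝ) → ℝ := fun x => (coulombCoord N k x - m) *
      (η (N * coulombCoord N k x) * η (N * coulombCoord N j x)) with hq
  set q' : (Fin (N - 1) → ℝ) → ℝ := fun x =>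
      η (N * coulombCoord N k x) * η (N * coulombCoord N j x) +
      (coulombCoord N k x - m) * (N * deriv η (N * coulombCoord N k x) * η (N * coulombCoord N j x)
        - η (N * coulombCoord N k x) * (N * deriv η (N * coulombCoord N j x))) with hq'
  set V : (Fin (N - 1) → ℝ) → ℝ := fun x =>
    ((-β / coulombCoord N k x ^ 2 + F * k) - (-β / coulombCoord N j x ^ 2 + F * j)) with hV
  have mc : ∀ i, Measurable (coulombCoord N i) := fun i => (cc_cont N i).measurable
  have mη : Measurable η := hη.continuous.measurable
  have mη' : Measurable (deriv η) := measurable_deriv η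
  have mq : Measurable q := by fun_prop
  have mq' : Measurable q' := by fun_prop
  have mV : Measurable V := by fun_prop
  have aη : ∀ y, |η y| ≤ 1 := fun y => abs_le.2 ⟨by linarith [hη0 y], hη1 y⟩
  have bX : ∀ x ∈ coulombDomain N, |coulombCoord N k x - m| ≤ 1 + |m| := by
    intro x hx
    have h1 := cc_le_one hN hx hk
    have h2 := (cc_mem_iff hN x).1 hx k hk
    refine (abs_sub _ _).trans ?_
    rw [abs_of_pos h2]; gcongr
  have bηη : ∀ y z, |η y * η z| ≤ 1 := by
    intro y z
    rw [abs_mul]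
    exact mul_le_one₀ (aη y) (abs_nonneg _) (aη z)
  have bq : ∀ x ∈ coulombDomain N, |q x| ≤ 1 + |m| := by
    intro x hx
    rw [hq]
    simp only []
    rw [abs_mul]
    calc _ ≤ (1 + |m|) * 1 := by gcongr; exacts [bX x hx, bηη _ _]
      _ = _ := by ring
  have bq' : ∀ x ∈ coulombDomain N, |q' x| ≤ 1 + (1 + |m|) * (N * C * 1 + 1 * (N * C)) := by
    intro x hx
    rw [hq']
    simp only []
    refine (abs_add_le _ _).trans ?_
    rw [abs_mul (coulombCoord N k x - m)]
    gcongr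
    · exact bηη _ _
    · exact bX x hx
    · refine (abs_sub _ _).trans ?_
      simp only [abs_mul, Nat.abs_cast]
      gcongr
      all_goals first | exact hC _ | exact aη _
  have bV : ∀ x ∈ coulombDomain N, |q x * V x| ≤
      (1 + |m|) * ((β * (4 * N ^ 2) + F * k) + (β * (4 * N ^ 2) + F * j)) := by
    intro x hx
    by_cases h0 : η (N * coulombCoord N k x) * η (N * coulombCoord N j x) = 0
    · have : q x = 0 := by simp only [hq, h0, mul_zero]
      rw [this, zero_mul, abs_zero]
      positivity
    · have h1 : ∀ i, η (N * coulombCoord N i x) ≠ 0 → |-β / coulombCoord N i x ^ 2 + F * i| ≤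
          β * (4 * N ^ 2) + F * i := by
        intro i hi
        have h2 : 1 / 2 < N * coulombCoord N i x := by
          by_contra hcon
          exact hi (hη2 _ (not_lt.1 hcon))
        have h3 : 0 < coulombCoord N i x := by
          by_contra hcon
          nlinarith
        refine (abs_add_le _ _).trans ?_
        rw [abs_of_nonneg (by positivity : 0 ≤ F * (i:ℝ)), neg_div, abs_neg,
          abs_of_pos (by positivity)]
        gcongr
        rw [div_le_iff₀ (by positivity), mul_assoc]
        refine le_mul_of_one_le_right hβ.le ?_
        nlinarith
      rw [abs_mul]
      gcongr
      · exact bq x hx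
      · refine (abs_sub _ _).trans ?_
        gcongr
        · exact h1 k (left_ne_zero_of_mul h0)
        · exact h1 j (right_ne_zero_of_mul h0)
  have i1 : Integrable q' (ccP β F N) := ccP_integrable hβ hF hN mq' bq'
  have i2 : Integrable (fun x => q x * V x) (ccP β F N) :=
    ccP_integrable hβ hF hN (mq.mul mV) bV
  suffices hmain : ∫ x, q' x ∂(ccP β F N) = ∫ x, q x * V x ∂(ccP β F N) by
    have hp := ccP_prob hβ hF hN
    rw [← integral_add_compl mG i1, ← integral_add_compl mG i2] at hmain
    have g1 : ∫ x in G, q' x ∂(ccP β F N) = 1 - (ccP β F N).real Gᶜ := by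
      rw [setIntegral_congr_fun (g := fun _ => (1:ℝ)) mG, setIntegral_const,
        probReal_compl_eq_one_sub mG]
      · simp
      · intro x hx
        simp [hq', (hG x hx k hk).1, (hG x hx k hk).2, (hG x hx j hj).1, (hG x hx j hj).2]
    have g2 : ∫ x in G, (coulombCoord N k x - m) * ((-β / coulombCoord N k x ^ 2 + F * k)
      - (-β / coulombCoord N j x ^ 2 + F * j)) ∂(ccP β F N) =
        ∫ x in G, q x * V x ∂(ccP β F N) := by
      refine setIntegral_congr_fun mG fun x hx => ?_
      simp [hq, hV, (hG x hx k hk).1, (hG x hx j hj).1]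
    have g3 := norm_setIntegral_le_of_norm_le_const_ae' (μ := ccP β F N) (s := Gᶜ) (f := q')
      (C := 1 + (1 + |m|) * (N * C * 1 + 1 * (N * C))) (measure_lt_top _ _) (by
        filter_upwards [ccP_ae β F N] with x hx _
        exact bq' x hx)
    have g4 := norm_setIntegral_le_of_norm_le_const_ae' (μ := ccP β F N) (s := Gᶜ)
      (f := fun x => q x * V x)
      (C := (1 + |m|) * ((β * (4 * N ^ 2) + F * k) + (β * (4 * N ^ 2) + F * j)))
      (measure_lt_top _ _) (by
        filter_upwards [ccP_ae β F N] with x hx _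
        exact bV x hx)
    rw [Real.norm_eq_abs, abs_le] at g3 g4
    rw [g2, abs_le]
    have g5 : 0 ≤ (ccP β F N).real Gᶜ := measureReal_nonneg
    constructor <;> linarith [g3.1, g3.2, g4.1, g4.2]
  rw [← sub_eq_zero, ← integral_sub i1 i2, ccP_int_set]
  have if' : Integrable ((coulombDomain N).indicator (fun x => (q' x - q x * V x) * ccE β F N x)) :=
    cc_integrable hβ hF hN (mq'.sub (mq.mul mV)) (B := _) (fun x hx =>
      (abs_sub _ _).trans (add_le_add (bq' x hx) (bV x hx)))
  have if0 : Integrable ((coulombDomain N).indicator (fun x => q x * ccE β F N x)) :=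
    cc_integrable hβ hF hN mq bq
  have hline : ∀ x, HasLineDerivAt ℝ ((coulombDomain N).indicator (fun x => q x * ccE β F N x))
      ((coulombDomain N).indicator (fun x => (q' x - q x * V x) * ccE β F N x) x) x
      (ccDir N k j) := by
    intro x
    unfold HasLineDerivAt
    have ek : (fun t : ℝ => coulombCoord N k (x + t • ccDir N k j)) =
        fun t => coulombCoord N k x + t := by
      ext t; rw [cc_dir hk hj hk]; simp [hkj]
    have ej : (fun t : ℝ => coulombCoord N j (x + t • ccDir N k j)) =
        fun t => coulombCoord N j x - t := by
      ext t; rw [cc_dir hk hj hj]; simp [hkj.symm]; ring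
    by_cases hx : x ∈ coulombDomain N
    · rw [Set.indicator_of_mem hx]
      have hcont : Continuous (fun t : ℝ => x + t • ccDir N k j) := by fun_prop
      have hev : ∀ᶠ t in nhds (0:ℝ), x + t • ccDir N k j ∈ coulombDomain N := by
        refine hcont.continuousAt.eventually_mem ((cc_open N).mem_nhds ?_)
        simpa using hx
      have hd : HasDerivAt (fun t : ℝ => q (x + t • ccDir N k j) * ccE β F N (x + t • ccDir N k j))
          ((q' x - q x * V x) * ccE β F N x) 0 := by
        have dk : HasDerivAt (fun t : ℝ => coulombCoord N k (x + t • ccDir N k j)) 1 0 := by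
          rw [ek]; simpa using (hasDerivAt_id (0:ℝ)).const_add (coulombCoord N k x)
        have dj : HasDerivAt (fun t : ℝ => coulombCoord N j (x + t • ccDir N k j)) (-1) 0 := by
          rw [ej]; simpa using (hasDerivAt_id (0:ℝ)).const_sub (coulombCoord N j x)
        have e1 := HasDerivAt.comp (0:ℝ) (hη _).hasDerivAt (dk.const_mul (N:ℝ))
        have e2 := HasDerivAt.comp (0:ℝ) (hη _).hasDerivAt (dj.const_mul (N:ℝ))
        have e3 := ((dk.sub_const m).mul (e1.mul e2)).mul (ccE_deriv (β := β) (F := F) hN hk hj hx)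
        refine HasDerivAt.congr_deriv e3 ?_
        simp only [Function.comp, zero_smul, add_zero, hq, hq', hV, Pi.mul_apply]
        ring
      refine hd.congr_of_eventuallyEq ?_
      filter_upwards [hev] with t ht
      rw [Set.indicator_of_mem ht]
    · rw [Set.indicator_of_notMem hx]
      have hz : (fun t : ℝ => (coulombDomain N).indicator (fun x => q x * ccE β F N x)
          (x + t • ccDir N k j)) =ᶠ[nhds 0] fun _ => 0 := by
        rw [cc_mem_iff hN] at hx
        push Not at hx
        obtain ⟨i, hi, hix⟩ := hx
        by_cases hik : i = k
        · subst hik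
          have : ∀ᶠ t : ℝ in nhds (0:ℝ), t < 1 / (2 * N) := Iio_mem_nhds (by positivity)
          filter_upwards [this] with t ht
          refine Set.indicator_apply_eq_zero.2 fun _ => ?_
          have e := congrFun ek t
          simp only [hq]
          rw [e, hη2 (N * (coulombCoord N i x + t))]
          · simp
          · rw [lt_div_iff₀ (by positivity)] at ht
            nlinarith
        by_cases hij : i = j
        · subst hij
          have : ∀ᶠ t : ℝ in nhds (0:ℝ), -(1 / (2 * N)) < t := Ioi_mem_nhds (by
            rw [neg_lt_zero]; positivity)
          filter_upwards [this] with t ht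
          refine Set.indicator_apply_eq_zero.2 fun _ => ?_
          have e := congrFun ej t
          simp only [hq]
          rw [e, hη2 (N * (coulombCoord N i x - t))]
          · simp
          · rw [neg_lt, lt_div_iff₀ (by positivity)] at ht
            nlinarith
        · refine Eventually.of_forall fun t => ?_
          refine Set.indicator_of_notMem (fun hmem => ?_) _
          have := (cc_mem_iff hN _).1 hmem i hi
          rw [cc_dir hk hj hi] at this
          simp [hik, hij] at this
          linarith
      exact (hasDerivAt_const (0:ℝ) (0:ℝ)).congr_of_eventuallyEq hz
  have key := integral_bilinear_hasLineDerivAt_right_eq_neg_left_of_integrable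
    (μ := (volume : Measure (Fin (N - 1) → ℝ)))
    (f := fun _ => (1:ℝ)) (f' := fun _ => (0:ℝ)) (v := ccDir N k j)
    (g := (coulombDomain N).indicator (fun x => q x * ccE β F N x))
    (g' := (coulombDomain N).indicator (fun x => (q' x - q x * V x) * ccE β F N x))
    (B := ContinuousLinearMap.mul ℝ ℝ) (by simp) (by simpa using if') (by simpa using if0)
    (fun x _ => hasDerivAt_const (0:ℝ) (1:ℝ)) (fun x _ => hline x)
  simp only [ContinuousLinearMap.mul_apply', one_mul, zero_mul, integral_zero, neg_zero] at key
  rw [key, zero_div]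

/-! ### Concentration -/

lemma ccE_shift {β F : ℝ} {N : ℕ} {k j : ℕ}
    (hk : k ∈ Finset.Icc 1 N) (hj : j ∈ Finset.Icc 1 N) (hjk : j ≠ k) (t : ℝ)
    (x : Fin (N - 1) → ℝ) :
    ccE β F N x = Real.exp (-((β / coulombCoord N j x - β / (coulombCoord N j x + t)) +
      (β / coulombCoord N k x - β / (coulombCoord N k x - t)) + F * t * (k - j))) *
      ccE β F N (x + t • ccDir N j k) := by
  unfold ccE
  rw [← Real.exp_add, Real.exp_eq_exp, ← neg_add, neg_inj, ← sub_eq_iff_eq_add,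
    ← Finset.sum_sub_distrib]
  rw [Finset.sum_eq_add_of_mem j k hj hk hjk]
  · rw [cc_dir hj hk hj, cc_dir hj hk hk]
    simp [hjk, hjk.symm]
    ring
  · rintro i hi ⟨h1, h2⟩
    rw [cc_dir hj hk hi]
    simp [h1, h2]

lemma ccP_pair {β : ℝ} (hβ : 0 < β) {a b : ℝ} (ha : 0 < a) (hab : a < b) :
    ∃ κ > (0:ℝ), ∃ γ > (0:ℝ), ∀ N : ℕ, 2 ≤ N → ∀ F : ℝ, 0 ≤ F → F ≤ γ * N →
      ∀ j ∈ Finset.Icc 1 N, ∀ k ∈ Finset.Icc 1 N,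
      (ccP β F N).real {x | N * coulombCoord N j x ≤ a ∧ b ≤ N * coulombCoord N k x} ≤
        Real.exp (-(κ * N)) := by
  have hb : 0 < b := ha.trans hab
  set c := (a + b) / 2 with hc
  have hc0 : 0 < c := by positivity
  set h := (b - a) / 2 with hh
  have hh0 : 0 < h := by rw [hh]; linarith
  set γ := β * (1 / (a * c) - 1 / (b * c)) / 2 with hγ
  have hγ0 : 0 < γ := by
    have : 1 / (b * c) < 1 / (a * c) := by gcongr
    rw [hγ]
    have : 0 < 1 / (a * c) - 1 / (b * c) := by linarith
    positivity
  refine ⟨h * γ, by positivity, γ, hγ0, ?_⟩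
  intro N hN F hF hFN j hj k hk
  have hN0 : (0:ℝ) < N := by positivity
  by_cases hjk : j = k
  · subst hjk
    have : {x | N * coulombCoord N j x ≤ a ∧ b ≤ N * coulombCoord N j x} = ∅ := by
      ext x
      simp only [Set.mem_ofPred_eq, Set.mem_empty_iff_false, iff_false, not_and, not_le]
      intro h; linarith
    rw [this]
    simp only [measureReal_empty]
    positivity
  have mc : ∀ i, Measurable (coulombCoord N i) := fun i => (cc_cont N i).measurable
  refine ccP_shift hβ hF hN _ ?_ ((h / N) • ccDir N j k) _ ?_
  · rw [Set.ofPred_and]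
    exact (measurableSet_le (by fun_prop) (by fun_prop)).inter
      (measurableSet_le (by fun_prop) (by fun_prop))
  · rintro x ⟨h1, h2⟩ hx
    rw [cc_mem_iff hN] at hx
    set t := h / N with ht
    have ht0 : 0 < t := by positivity
    have htN : N * t = h := by rw [ht]; field_simp
    have xj := hx j hj
    have xk := hx k hk
    set y := coulombCoord N j x with hy
    set z := coulombCoord N k x with hz
    have zt : N * (z - t) ≥ c := by rw [mul_sub, htN, hc]; linarith
    have yt : N * (y + t) ≤ c := by rw [mul_add, htN, hc]; linarith
    have zt0 : 0 < z - t := by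
      by_contra hcon
      nlinarith
    constructor
    · rw [cc_mem_iff hN]
      intro i hi
      rw [cc_dir hj hk hi]
      by_cases hij : i = j
      · subst hij
        simp only [if_true, hjk, if_false]
        linarith
      by_cases hik : i = k
      · subst hik
        simp only [if_true, hij, if_false]
        linarith
      · simpa [hij, hik] using hx i hi
    · rw [ccE_shift hk hj hjk t x]
      refine mul_le_mul_of_nonneg_right ?_ (ccE_pos _ _ _ _).le
      rw [Real.exp_le_exp, neg_le_neg_iff]
      have p1 : β / y - β / (y + t) = β * t / (y * (y + t)) := by
        field_simp
        ring
      have p2 : β / z - β / (z - t) = - (β * t / (z * (z - t))) := by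
        field_simp
        ring
      have q1 : β * t * (N ^ 2 / (a * c)) ≤ β * t / (y * (y + t)) := by
        rw [div_eq_mul_one_div (β * t)]
        refine mul_le_mul_of_nonneg_left ?_ (by positivity)
        rw [div_le_div_iff₀ (by positivity) (by positivity)]
        calc (N:ℝ) ^ 2 * (y * (y + t)) = (N * y) * (N * (y + t)) := by ring
          _ ≤ a * c := by gcongr
          _ = _ := by ring
      have q2 : β * t / (z * (z - t)) ≤ β * t * (N ^ 2 / (b * c)) := by
        rw [div_eq_mul_one_div (β * t)]
        refine mul_le_mul_of_nonneg_left ?_ (by positivity)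
        rw [div_le_div_iff₀ (by positivity) (by positivity)]
        calc 1 * (b * c) = b * c := by ring
          _ ≤ (N * z) * (N * (z - t)) := by gcongr
          _ = _ := by ring
      have q3 : -(γ * N * t * N) ≤ F * t * (k - j) := by
        have kj : -(N:ℝ) ≤ (k:ℝ) - j := by
          have : (j:ℝ) ≤ N := by exact_mod_cast (Finset.mem_Icc.1 hj).2
          have : (0:ℝ) ≤ k := by positivity
          linarith
        have : F * t ≤ γ * N * t := by gcongr
        have h3 : 0 ≤ F * t := by positivity
        nlinarith
      rw [p1, p2]
      have e1 : β * t * (N ^ 2 / (a * c)) - β * t * (N ^ 2 / (b * c)) = 2 * γ * t * N ^ 2 := by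
        rw [hγ]; ring
      have e2 : h * γ * N = γ * t * N ^ 2 := by rw [← htN]; ring
      rw [e2]
      nlinarith

/-- The good event. -/
def ccG (N : ℕ) (ε : ℝ) : Set (Fin (N - 1) → ℝ) :=
  {x | ∀ i ∈ Finset.Icc 1 N, |N * coulombCoord N i x - 1| < ε}

lemma ccG_meas (N : ℕ) (ε : ℝ) : MeasurableSet (ccG N ε) := by
  have mc : ∀ i, Measurable (coulombCoord N i) := fun i => (cc_cont N i).measurable
  have : ccG N ε = ⋂ i ∈ Finset.Icc 1 N, {x | |N * coulombCoord N i x - 1| < ε} := by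
    ext x; simp [ccG]
  rw [this]
  refine Finset.measurableSet_biInter _ fun i _ => ?_
  exact measurableSet_lt (by fun_prop) (by fun_prop)

lemma ccP_bad {β : ℝ} (hβ : 0 < β) {ε : ℝ} (hε : 0 < ε) (hε1 : ε < 1) :
    ∃ κ > (0:ℝ), ∃ γ > (0:ℝ), ∀ N : ℕ, 2 ≤ N → ∀ F : ℝ, 0 ≤ F → F ≤ γ * N →
      (ccP β F N).real (ccG N ε)ᶜ ≤ 2 * N ^ 2 * Real.exp (-(κ * N)) := by
  obtain ⟨κ₁, hκ₁, γ₁, hγ₁, H1⟩ := ccP_pair hβ (a := 1) (b := 1 + ε) one_pos (by linarith)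
  obtain ⟨κ₂, hκ₂, γ₂, hγ₂, H2⟩ := ccP_pair hβ (a := 1 - ε) (b := 1) (by linarith) (by linarith)
  refine ⟨min κ₁ κ₂, lt_min hκ₁ hκ₂, min γ₁ γ₂, lt_min hγ₁ hγ₂, ?_⟩
  intro N hN F hF hFN
  have hN0 : (0:ℝ) < N := by positivity
  have hp := ccP_prob hβ hF hN
  have F1 : F ≤ γ₁ * N := hFN.trans (by gcongr; exact min_le_left _ _)
  have F2 : F ≤ γ₂ * N := hFN.trans (by gcongr; exact min_le_right _ _)
  set I := Finset.Icc 1 N with hI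
  set A : ℕ × ℕ → Set (Fin (N - 1) → ℝ) := fun p =>
    {x | N * coulombCoord N p.1 x ≤ 1 ∧ 1 + ε ≤ N * coulombCoord N p.2 x} ∪
    {x | N * coulombCoord N p.1 x ≤ 1 - ε ∧ 1 ≤ N * coulombCoord N p.2 x} with hA
  have hsub : (ccG N ε)ᶜ ⊆ ⋃ p ∈ I ×ˢ I, A p := by
    intro x hx
    simp only [ccG, Set.mem_compl_iff, Set.mem_ofPred_eq, not_forall, not_lt] at hx
    obtain ⟨i, hi, hix⟩ := hx
    have hs := cc_sum' (by omega : 1 ≤ N) x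
    have hcard : (I.card : ℝ) = N := by simp [hI]
    have hlow : ∃ j ∈ I, N * coulombCoord N j x ≤ 1 := by
      refine Finset.exists_le_of_sum_le (g := fun _ => (1:ℝ)) ⟨1, by simp [hI]; omega⟩ ?_
      rw [← Finset.mul_sum, hs]; simp [hcard]
    have hhigh : ∃ j ∈ I, 1 ≤ N * coulombCoord N j x := by
      refine Finset.exists_le_of_sum_le (f := fun _ => (1:ℝ)) ⟨1, by simp [hI]; omega⟩ ?_
      rw [← Finset.mul_sum, hs]; simp [hcard]
    simp only [Set.mem_iUnion]
    rcases le_abs.1 hix with h | h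
    · obtain ⟨j, hj, hjx⟩ := hlow
      exact ⟨(j, i), Finset.mem_product.2 ⟨hj, hi⟩, Or.inl ⟨hjx, by simp only; linarith⟩⟩
    · obtain ⟨j, hj, hjx⟩ := hhigh
      exact ⟨(i, j), Finset.mem_product.2 ⟨hi, hj⟩, Or.inr ⟨by simp only; linarith, hjx⟩⟩
  calc (ccP β F N).real (ccG N ε)ᶜ ≤ (ccP β F N).real (⋃ p ∈ I ×ˢ I, A p) :=
        measureReal_mono hsub (measure_ne_top _ _)
    _ ≤ ∑ p ∈ I ×ˢ I, (ccP β F N).real (A p) := measureReal_biUnion_finset_le _ _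
    _ ≤ ∑ p ∈ I ×ˢ I, 2 * Real.exp (-(min κ₁ κ₂ * N)) := by
        refine Finset.sum_le_sum fun p hp => ?_
        rw [Finset.mem_product] at hp
        refine (measureReal_union_le _ _).trans ?_
        have a1 := H1 N hN F hF F1 p.1 hp.1 p.2 hp.2
        have a2 := H2 N hN F hF F2 p.1 hp.1 p.2 hp.2
        have b1 : Real.exp (-(κ₁ * N)) ≤ Real.exp (-(min κ₁ κ₂ * N)) := by
          gcongr; exact min_le_left _ _
        have b2 : Real.exp (-(κ₂ * N)) ≤ Real.exp (-(min κ₁ κ₂ * N)) := by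
          gcongr; exact min_le_right _ _
        linarith
    _ = 2 * N ^ 2 * Real.exp (-(min κ₁ κ₂ * N)) := by
        rw [Finset.sum_const, Finset.card_product]
        simp [hI]
        ring

/-! ### The abstract variance computation -/

lemma cc_lin {β N ε x m : ℝ} (hβ : 0 < β) (hN : 0 < N) (hε : ε ≤ 1 / 160)
    (hx : |N * x - 1| ≤ ε) (hm : |N * m - 1| ≤ 2 * ε) :
    |(-β / x ^ 2 + β / m ^ 2) - 2 * β * N ^ 3 * (x - m)| ≤
      20 * ε * (2 * β * N ^ 3) * |x - m| := by
  have hε0 : 0 ≤ ε := (abs_nonneg _).trans hx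
  rw [abs_le] at hx hm
  obtain ⟨y, hy⟩ : ∃ y, y = N * x := ⟨_, rfl⟩
  obtain ⟨u, hu⟩ : ∃ u, u = N * m := ⟨_, rfl⟩
  rw [← hy] at hx
  rw [← hu] at hm
  have y0 : 9 / 10 ≤ y := by linarith
  have u0 : 9 / 10 ≤ u := by linarith
  have y1 : y ≤ 11 / 10 := by linarith
  have u1 : u ≤ 11 / 10 := by linarith
  have ex : x = y / N := by rw [hy]; field_simp
  have em : m = u / N := by rw [hu]; field_simp
  have yp : 0 < y := by linarith
  have up : 0 < u := by linarith
  have e : (-β / x ^ 2 + β / m ^ 2) - 2 * β * N ^ 3 * (x - m) =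
      ((y + u) / (2 * (y * u) ^ 2) - 1) * (2 * β * N ^ 3) * (x - m) := by
    rw [ex, em]
    field_simp
    ring
  rw [e, abs_mul, abs_mul, abs_of_pos (by positivity : 0 < 2 * β * N ^ 3)]
  gcongr
  have w1 : -(4 * ε) ≤ y * u - 1 := by nlinarith
  have w2 : y * u - 1 ≤ 4 * ε := by nlinarith
  have w3 : 8 / 10 ≤ y * u := by nlinarith
  have w4 : y * u ≤ 122 / 100 := by nlinarith
  rw [div_sub_one (by positivity), abs_div, abs_of_pos (by positivity : 0 < 2 * (y * u) ^ 2),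
    div_le_iff₀ (by positivity)]
  have w5 : (64 / 100 : ℝ) ≤ (y * u) ^ 2 := by nlinarith
  have w6 : 20 * ε * (2 * (64 / 100)) ≤ 20 * ε * (2 * (y * u) ^ 2) := by gcongr
  refine le_trans ?_ w6
  have w7 : (y * u) ^ 2 - 1 ≤ (9 : ℝ) * ε := by nlinarith
  have w8 : -(9 * ε) ≤ (y * u) ^ 2 - 1 := by nlinarith
  rw [abs_le]
  constructor <;> linarith [hx.1, hx.2, hm.1, hm.2]

set_option maxHeartbeats 3200000 in
lemma cc_core {Ω : Type*} [MeasurableSpace Ω] (P : Measure Ω) [IsProbabilityMeasure P]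
    {N : ℕ} (hN : 2 ≤ N) (X : ℕ → Ω → ℝ) (mX : ∀ i, Measurable (X i))
    (hX : ∀ᵐ ω ∂P, ∀ i ∈ Finset.Icc 1 N, 0 < X i ω ∧ X i ω ≤ 1)
    (hsum : ∀ ω, ∑ i ∈ Finset.Icc 1 N, X i ω = 1)
    {β F ε δ C : ℝ} (hβ : 0 < β) (hF : 0 ≤ F) (hFN : F ≤ N) (hε0 : 0 < ε) (hε : ε ≤ 1 / 160)
    (G : Set Ω) (mG : MeasurableSet G)
    (hG : ∀ ω ∈ G, ∀ i ∈ Finset.Icc 1 N, |N * X i ω - 1| ≤ ε)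
    (hδ : P.real Gᶜ ≤ δ) (hδε : N * δ ≤ ε)
    (m : ℕ → ℝ) (hm : ∀ i, m i = ∫ ω, X i ω ∂P)
    (hibp : ∀ k ∈ Finset.Icc 1 N, ∀ j ∈ Finset.Icc 1 N, k ≠ j →
      |(∫ ω in G, (X k ω - m k) * ((-β / X k ω ^ 2 + F * k) - (-β / X j ω ^ 2 + F * j)) ∂P) - 1|
        ≤ C * N ^ 2 * δ)
    (hsmall : (C + 8 * β + 1) * N ^ 2 * δ + 1 / N ≤ 1 / 2)
    (k : ℕ) (hk : k ∈ Finset.Icc 1 N) :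
    |2 * β * N ^ 3 * (∫ ω, (X k ω - m k) ^ 2 ∂P) - 1| ≤
      80 * ε + ((C + 8 * β + 1) * N ^ 2 * δ + 1 / N) + 2 * β * N ^ 3 * δ := by
  set I := Finset.Icc 1 N with hI
  have hN0 : (0:ℝ) < N := by positivity
  have hδ0 : 0 ≤ δ := measureReal_nonneg.trans hδ
  set L : ℝ := 2 * β * N ^ 3 with hL
  have hL0 : 0 < L := by positivity
  have iX : ∀ i ∈ I, Integrable (X i) P := by
    intro i hi
    refine Integrable.of_bound (mX i).aestronglyMeasurable 1 ?_
    filter_upwards [hX] with ω hω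
    rw [Real.norm_eq_abs, abs_of_pos (hω i hi).1]
    exact (hω i hi).2
  have m0 : ∀ i ∈ I, 0 ≤ m i := by
    intro i hi
    rw [hm]
    refine integral_nonneg_of_ae ?_
    filter_upwards [hX] with ω hω
    exact (hω i hi).1.le
  have m1 : ∀ i ∈ I, m i ≤ 1 := by
    intro i hi
    rw [hm]
    calc ∫ ω, X i ω ∂P ≤ ∫ ω, (1:ℝ) ∂P := by
          refine integral_mono_ae (iX i hi) (integrable_const _) ?_
          filter_upwards [hX] with ω hω
          exact (hω i hi).2
      _ = 1 := by simp
  set D : ℕ → Ω → ℝ := fun i ω => X i ω - m i with hD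
  have mD : ∀ i, Measurable (D i) := fun i => (mX i).sub_const _
  have bD : ∀ᵐ ω ∂P, ∀ i ∈ I, |D i ω| ≤ 1 := by
    filter_upwards [hX] with ω hω i hi
    rw [abs_le]
    constructor <;> simp only [hD] <;> linarith [(hω i hi).1, (hω i hi).2, m0 i hi, m1 i hi]
  have iD : ∀ i ∈ I, Integrable (D i) P := fun i hi => (iX i hi).sub (integrable_const _)
  have zD : ∀ i ∈ I, ∫ ω, D i ω ∂P = 0 := by
    intro i hi
    rw [integral_sub (iX i hi) (integrable_const _), ← hm]
    simp
  have sm : ∑ i ∈ I, m i = 1 := by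
    simp only [hm]
    rw [← integral_finsetSum _ iX]
    simp [hsum]
  have sD : ∀ ω, ∑ i ∈ I, D i ω = 0 := by
    intro ω
    simp only [hD]
    rw [Finset.sum_sub_distrib, hsum, sm, sub_self]
  -- the means are close to `1/N`
  have hmN : ∀ i ∈ I, |N * m i - 1| ≤ 2 * ε := by
    intro i hi
    have e1 : N * m i - 1 = ∫ ω, (N * X i ω - 1) ∂P := by
      rw [integral_sub ((iX i hi).const_mul _) (integrable_const _), integral_const_mul, ← hm]
      simp
    have ii : Integrable (fun ω => N * X i ω - 1) P :=
      ((iX i hi).const_mul _).sub (integrable_const _)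
    rw [e1, ← integral_add_compl mG ii]
    have g1 := norm_setIntegral_le_of_norm_le_const (μ := P) (s := G)
      (f := fun ω => N * X i ω - 1) (C := ε) (measure_lt_top _ _) (fun ω hω => hG ω hω i hi)
    have g2 := norm_setIntegral_le_of_norm_le_const_ae' (μ := P) (s := Gᶜ)
      (f := fun ω => N * X i ω - 1) (C := N) (measure_lt_top _ _) (by
        filter_upwards [hX] with ω hω _
        rw [Real.norm_eq_abs, abs_le]
        have hN2 : (2:ℝ) ≤ N := by exact_mod_cast hN
        have := hω i hi
        constructor <;> nlinarith)
    have g3 : P.real G ≤ 1 := measureReal_le_one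
    have g4 : N * P.real Gᶜ ≤ N * δ := by gcongr
    have g5 : ε * P.real G ≤ ε * 1 := by gcongr
    refine (abs_add_le _ _).trans ?_
    rw [Real.norm_eq_abs] at g1 g2
    linarith
  set A : ℕ → Ω → ℝ := fun i ω => -β / X i ω ^ 2 + β / m i ^ 2 with hA
  have mA : ∀ i, Measurable (A i) := by
    intro i
    have := mX i
    fun_prop
  set Q := P.restrict G with hQ
  have aeQ : ∀ᵐ ω ∂Q, (∀ i ∈ I, |D i ω| ≤ 1) ∧
      ∀ i ∈ I, |A i ω - L * D i ω| ≤ 20 * ε * L * |D i ω| := by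
    filter_upwards [ae_restrict_of_ae bD, ae_restrict_mem mG] with ω h1 h2
    exact ⟨h1, fun i hi => cc_lin hβ hN0 hε (hG ω h2 i hi) (hmN i hi)⟩
  have iDQ : ∀ i ∈ I, Integrable (D i) Q := fun i hi => (iD i hi).restrict
  have iDD : ∀ i ∈ I, Integrable (fun ω => D i ω ^ 2) Q := by
    intro i hi
    refine Integrable.of_bound ((mD i).pow_const 2).aestronglyMeasurable 1 ?_
    filter_upwards [aeQ] with ω hω
    rw [Real.norm_eq_abs, abs_pow]
    exact pow_le_one₀ (abs_nonneg _) (hω.1 i hi)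
  have iDA : ∀ i ∈ I, ∀ j ∈ I, Integrable (fun ω => D i ω * A j ω) Q := by
    intro i hi j hj
    refine Integrable.of_bound ((mD i).mul (mA j)).aestronglyMeasurable (20 * ε * L + L) ?_
    filter_upwards [aeQ] with ω hω
    have h1 := hω.1 i hi
    have h2 := hω.1 j hj
    have h3 := hω.2 j hj
    have h4 : |A j ω| ≤ 20 * ε * L + L := by
      have : |A j ω| ≤ |A j ω - L * D j ω| + |L * D j ω| := by
        have := abs_add_le (A j ω - L * D j ω) (L * D j ω)
        simpa using this
      rw [abs_mul, abs_of_pos hL0] at this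
      have h5 : 20 * ε * L * |D j ω| ≤ 20 * ε * L * 1 := by gcongr
      have h6 : L * |D j ω| ≤ L * 1 := by gcongr
      linarith
    rw [Real.norm_eq_abs, abs_mul]
    calc _ ≤ 1 * (20 * ε * L + L) := by gcongr
      _ = _ := one_mul _
  set e : ℝ := (C + 8 * β + 1) * N ^ 2 * δ with he
  -- pair identities
  have pair : ∀ i ∈ I, ∀ j ∈ I, i ≠ j →
      |(∫ ω, D i ω * (A i ω - A j ω) ∂Q) - 1| ≤ e := by
    intro i hi j hj hij
    have h1 := hibp i hi j hj hij
    set c : ℝ := (-β / m i ^ 2 + β / m j ^ 2) + F * (i - j) with hc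
    have h2 : ∫ ω in G, (X i ω - m i) * ((-β / X i ω ^ 2 + F * i) - (-β / X j ω ^ 2 + F * j)) ∂P
        = (∫ ω, D i ω * (A i ω - A j ω) ∂Q) + c * ∫ ω, D i ω ∂Q := by
      rw [← integral_const_mul, ← integral_add]
      · refine integral_congr_ae (Eventually.of_forall fun ω => ?_)
        simp only [hD, hA, hc]
        ring
      · simp only [mul_sub]
        exact (iDA i hi i hi).sub (iDA i hi j hj)
      · exact (iDQ i hi).const_mul _
    have h3 : |∫ ω, D i ω ∂Q| ≤ δ := by
      have h4 := integral_add_compl mG (iD i hi)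
      rw [zD i hi] at h4
      have h5 := norm_setIntegral_le_of_norm_le_const_ae' (μ := P) (s := Gᶜ)
        (f := D i) (C := 1) (measure_lt_top _ _) (by
        filter_upwards [bD] with ω hω _
        exact hω i hi)
      have h6 : ∫ ω, D i ω ∂Q = - ∫ ω in Gᶜ, D i ω ∂P := by rw [hQ]; linarith
      rw [h6, abs_neg]
      rw [Real.norm_eq_abs] at h5
      linarith
    have h7 : |c| ≤ (8 * β + 1) * N ^ 2 := by
      have hmb : ∀ l ∈ I, 0 ≤ β / m l ^ 2 ∧ β / m l ^ 2 ≤ 4 * β * N ^ 2 := by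
        intro l hl
        have h8 := (abs_le.1 (hmN l hl)).1
        have h9 : 1 / 2 ≤ N * m l := by linarith
        have h10 : 0 < m l := by
          by_contra hcon
          nlinarith
        refine ⟨by positivity, ?_⟩
        rw [div_le_iff₀ (by positivity)]
        have : 1 / 4 ≤ (N * m l) ^ 2 := by nlinarith
        nlinarith
      have hi2 : (i:ℝ) ≤ N := by exact_mod_cast (Finset.mem_Icc.1 hi).2
      have hj2 : (j:ℝ) ≤ N := by exact_mod_cast (Finset.mem_Icc.1 hj).2
      have hi3 : (0:ℝ) ≤ i := by positivity
      have hj3 : (0:ℝ) ≤ j := by positivity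
      have hij2 : |F * ((i:ℝ) - j)| ≤ N * N := by
        rw [abs_mul, abs_of_nonneg hF]
        gcongr
        rw [abs_le]
        constructor <;> linarith
      rw [abs_le] at hij2 ⊢
      have a1 := hmb i hi
      have a2 := hmb j hj
      have a3 : 0 ≤ β * (N:ℝ) ^ 2 := by positivity
      simp only [hc, neg_div]
      constructor <;> nlinarith
    rw [h2] at h1
    have h8 : |c * ∫ ω, D i ω ∂Q| ≤ (8 * β + 1) * N ^ 2 * δ := by
      rw [abs_mul]; gcongr
    rw [abs_le] at h1 h8 ⊢
    simp only [he]
    constructor <;> linarith [h1.1, h1.2, h8.1, h8.2]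
  set T : ℕ → ℝ := fun i => L * ∫ ω, D i ω ^ 2 ∂Q with hT
  have T0 : ∀ i, 0 ≤ T i := fun i =>
    mul_nonneg hL0.le (integral_nonneg fun ω => sq_nonneg _)
  have cardI : (I.card : ℝ) = N := by simp [hI]
  obtain ⟨s, hs, hmax⟩ := Finset.exists_max_image I T ⟨k, hk⟩
  have main : ∀ i ∈ I, |T i - 1| ≤ 40 * ε * T s + (e + 1 / N) := by
    intro i hi
    have e1 : ∫ ω, D i ω * (N * A i ω - ∑ j ∈ I, A j ω) ∂Q =
        ∑ j ∈ I, ∫ ω, D i ω * (A i ω - A j ω) ∂Q := by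
      rw [← integral_finsetSum]
      · refine integral_congr_ae (Eventually.of_forall fun ω => ?_)
        simp only
        rw [← Finset.mul_sum, Finset.sum_sub_distrib, Finset.sum_const, nsmul_eq_mul, cardI]
      · intro j hj
        simp only [mul_sub]
        exact (iDA i hi i hi).sub (iDA i hi j hj)
    have e2 : |(∑ j ∈ I, ∫ ω, D i ω * (A i ω - A j ω) ∂Q) - (N - 1)| ≤ N * e := by
      rw [← Finset.add_sum_erase I _ hi]
      simp only [sub_self, mul_zero, integral_zero, zero_add]
      have hc : ((I.erase i).card : ℝ) = N - 1 := by
        rw [Finset.card_erase_of_mem hi, Nat.cast_sub (Finset.card_pos.2 ⟨i, hi⟩), cardI]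
        simp
      have e0 : 0 ≤ e := by
        have : ∃ j ∈ I, i ≠ j := by
          by_cases h : i = 1
          · exact ⟨2, by simp [hI]; omega, by omega⟩
          · exact ⟨1, by simp [hI]; omega, h⟩
        obtain ⟨j, hj, hij⟩ := this
        exact (abs_nonneg _).trans (pair i hi j hj hij)
      calc _ = |∑ j ∈ I.erase i, ((∫ ω, D i ω * (A i ω - A j ω) ∂Q) - 1)| := by
            rw [Finset.sum_sub_distrib, Finset.sum_const, nsmul_eq_mul, hc, mul_one]
        _ ≤ ∑ j ∈ I.erase i, |(∫ ω, D i ω * (A i ω - A j ω) ∂Q) - 1| :=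
            Finset.abs_sum_le_sum_abs _ _
        _ ≤ ∑ j ∈ I.erase i, e := Finset.sum_le_sum fun j hj =>
            pair i hi j (Finset.mem_of_mem_erase hj) (Finset.ne_of_mem_erase hj).symm
        _ = (N - 1) * e := by rw [Finset.sum_const, nsmul_eq_mul, hc]
        _ ≤ N * e := by nlinarith
    have iall : Integrable (fun ω => D i ω * (N * A i ω - ∑ j ∈ I, A j ω)) Q := by
      have h1 : (fun ω => D i ω * (N * A i ω - ∑ j ∈ I, A j ω)) =
          fun ω => N * (D i ω * A i ω) - ∑ j ∈ I, D i ω * A j ω := by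
        ext ω
        rw [← Finset.mul_sum]
        ring
      rw [h1]
      exact ((iDA i hi i hi).const_mul _).sub (integrable_finsetSum _ fun j hj => iDA i hi j hj)
    have isq : Integrable (fun ω => ∑ j ∈ I, D j ω ^ 2) Q := integrable_finsetSum _ iDD
    have e3 : |(∫ ω, D i ω * (N * A i ω - ∑ j ∈ I, A j ω) ∂Q) - N * T i| ≤
        20 * ε * (3 / 2 * N * T i + 1 / 2 * ∑ j ∈ I, T j) := by
      have h1 : N * T i = ∫ ω, N * L * D i ω ^ 2 ∂Q := by
        rw [integral_const_mul]; simp only [hT]; ring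
      have h2 : 20 * ε * (3 / 2 * N * T i + 1 / 2 * ∑ j ∈ I, T j) =
          ∫ ω, 20 * ε * L * (3 / 2 * N * D i ω ^ 2 + 1 / 2 * ∑ j ∈ I, D j ω ^ 2) ∂Q := by
        rw [integral_const_mul, integral_add ((iDD i hi).const_mul _) (isq.const_mul _),
          integral_const_mul, integral_const_mul, integral_finsetSum _ iDD]
        simp only [hT, ← Finset.mul_sum]
        ring
      rw [h1, h2, ← integral_sub iall ((iDD i hi).const_mul _), ← Real.norm_eq_abs]
      refine norm_integral_le_of_norm_le ((((iDD i hi).const_mul _).add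
        (isq.const_mul _)).const_mul _) ?_
      filter_upwards [aeQ] with ω hω
      have r1 : D i ω * (N * A i ω - ∑ j ∈ I, A j ω) - N * L * D i ω ^ 2 =
          N * (D i ω * (A i ω - L * D i ω)) - ∑ j ∈ I, D i ω * (A j ω - L * D j ω) := by
        rw [← Finset.mul_sum, Finset.sum_sub_distrib, ← Finset.mul_sum, sD]
        ring
      rw [r1, Real.norm_eq_abs]
      have r2 : |N * (D i ω * (A i ω - L * D i ω))| ≤ N * (20 * ε * L * D i ω ^ 2) := by
        rw [abs_mul, abs_mul, Nat.abs_cast, ← sq_abs (D i ω)]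
        have := hω.2 i hi
        calc _ ≤ N * (|D i ω| * (20 * ε * L * |D i ω|)) := by gcongr
          _ = _ := by ring
      have r3 : |∑ j ∈ I, D i ω * (A j ω - L * D j ω)| ≤
          ∑ j ∈ I, 20 * ε * L * (1 / 2 * (D i ω ^ 2 + D j ω ^ 2)) := by
        refine (Finset.abs_sum_le_sum_abs _ _).trans (Finset.sum_le_sum fun j hj => ?_)
        rw [abs_mul]
        have := hω.2 j hj
        calc _ ≤ |D i ω| * (20 * ε * L * |D j ω|) := by gcongr
          _ = 20 * ε * L * (|D i ω| * |D j ω|) := by ring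
          _ ≤ _ := by
            refine mul_le_mul_of_nonneg_left ?_ (by positivity)
            rw [← sq_abs (D i ω), ← sq_abs (D j ω)]
            nlinarith [sq_nonneg (|D i ω| - |D j ω|)]
      have r4 : ∑ j ∈ I, 20 * ε * L * (1 / 2 * (D i ω ^ 2 + D j ω ^ 2)) =
          20 * ε * L * (1 / 2 * (N * D i ω ^ 2 + ∑ j ∈ I, D j ω ^ 2)) := by
        rw [← Finset.mul_sum, ← Finset.mul_sum, Finset.sum_add_distrib, Finset.sum_const,
          nsmul_eq_mul, cardI]
      refine (abs_sub _ _).trans ?_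
      rw [r4] at r3
      linarith
    have e4 : ∑ j ∈ I, T j ≤ N * T s := by
      calc _ ≤ ∑ j ∈ I, T s := Finset.sum_le_sum hmax
        _ = _ := by rw [Finset.sum_const, nsmul_eq_mul, cardI]
    have e5 : 20 * ε * (3 / 2 * N * T i + 1 / 2 * ∑ j ∈ I, T j) ≤ N * (40 * ε * T s) := by
      have h1 := hmax i hi
      calc _ ≤ 20 * ε * (3 / 2 * N * T s + 1 / 2 * (N * T s)) := by gcongr
        _ = _ := by ring
    rw [e1] at e3
    have e6 : |N * (T i - 1)| ≤ N * (40 * ε * T s + (e + 1 / N)) := by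
      have : N * (40 * ε * T s + (e + 1 / N)) = N * (40 * ε * T s) + N * e + 1 := by
        field_simp
        ring
      rw [this]
      rw [abs_le] at e2 e3 ⊢
      constructor <;> linarith [e2.1, e2.2, e3.1, e3.2]
    rw [abs_mul, Nat.abs_cast] at e6
    exact le_of_mul_le_mul_left e6 hN0
  have hS : T s ≤ 2 := by
    have h1 := (abs_le.1 (main s hs)).2
    have h2 : 40 * ε * T s ≤ 1 / 4 * T s := by
      have := T0 s
      gcongr
      linarith
    linarith
  have hTk := main k hk
  have hfin : L * (∫ ω, D k ω ^ 2 ∂P) = T k + L * ∫ ω in Gᶜ, D k ω ^ 2 ∂P := by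
    have ii : Integrable (fun ω => D k ω ^ 2) P := by
      refine Integrable.of_bound ((mD k).pow_const 2).aestronglyMeasurable 1 ?_
      filter_upwards [bD] with ω hω
      rw [Real.norm_eq_abs, abs_pow]
      exact pow_le_one₀ (abs_nonneg _) (hω k hk)
    rw [← integral_add_compl mG ii, mul_add]
  have hrem : |L * ∫ ω in Gᶜ, D k ω ^ 2 ∂P| ≤ L * δ := by
    rw [abs_mul, abs_of_pos hL0]
    gcongr
    have h5 := norm_setIntegral_le_of_norm_le_const_ae' (μ := P) (s := Gᶜ)
        (f := fun ω => D k ω ^ 2) (C := 1) (measure_lt_top _ _) (by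
        filter_upwards [bD] with ω hω _
        rw [Real.norm_eq_abs, abs_pow]
        exact pow_le_one₀ (abs_nonneg _) (hω k hk))
    rw [Real.norm_eq_abs] at h5
    linarith
  have h40 : 40 * ε * T s ≤ 80 * ε := by nlinarith
  rw [hfin]
  rw [abs_le] at hTk hrem ⊢
  constructor <;> linarith [hTk.1, hTk.2, hrem.1, hrem.2]

/-! ### Assembling the proof -/

lemma condMean_eq_s1 (β F : ℝ) (N k : ℕ) :
    condMean β N F k = ∫ x, coulombCoord N k x ∂(ccP β F N) := by
  rw [ccP_int]; rfl

lemma condVar_eq {β F : ℝ} (hβ : 0 < β) (hF : 0 ≤ F) {N : ℕ} (hN : 2 ≤ N) {k : ℕ}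
    (hk : k ∈ Finset.Icc 1 N) :
    condVar β N F k = ∫ x, (coulombCoord N k x - condMean β N F k) ^ 2 ∂(ccP β F N) := by
  have hp := ccP_prob hβ hF hN
  have mc : Measurable (coulombCoord N k) := (cc_cont N k).measurable
  have b : ∀ x ∈ coulombDomain N, |coulombCoord N k x| ≤ 1 := by
    intro x hx
    rw [abs_of_pos ((cc_mem_iff hN x).1 hx k hk)]
    exact cc_le_one hN hx hk
  have i1 : Integrable (coulombCoord N k) (ccP β F N) := ccP_integrable hβ hF hN mc b
  have i2 : Integrable (fun x => coulombCoord N k x ^ 2) (ccP β F N) :=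
    ccP_integrable hβ hF hN (B := 1) (mc.pow_const 2) (fun x hx => by
      rw [abs_pow]; exact pow_le_one₀ (abs_nonneg _) (b x hx))
  set m := condMean β N F k with hm
  have e : (fun x => (coulombCoord N k x - m) ^ 2) = fun x =>
      (coulombCoord N k x ^ 2 - 2 * m * coulombCoord N k x) + m ^ 2 := by
    ext x; ring
  have h1 := condMean_eq_s1 β F N k
  rw [← hm] at h1
  have i3 : Integrable (fun x => coulombCoord N k x ^ 2 - 2 * m * coulombCoord N k x)
      (ccP β F N) := i2.sub (i1.const_mul _)
  rw [e, integral_add i3 (integrable_const _),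
    integral_sub i2 (i1.const_mul _), integral_const_mul, ← h1]
  unfold condVar
  rw [← ccP_int, ← hm]
  simp
  ring

lemma cc_bump {ε : ℝ} (hε : 0 < ε) (hε1 : ε ≤ 1 / 4) :
    ∃ η : ℝ → ℝ, ∃ C : ℝ, Differentiable ℝ η ∧ (∀ y, |deriv η y| ≤ C) ∧ (∀ y, 0 ≤ η y) ∧
      (∀ y, η y ≤ 1) ∧ (∀ y ≤ 1 / 2, η y = 0) ∧
      ∀ y, |y - 1| < ε → η y = 1 ∧ deriv η y = 0 := by
  let f : ContDiffBump (1:ℝ) := ⟨ε, 2 * ε, hε, by linarith⟩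
  have hc : ContDiff ℝ 1 f := f.contDiff
  obtain ⟨C, hC⟩ := f.hasCompactSupport.deriv.exists_bound_of_continuous
    (hc.continuous_deriv le_rfl)
  refine ⟨f, C, hc.differentiable one_ne_zero, hC, fun y => f.nonneg, fun y => f.le_one, ?_, ?_⟩
  · intro y hy
    refine f.zero_of_le_dist ?_
    rw [Real.dist_eq, abs_of_nonpos (by linarith)]
    change 2 * ε ≤ _
    linarith
  · intro y hy
    have hy' : y ∈ Metric.ball (1:ℝ) f.rIn := by
      rw [Metric.mem_ball, Real.dist_eq]; exact hy
    have h := f.eventuallyEq_one_of_mem_ball hy'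
    refine ⟨h.eq_of_nhds, ?_⟩
    rw [h.deriv_eq]
    simp

/-- Weak subcritical force: the conditional variance satisfies
`v_k(N,F(N)) = (1/(2βN³))(1 + o(1))` uniformly in `1 ≤ k ≤ N`. -/
theorem var_spacing_weak_subcritical (β : ℝ) (hβ : 0 < β)
    (F : ℕ → ℝ) (hF0 : ∀ N, 0 ≤ F N)
    (hF : Tendsto (fun N : ℕ => F N / N) atTop (nhds 0)) :
    ∀ ε > (0:ℝ), ∃ N₀ : ℕ, ∀ N ≥ N₀, ∀ k : ℕ, 1 ≤ k → k ≤ N →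
      |2 * β * (N : ℝ) ^ 3 * condVar β N (F N) k - 1| ≤ ε := by
  intro ε₀ hε₀
  obtain ⟨ε, hεdef⟩ : ∃ ε, ε = min (1 / 160) (ε₀ / 320) := ⟨_, rfl⟩
  have hε : 0 < ε := by rw [hεdef]; positivity
  have hε1 : ε ≤ 1 / 160 := by rw [hεdef]; exact min_le_left _ _
  have hε2 : 80 * ε ≤ ε₀ / 4 := by
    have : ε ≤ ε₀ / 320 := by rw [hεdef]; exact min_le_right _ _
    linarith
  obtain ⟨η, C, dη, hC, η0, η1, η2, ηG⟩ := cc_bump hε (by linarith)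
  obtain ⟨κ, hκ, γ, hγ, hbad⟩ := ccP_bad hβ hε (by linarith)
  have hC0 : 0 ≤ C := (abs_nonneg _).trans (hC 0)
  set C' : ℝ := 6 + 4 * C + 16 * β with hC'
  set K : ℝ := C' + 8 * β + 1 with hK
  have hK0 : 0 < K := by positivity
  -- smallness of the exponential error
  have hlim : Tendsto (fun N : ℕ => 2 * ((N:ℝ) ^ 5 * Real.exp (-(κ * N)))) atTop (nhds 0) := by
    have h1 := (tendsto_rpow_mul_exp_neg_mul_atTop_nhds_zero 5 κ hκ).comp
      (tendsto_natCast_atTop_atTop (R := ℝ))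
    have h2 := h1.const_mul 2
    rw [mul_zero] at h2
    refine h2.congr fun N => ?_
    simp only [Function.comp]
    rw [← Real.rpow_natCast (N:ℝ) 5]
    norm_num
  have hr : ∀ᶠ N : ℕ in atTop, 2 * ((N:ℝ) ^ 5 * Real.exp (-(κ * N))) <
      min ε (min (1 / (4 * K)) (min (ε₀ / (8 * K)) (ε₀ / (8 * β)))) :=
    hlim.eventually_lt_const (by positivity)
  have hFev : ∀ᶠ N : ℕ in atTop, F N / N < min 1 γ := hF.eventually_lt_const (by positivity)
  have hinv : ∀ᶠ N : ℕ in atTop, (1:ℝ) / N < min (1 / 4) (ε₀ / 8) :=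
    tendsto_one_div_atTop_nhds_zero_nat.eventually_lt_const (by positivity)
  obtain ⟨N₀, hN₀⟩ := eventually_atTop.1 ((hr.and (hFev.and hinv)).and (eventually_ge_atTop 2))
  refine ⟨N₀, fun N hNN k hk1 hk2 => ?_⟩
  obtain ⟨⟨h1, h2, h3⟩, hN⟩ := hN₀ N hNN
  have hN0 : (0:ℝ) < N := by positivity
  have hN1 : (1:ℝ) ≤ N := by exact_mod_cast (by omega : 1 ≤ N)
  have hk : k ∈ Finset.Icc 1 N := Finset.mem_Icc.2 ⟨hk1, hk2⟩
  simp only [lt_min_iff] at h1 h2 h3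
  obtain ⟨r1, r2, r3, r4⟩ := h1
  obtain ⟨f1, f2⟩ := h2
  obtain ⟨n1, n2⟩ := h3
  rw [div_lt_iff₀ hN0] at f1 f2
  have hFN : F N ≤ N := by linarith
  have hp := ccP_prob hβ (hF0 N) hN
  set δ : ℝ := 2 * N ^ 2 * Real.exp (-(κ * N)) with hδ
  have hδ0 : 0 ≤ δ := by positivity
  have hb : (ccP β (F N) N).real (ccG N ε)ᶜ ≤ δ := hbad N hN (F N) (hF0 N) f2.le
  have hδ3 : (N:ℝ) ^ 3 * δ = 2 * ((N:ℝ) ^ 5 * Real.exp (-(κ * N))) := by rw [hδ]; ring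
  rw [← hδ3] at r1 r2 r3 r4
  have hδ2 : (N:ℝ) ^ 2 * δ ≤ N ^ 3 * δ := by gcongr <;> norm_num
  have hδ1 : (N:ℝ) * δ ≤ N ^ 3 * δ := by
    gcongr
    exact le_self_pow₀ hN1 (by norm_num)
  have r2' : K * (N ^ 3 * δ) ≤ 1 / 4 := by
    rw [lt_div_iff₀ (by positivity)] at r2; linarith
  have r3' : K * (N ^ 3 * δ) ≤ ε₀ / 8 := by
    rw [lt_div_iff₀ (by positivity)] at r3; linarith
  have r4' : β * (N ^ 3 * δ) ≤ ε₀ / 8 := by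
    rw [lt_div_iff₀ (by positivity)] at r4; linarith
  have r5 : K * (N ^ 2 * δ) ≤ K * (N ^ 3 * δ) := by gcongr
  have hX : ∀ᵐ x ∂(ccP β (F N) N), ∀ i ∈ Finset.Icc 1 N,
      0 < coulombCoord N i x ∧ coulombCoord N i x ≤ 1 := by
    filter_upwards [ccP_ae β (F N) N] with x hx i hi
    exact ⟨(cc_mem_iff hN x).1 hx i hi, cc_le_one hN hx hi⟩
  have hm1 : ∀ i ∈ Finset.Icc 1 N, |condMean β N (F N) i| ≤ 1 := by
    intro i hi
    rw [condMean_eq_s1]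
    have := norm_integral_le_of_norm_le_const (μ := ccP β (F N) N) (f := coulombCoord N i)
      (C := 1) (by
        filter_upwards [hX] with x hx
        rw [Real.norm_eq_abs, abs_of_pos (hx i hi).1]
        exact (hx i hi).2)
    simpa using this
  have key := cc_core (ccP β (F N) N) hN (coulombCoord N)
    (fun i => (cc_cont N i).measurable) hX (cc_sum' (by omega)) (ε := ε) (δ := δ) (C := C')
    hβ (hF0 N) hFN hε hε1 (ccG N ε) (ccG_meas N ε) (fun x hx i hi => (hx i hi).le) hb
    (by linarith) (condMean β N (F N)) (condMean_eq_s1 β (F N) N) ?_ ?_ k hk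
  · rw [← condVar_eq hβ (hF0 N) hN hk] at key
    refine key.trans ?_
    rw [← hK]
    have a1 : K * N ^ 2 * δ = K * (N ^ 2 * δ) := by ring
    have a2 : 2 * β * N ^ 3 * δ = 2 * (β * (N ^ 3 * δ)) := by ring
    rw [a1, a2]
    linarith
  · intro i hi j hj hij
    have h := ccP_ibp hβ (hF0 N) hN hi hj hij (condMean β N (F N) i) η dη C hC η0 η1 η2
      (ccG N ε) (ccG_meas N ε) (fun x hx l hl => ηG _ (hx l hl))
    refine h.trans ?_
    have hi2 : (i:ℝ) ≤ N := by exact_mod_cast (Finset.mem_Icc.1 hi).2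
    have hj2 : (j:ℝ) ≤ N := by exact_mod_cast (Finset.mem_Icc.1 hj).2
    have hFi := hF0 N
    have hm := hm1 i hi
    calc _ ≤ (1 + (1 + (1 + 1) * (N * C * 1 + 1 * (N * C))) +
          (1 + 1) * ((β * (4 * N ^ 2) + N * N) + (β * (4 * N ^ 2) + N * N))) * δ := by
          gcongr
      _ ≤ C' * N ^ 2 * δ := by
          gcongr
          have : (N:ℝ) ≤ N ^ 2 := le_self_pow₀ hN1 (by norm_num)
          have h5 : (N:ℝ) * C ≤ N ^ 2 * C := by gcongr
          rw [hC']
          nlinarith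
  · rw [← hK]
    have a1 : K * N ^ 2 * δ = K * (N ^ 2 * δ) := by ring
    rw [a1]
    linarith
end
end

section
/- Let β > 0 and take the critical external force F(N) = 4βN. Then there exist a constant C > 0 and N₀ ∈ ℕ such that for all N ≥ N₀ and all 1 ≤ k ≤ N, the conditional variance satisfies 0 ≤ v_k(N, 4βN) ≤ C·N^{−3/2}. -/
open MeasureTheory Filter

noncomputable section

/-- one-site weight -/
def qw (β t x : ℝ) : ℝ := if 0 < x then Real.exp (-(β * (1 / x + t * x))) else 0

lemma qw_nonneg (β t x : ℝ) : 0 ≤ qw β t x := by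
  unfold qw; split_ifs <;> positivity

lemma qw_meas (β t : ℝ) : Measurable (qw β t) := by
  unfold qw
  exact Measurable.ite measurableSet_Ioi (by fun_prop) measurable_const

lemma qw_pos {β t x : ℝ} (hx : 0 < x) : qw β t x = Real.exp (-(β * (1 / x + t * x))) := by
  simp [qw, hx]

lemma qw_neg {β t x : ℝ} (hx : ¬ 0 < x) : qw β t x = 0 := by
  simp [qw, hx]

lemma qw_le_exp {β t x : ℝ} (hβ : 0 < β) : qw β t x ≤ Real.exp (-(β * t) * x) := by
  unfold qw; split_ifs with h
  · apply Real.exp_le_exp.2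
    have : 0 < β * (1 / x) := by positivity
    nlinarith
  · positivity

lemma qw_div_le {β t x : ℝ} (hβ : 0 < β) (h : 0 < x) :
    x⁻¹ * qw β t x ≤ β⁻¹ * Real.exp (-(β * t) * x) := by
  rw [qw_pos h]
  have e : -(β * (1 / x + t * x)) = -(β / x) + (-(β * t) * x) := by ring
  rw [e, Real.exp_add, ← mul_assoc]
  apply mul_le_mul_of_nonneg_right _ (Real.exp_pos _).le
  have h1 : β / x ≤ Real.exp (β / x) := by
    have := Real.add_one_le_exp (β / x); linarith
  rw [Real.exp_neg, ← mul_inv]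
  apply inv_anti₀ hβ
  calc β = x * (β / x) := by field_simp
    _ ≤ _ := by gcongr

lemma exp_int (a : ℝ) (ha : 0 < a) (k : ℕ) :
    IntegrableOn (fun x : ℝ => x ^ k * Real.exp (-a * x)) (Set.Ioi 0) := by
  have := integrableOn_rpow_mul_exp_neg_mul_rpow (s := (k:ℝ)) (p := 1) (b := a)
    (by have : (0:ℝ) ≤ k := by positivity
        linarith) (by norm_num) ha
  refine this.congr_fun (fun x hx => ?_) measurableSet_Ioi
  simp

lemma qw_int_on {β t : ℝ} (hβ : 0 < β) (ht : 0 < t) (k : ℕ) :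
    IntegrableOn (fun x : ℝ => x ^ k * qw β t x) (Set.Ioi 0) := by
  refine Integrable.mono' (exp_int (β * t) (by positivity) k) ?_ ?_
  · exact ((measurable_id.pow_const k).mul (qw_meas β t)).aestronglyMeasurable
  · refine (ae_restrict_iff' measurableSet_Ioi).2 (ae_of_all _ fun x hx => ?_)
    have hx : 0 < x := hx
    rw [Real.norm_of_nonneg (mul_nonneg (by positivity) (qw_nonneg _ _ _))]
    exact mul_le_mul_of_nonneg_left (qw_le_exp hβ) (by positivity)

lemma qw_int_inv {β t : ℝ} (hβ : 0 < β) (ht : 0 < t) :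
    IntegrableOn (fun x : ℝ => x⁻¹ * qw β t x) (Set.Ioi 0) := by
  refine Integrable.mono' ((exp_int (β * t) (by positivity) 0).const_mul β⁻¹) ?_ ?_
  · exact (measurable_id.inv.mul (qw_meas β t)).aestronglyMeasurable
  · refine (ae_restrict_iff' measurableSet_Ioi).2 (ae_of_all _ fun x hx => ?_)
    have hx : 0 < x := hx
    rw [Real.norm_of_nonneg (mul_nonneg (by positivity) (qw_nonneg _ _ _))]
    simpa using qw_div_le (t := t) hβ hx

lemma qw_int {β t : ℝ} (hβ : 0 < β) (ht : 0 < t) (k : ℕ) :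
    Integrable (fun x : ℝ => x ^ k * qw β t x) := by
  rw [← integrableOn_univ, ← Set.Iic_union_Ioi (a := (0:ℝ))]
  refine IntegrableOn.union ?_ (qw_int_on hβ ht k)
  refine (integrableOn_zero (μ := volume)).congr_fun (fun x hx => ?_) measurableSet_Iic
  simp [qw_neg (not_lt.2 hx)]

lemma qw_integral_eq (β t : ℝ) (f : ℝ → ℝ) :
    ∫ x, f x * qw β t x = ∫ x in Set.Ioi 0, f x * qw β t x := by
  symm
  apply setIntegral_eq_integral_of_forall_compl_eq_zero
  intro x hx
  rw [qw_neg (by simpa using hx), mul_zero]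

lemma qw_hasDeriv {β t x : ℝ} (hx : 0 < x) :
    HasDerivAt (qw β t) (β * ((x ^ 2)⁻¹ - t) * qw β t x) x := by
  have h1 : HasDerivAt (fun y : ℝ => Real.exp (-(β * (1 / y + t * y))))
      (β * ((x ^ 2)⁻¹ - t) * qw β t x) x := by
    have h2 : HasDerivAt (fun y : ℝ => -(β * (y⁻¹ + t * y))) (-(β * (-(x ^ 2)⁻¹ + t * 1))) x :=
      (((hasDerivAt_inv hx.ne').add ((hasDerivAt_id x).const_mul t)).const_mul β).neg
    have h3 := h2.exp
    rw [qw_pos hx]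
    simp only [one_div]
    convert h3 using 1
    ring
  refine h1.congr_of_eventuallyEq ?_
  filter_upwards [lt_mem_nhds hx] with y hy
  exact qw_pos hy

lemma qw_ibp {β t : ℝ} (hβ : 0 < β) (ht : 0 < t) (k : ℕ) (g : ℝ → ℝ)
    (hg : IntegrableOn g (Set.Ioi 0))
    (hd : ∀ x, 0 < x → HasDerivAt (fun y => y ^ (k+1) * qw β t y) (g x) x) :
    ∫ x in Set.Ioi 0, g x = 0 := by
  have hb : ∀ x : ℝ, 0 ≤ x → |x ^ (k+1) * qw β t x| ≤ x ^ (k+1) * Real.exp (-(β * t) * x) := by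
    intro x hx
    rw [abs_of_nonneg (mul_nonneg (by positivity) (qw_nonneg _ _ _))]
    exact mul_le_mul_of_nonneg_left (qw_le_exp hβ) (by positivity)
  have := integral_Ioi_of_hasDerivAt_of_tendsto (f := fun y => y ^ (k+1) * qw β t y) (f' := g)
    (a := 0) (m := 0) ?_ (fun x hx => hd x hx) hg ?_
  · simpa using this
  · unfold ContinuousWithinAt
    have e : (0:ℝ) ^ (k+1) * qw β t 0 = 0 := by simp
    show Tendsto _ _ (nhds ((0:ℝ) ^ (k+1) * qw β t 0))
    rw [e]
    have hc : Tendsto (fun x : ℝ => x ^ (k+1) * Real.exp (-(β * t) * x)) (nhdsWithin 0 (Set.Ici 0))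
        (nhds 0) := by
      have : Continuous (fun x : ℝ => x ^ (k+1) * Real.exp (-(β * t) * x)) := by fun_prop
      have h2 := (this.tendsto 0).mono_left (nhdsWithin_le_nhds (s := Set.Ici (0:ℝ)))
      simpa using h2
    apply squeeze_zero_norm' _ hc
    filter_upwards [self_mem_nhdsWithin] with x hx
    exact hb x hx
  · have hc : Tendsto (fun x : ℝ => x ^ (k+1) * Real.exp (-(β * t) * x)) atTop (nhds 0) := by
      have := Real.tendsto_pow_mul_exp_neg_atTop_nhds_zero (k+1)
      have h2 := this.comp (tendsto_id.const_mul_atTop (show 0 < β * t by positivity))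
      have h3 := h2.const_mul (((β * t)^(k+1))⁻¹)
      rw [mul_zero] at h3
      refine h3.congr (fun x => ?_)
      simp only [Function.comp, id]
      rw [mul_pow (β * t) x, ← mul_assoc, ← mul_assoc, inv_mul_cancel₀ (by positivity), one_mul, neg_mul]
    apply squeeze_zero_norm' _ hc
    filter_upwards [eventually_ge_atTop 0] with x hx
    exact hb x hx

lemma lin3 {μ : Measure ℝ} {f g h : ℝ → ℝ} (hf : Integrable f μ) (hg : Integrable g μ)
    (hh : Integrable h μ) (a b c : ℝ) :
    Integrable (fun x => a * f x + b * g x + c * h x) μ ∧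
    ∫ x, (a * f x + b * g x + c * h x) ∂μ
      = a * ∫ x, f x ∂μ + b * ∫ x, g x ∂μ + c * ∫ x, h x ∂μ := by
  have h1 : Integrable (fun x => a * f x) μ := hf.const_mul a
  have h2 : Integrable (fun x => b * g x) μ := hg.const_mul b
  have h3 : Integrable (fun x => c * h x) μ := hh.const_mul c
  have h12 : Integrable (fun x => a * f x + b * g x) μ := h1.add h2
  refine ⟨h12.add h3, ?_⟩
  rw [integral_add h12 h3, integral_add h1 h2, integral_const_mul, integral_const_mul,
    integral_const_mul]

lemma qw_id1 {β t : ℝ} (hβ : 0 < β) (ht : 0 < t) :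
    ∫ x in Set.Ioi 0, qw β t x = β * (t * (∫ x in Set.Ioi 0, x * qw β t x)
      - ∫ x in Set.Ioi 0, x⁻¹ * qw β t x) := by
  have i0 := qw_int_on hβ ht 0
  have i1 := qw_int_on hβ ht 1
  have im := qw_int_inv hβ ht
  simp only [pow_zero, one_mul, pow_one] at i0 i1
  obtain ⟨hi, he⟩ := lin3 i0 i1 im 1 (-(β * t)) β
  have := qw_ibp hβ ht 0 _ hi ?_
  · rw [he] at this
    linarith
  · intro x hx
    have h := (hasDerivAt_pow (0+1) x).mul (qw_hasDeriv (β := β) (t := t) hx)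
    refine h.congr_deriv ?_
    field_simp
    simp
    ring

lemma qw_id2 {β t : ℝ} (hβ : 0 < β) (ht : 0 < t) :
    2 * ∫ x in Set.Ioi 0, x * qw β t x = β * (t * (∫ x in Set.Ioi 0, x ^ 2 * qw β t x)
      - ∫ x in Set.Ioi 0, qw β t x) := by
  have i0 := qw_int_on hβ ht 0
  have i1 := qw_int_on hβ ht 1
  have i2 := qw_int_on hβ ht 2
  simp only [pow_zero, one_mul, pow_one] at i0 i1
  obtain ⟨hi, he⟩ := lin3 i1 i2 i0 2 (-(β * t)) β
  have := qw_ibp hβ ht 1 _ hi ?_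
  · rw [he] at this
    linarith
  · intro x hx
    have h := (hasDerivAt_pow (1+1) x).mul (qw_hasDeriv (β := β) (t := t) hx)
    refine h.congr_deriv ?_
    field_simp
    simp
    ring

lemma qw_Z_pos {β t : ℝ} (hβ : 0 < β) (ht : 0 < t) : 0 < ∫ x, qw β t x := by
  have i0 := qw_int hβ ht 0
  simp only [pow_zero, one_mul] at i0
  rw [integral_pos_iff_support_of_nonneg (fun x => qw_nonneg _ _ _) i0]
  have : Set.Ioi (0:ℝ) ⊆ Function.support (qw β t) := by
    intro x hx
    have hx : 0 < x := hx
    simp only [Function.mem_support]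
    rw [qw_pos hx]; positivity
  exact lt_of_lt_of_le (by simp) (measure_mono this)

/-- the one-site probability measure -/
def qP (β t : ℝ) : Measure ℝ :=
  volume.withDensity (fun x => ENNReal.ofReal (qw β t x / ∫ y, qw β t y))

lemma qP_prob {β t : ℝ} (hβ : 0 < β) (ht : 0 < t) : IsProbabilityMeasure (qP β t) := by
  have i0 := qw_int hβ ht 0
  simp only [pow_zero, one_mul] at i0
  have hZ := qw_Z_pos hβ ht
  constructor
  unfold qP
  rw [withDensity_apply _ MeasurableSet.univ, Measure.restrict_univ,
    ← ofReal_integral_eq_lintegral_ofReal (i0.div_const _)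
      (ae_of_all _ fun x => div_nonneg (qw_nonneg _ _ _) hZ.le), integral_div, div_self hZ.ne']
  simp

lemma qP_integral {β t : ℝ} (hβ : 0 < β) (ht : 0 < t) (f : ℝ → ℝ) :
    ∫ x, f x ∂(qP β t) = (∫ x, f x * qw β t x) / ∫ y, qw β t y := by
  have hZ := qw_Z_pos hβ ht
  unfold qP
  rw [integral_withDensity_eq_integral_toReal_smul
    (by have := qw_meas β t; fun_prop) (by simp), ← integral_div]
  congr 1; ext x
  rw [ENNReal.toReal_ofReal (div_nonneg (qw_nonneg _ _ _) hZ.le)]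
  simp only [smul_eq_mul]; ring

lemma qP_memLp {β t : ℝ} (hβ : 0 < β) (ht : 0 < t) : MemLp (fun x : ℝ => x) 2 (qP β t) := by
  have hZ := qw_Z_pos hβ ht
  rw [memLp_two_iff_integrable_sq (by fun_prop)]
  unfold qP
  rw [integrable_withDensity_iff (by have := qw_meas β t; fun_prop) (by simp)]
  refine ((qw_int hβ ht 2).div_const (∫ y, qw β t y)).congr (ae_of_all _ fun x => ?_)
  simp only
  rw [ENNReal.toReal_ofReal (div_nonneg (qw_nonneg _ _ _) hZ.le)]
  ring

lemma qP_moments {β t : ℝ} (hβ : 0 < β) (ht : 0 < t) (c : ℝ) (hc : 0 < c) (hct : t * c ^ 2 = 1) :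
    c ≤ ∫ x, x ∂(qP β t) ∧ ∫ x, x ∂(qP β t) ≤ c + 2 * c ^ 2 / β ∧
    ProbabilityTheory.variance (fun x : ℝ => x) (qP β t) ≤ 2 * (∫ x, x ∂(qP β t)) * c ^ 2 / β := by
  have := qP_prob hβ ht
  have hZ := qw_Z_pos hβ ht
  have h1 := qw_id1 hβ ht
  have h2 := qw_id2 hβ ht
  have hvar := ProbabilityTheory.variance_eq_sub (qP_memLp hβ ht)
  have hv0 := ProbabilityTheory.variance_nonneg (fun x : ℝ => x) (qP β t)
  have e0 : ∫ x, qw β t x = ∫ x in Set.Ioi 0, qw β t x := by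
    simpa using qw_integral_eq β t (fun _ => 1)
  have em : ∫ x, x ∂(qP β t) = (∫ x in Set.Ioi 0, x * qw β t x) / ∫ x in Set.Ioi 0, qw β t x := by
    rw [qP_integral hβ ht, qw_integral_eq, e0]
  have em2 : ∫ x, x ^ 2 ∂(qP β t) =
      (∫ x in Set.Ioi 0, x ^ 2 * qw β t x) / ∫ x in Set.Ioi 0, qw β t x := by
    rw [qP_integral hβ ht, qw_integral_eq β t (fun x => x ^ 2), e0]
  have em2' : ∫ x, ((fun x : ℝ => x) ^ 2) x ∂(qP β t) = ∫ x, x ^ 2 ∂(qP β t) := rfl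
  rw [em2', em2, em] at hvar
  rw [e0] at hZ
  have i0 := qw_int_on hβ ht 0
  have i1 := qw_int_on hβ ht 1
  have im := qw_int_inv hβ ht
  simp only [pow_zero, one_mul, pow_one] at i0 i1
  -- Jensen
  have hJ : ∀ m : ℝ, 0 ≤ (∫ x in Set.Ioi 0, x * qw β t x) - 2 * m * (∫ x in Set.Ioi 0, qw β t x)
      + m ^ 2 * ∫ x in Set.Ioi 0, x⁻¹ * qw β t x := by
    intro m
    have he := (lin3 i1 i0 im 1 (-(2 * m)) (m ^ 2)).2
    suffices this : 0 ≤ ∫ x in Set.Ioi 0, (1 * (x * qw β t x) + -(2 * m) * qw β t x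
      + m ^ 2 * (x⁻¹ * qw β t x)) by
      rw [he] at this; linarith
    apply setIntegral_nonneg measurableSet_Ioi
    intro x hx
    have hx : 0 < x := hx
    have : 1 * (x * qw β t x) + -(2 * m) * qw β t x + m ^ 2 * (x⁻¹ * qw β t x)
      = (x - m) ^ 2 * x⁻¹ * qw β t x := by field_simp; ring
    rw [this]
    exact mul_nonneg (by positivity) (qw_nonneg _ _ _)
  have hmpos : 0 ≤ ∫ x in Set.Ioi 0, x * qw β t x :=
    setIntegral_nonneg measurableSet_Ioi fun x hx => mul_nonneg (le_of_lt hx) (qw_nonneg _ _ _)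
  set Z := ∫ x in Set.Ioi 0, qw β t x
  set A := ∫ x in Set.Ioi 0, x * qw β t x
  set B := ∫ x in Set.Ioi 0, x ^ 2 * qw β t x
  set D := ∫ x in Set.Ioi 0, x⁻¹ * qw β t x
  rw [em]
  have hA : A = (A / Z) * Z := by field_simp
  have hB : B = (B / Z) * Z := by field_simp
  have hD : D = (D / Z) * Z := by field_simp
  have hm0 : 0 ≤ A / Z := by positivity
  generalize A / Z = m at *
  generalize B / Z = b at *
  generalize D / Z = d at *
  have h1' : 1 = β * (t * m - d) := by
    apply mul_right_cancel₀ hZ.ne'; rw [hA, hD] at h1; linarith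
  have h2' : 2 * m = β * (t * b - 1) := by
    apply mul_right_cancel₀ hZ.ne'; rw [hA, hB] at h2; linarith
  have hJ' : 1 ≤ m * d := by
    have := hJ m
    rw [hA, hD] at this
    have h3 : 0 ≤ m * (m * d - 1) := by
      have : 0 ≤ (m * (m * d - 1)) * Z := by nlinarith
      exact nonneg_of_mul_nonneg_left this hZ
    rcases hm0.eq_or_lt with h | h
    · exfalso
      have := hJ 1
      have h4 := hJ (β / 2)
      rw [hA, hD, ← h] at h4
      have hd : d = -β⁻¹ := by rw [← h] at h1'; field_simp; linarith
      rw [hd] at h4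
      have : (β/2)^2 * (-β⁻¹ * Z) = -(β/4) * Z := by field_simp; norm_num
      nlinarith [mul_pos hβ hZ]
    · nlinarith [nonneg_of_mul_nonneg_right h3 h]
  have hmpos' : 0 < m := by
    rcases hm0.eq_or_lt with h | h
    · rw [← h] at hJ'; norm_num at hJ'
    · exact h
  have ht' : t = (c ^ 2)⁻¹ := by field_simp; linarith
  have hb : b = c ^ 2 + 2 * m * c ^ 2 / β := by
    rw [ht'] at h2'; field_simp at h2' ⊢; nlinarith
  have h5 : c ^ 2 ≤ m ^ 2 := by
    have h8 : 1 ≤ t * m ^ 2 := by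
      have hd' : d = t * m - β⁻¹ := by field_simp; linarith
      rw [hd'] at hJ'
      have h9 : 0 < m * β⁻¹ := by positivity
      clear * - hJ' h9
      nlinarith
    have h10 : c ^ 2 * 1 ≤ c ^ 2 * (t * m ^ 2) := by gcongr
    have h11 : c ^ 2 * (t * m ^ 2) = (t * c ^ 2) * m ^ 2 := by ring
    rw [h11, hct] at h10
    linarith
  refine ⟨?_, ?_, ?_⟩
  · exact (sq_le_sq₀ hc.le hm0).1 h5
  · rw [hvar, hb] at hv0
    by_contra hcon
    push Not at hcon
    have h6 : 0 < 2 * c ^ 2 / β := by positivity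
    have h7 : 2 * m * c ^ 2 / β = m * (2 * c ^ 2 / β) := by ring
    rw [h7] at hv0
    clear * - hv0 hcon h6 hc hm0
    nlinarith
  · rw [hvar, hb]
    linarith


lemma cond_var_bound {Ω : Type*} [MeasurableSpace Ω] (μ : Measure Ω) [IsProbabilityMeasure μ]
    (X W S : Ω → ℝ) (hX : MemLp X 2 μ) (hS : MemLp S 2 μ) (hW : Measurable W)
    (hW0 : ∀ ω, 0 ≤ W ω) (hW1 : ∀ ω, W ω ≤ 1) (δ ε : ℝ) (hδ : 0 < δ) (hε : 0 < ε)
    (hV : ProbabilityTheory.variance S μ ≤ δ ^ 2 / 2)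
    (hlow : ∀ ω, |S ω - ∫ ω', S ω' ∂μ| < δ → ε ≤ W ω) :
    0 < ∫ ω, W ω ∂μ ∧
    0 ≤ (∫ ω, X ω ^ 2 * W ω ∂μ) / (∫ ω, W ω ∂μ) - ((∫ ω, X ω * W ω ∂μ) / (∫ ω, W ω ∂μ)) ^ 2 ∧
    (∫ ω, X ω ^ 2 * W ω ∂μ) / (∫ ω, W ω ∂μ) - ((∫ ω, X ω * W ω ∂μ) / (∫ ω, W ω ∂μ)) ^ 2
      ≤ 2 * ProbabilityTheory.variance X μ / ε := by
  have hWb : ∀ᵐ ω ∂μ, ‖W ω‖ ≤ 1 := ae_of_all _ fun ω => by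
    rw [Real.norm_of_nonneg (hW0 ω)]; exact hW1 ω
  have iW : Integrable W μ := (integrable_const (1:ℝ)).mono' hW.aestronglyMeasurable hWb
  have iX : Integrable X μ := hX.integrable (by norm_num)
  have iX2 : Integrable (fun ω => X ω ^ 2) μ := hX.integrable_sq
  have iXW : Integrable (fun ω => X ω * W ω) μ := by
    have := iX.bdd_mul hW.aestronglyMeasurable hWb
    exact this.congr (ae_of_all _ fun ω => by simp [mul_comm])
  have iX2W : Integrable (fun ω => X ω ^ 2 * W ω) μ := by
    have := iX2.bdd_mul hW.aestronglyMeasurable hWb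
    exact this.congr (ae_of_all _ fun ω => by simp [mul_comm])
  have hvX := ProbabilityTheory.variance_eq_integral (μ := μ) hX.aemeasurable
  have hvS := ProbabilityTheory.variance_eq_integral (μ := μ) hS.aemeasurable
  have iS : Integrable (fun ω => (S ω - ∫ ω', S ω' ∂μ) ^ 2) μ :=
    (hS.sub (memLp_const _)).integrable_sq
  have iXm : Integrable (fun ω => (X ω - ∫ ω', X ω' ∂μ) ^ 2) μ :=
    (hX.sub (memLp_const _)).integrable_sq
  have hD : ε / 2 ≤ ∫ ω, W ω ∂μ := by
    have h1 : ∫ ω, (ε - ε / δ ^ 2 * (S ω - ∫ ω', S ω' ∂μ) ^ 2) ∂μ ≤ ∫ ω, W ω ∂μ := by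
      apply integral_mono ((integrable_const _).sub (iS.const_mul _)) iW
      intro ω
      show ε - ε / δ ^ 2 * (S ω - ∫ ω', S ω' ∂μ) ^ 2 ≤ W ω
      by_cases h : |S ω - ∫ ω', S ω' ∂μ| < δ
      · have := hlow ω h
        have h2 : 0 ≤ ε / δ ^ 2 * (S ω - ∫ ω', S ω' ∂μ) ^ 2 := by positivity
        linarith
      · have h2 : δ ^ 2 ≤ (S ω - ∫ ω', S ω' ∂μ) ^ 2 := by
          rw [← sq_abs (S ω - _)]
          exact pow_le_pow_left₀ hδ.le (not_lt.1 h) 2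
        have h3 : ε / δ ^ 2 * δ ^ 2 ≤ ε / δ ^ 2 * (S ω - ∫ ω', S ω' ∂μ) ^ 2 := by gcongr
        have h4 : ε / δ ^ 2 * δ ^ 2 = ε := by field_simp
        have := hW0 ω
        linarith
    rw [integral_sub (integrable_const _) (iS.const_mul _), integral_const_mul, ← hvS] at h1
    simp at h1
    have h3 : ε / δ ^ 2 * ProbabilityTheory.variance S μ ≤ ε / δ ^ 2 * (δ ^ 2 / 2) := by gcongr
    have h4 : ε / δ ^ 2 * (δ ^ 2 / 2) = ε / 2 := by field_simp
    linarith
  have hDpos : 0 < ∫ ω, W ω ∂μ := by linarith [half_pos hε]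
  have hexp : ∀ a : ℝ, ∫ ω, (X ω - a) ^ 2 * W ω ∂μ
      = (∫ ω, X ω ^ 2 * W ω ∂μ) - 2 * a * (∫ ω, X ω * W ω ∂μ) + a ^ 2 * ∫ ω, W ω ∂μ := by
    intro a
    have e : ∀ ω, (X ω - a) ^ 2 * W ω = X ω ^ 2 * W ω - 2 * a * (X ω * W ω) + a ^ 2 * W ω := by
      intro ω; ring
    simp_rw [e]
    have h1 : Integrable (fun ω => 2 * a * (X ω * W ω)) μ := iXW.const_mul _
    have h2 : Integrable (fun ω => X ω ^ 2 * W ω - 2 * a * (X ω * W ω)) μ := iX2W.sub h1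
    rw [integral_add h2 (iW.const_mul _), integral_sub iX2W h1, integral_const_mul,
      integral_const_mul]
  have hup : ∫ ω, (X ω - ∫ ω', X ω' ∂μ) ^ 2 * W ω ∂μ ≤ ProbabilityTheory.variance X μ := by
    rw [hvX]
    apply integral_mono_of_nonneg _ iXm
    · refine ae_of_all _ fun ω => ?_
      simp only
      exact mul_le_of_le_one_right (sq_nonneg _) (hW1 ω)
    · exact ae_of_all _ fun ω => mul_nonneg (sq_nonneg _) (hW0 ω)
  have hnn : ∀ a : ℝ, 0 ≤ ∫ ω, (X ω - a) ^ 2 * W ω ∂μ := fun a =>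
    integral_nonneg fun ω => mul_nonneg (sq_nonneg _) (hW0 ω)
  have hv0 := ProbabilityTheory.variance_nonneg X μ
  rw [hexp] at hup
  have hnn' := hnn ((∫ ω, X ω * W ω ∂μ) / (∫ ω, W ω ∂μ))
  rw [hexp] at hnn'
  generalize ProbabilityTheory.variance X μ = V at *
  generalize (∫ ω, X ω ∂μ) = m at *
  generalize (∫ ω, W ω ∂μ) = D at *
  generalize (∫ ω, X ω * W ω ∂μ) = A at *
  generalize (∫ ω, X ω ^ 2 * W ω ∂μ) = B at *
  refine ⟨hDpos, ?_, ?_⟩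
  · have : B / D - (A / D) ^ 2 = (B - 2 * (A / D) * A + (A / D) ^ 2 * D) / D := by
      field_simp; ring
    rw [this]; positivity
  · have : B / D - (A / D) ^ 2 = (B - 2 * m * A + m ^ 2 * D) / D - (m - A / D) ^ 2 := by
      field_simp; ring
    rw [this]
    have h1 : (B - 2 * m * A + m ^ 2 * D) / D ≤ V / (ε / 2) := by gcongr
    have h2 : V / (ε / 2) = 2 * V / ε := by field_simp
    nlinarith [sq_nonneg (m - A / D)]

lemma qw_Z_int {β t : ℝ} (hβ : 0 < β) (ht : 0 < t) : Integrable (qw β t) := by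
  have i0 := qw_int hβ ht 0
  simpa only [pow_zero, one_mul] using i0

lemma pi_dens {n : ℕ} {β : ℝ} (hβ : 0 < β) (τ : Fin n → ℝ) (hτ : ∀ i, 0 < τ i) :
    Measure.pi (fun i => qP β (τ i)) =
      (volume : Measure (Fin n → ℝ)).withDensity
        (fun x => ENNReal.ofReal (∏ i, (qw β (τ i) (x i) / ∫ y, qw β (τ i) y))) := by
  have := fun i => qP_prob hβ (hτ i)
  have hnn : ∀ i y, 0 ≤ qw β (τ i) y / ∫ y, qw β (τ i) y := fun i y =>
    div_nonneg (qw_nonneg _ _ _) (qw_Z_pos hβ (hτ i)).le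
  have hIntg : ∀ i, Integrable (fun y => qw β (τ i) y / ∫ y, qw β (τ i) y) := fun i =>
    (qw_Z_int hβ (hτ i)).div_const _
  symm
  refine (Measure.pi_eq (μ := fun i => qP β (τ i)) (fun s hs => ?_)).symm ▸ rfl
  rw [withDensity_apply _ (MeasurableSet.univ_pi hs), ← lintegral_indicator (MeasurableSet.univ_pi hs)]
  have e : ∀ x : Fin n → ℝ, (Set.univ.pi s).indicator
      (fun x => ENNReal.ofReal (∏ i, (qw β (τ i) (x i) / ∫ y, qw β (τ i) y))) x
      = ENNReal.ofReal (∏ i, (s i).indicator (fun y => qw β (τ i) y / ∫ y, qw β (τ i) y) (x i)) := by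
    intro x
    by_cases h : x ∈ Set.univ.pi s
    · rw [Set.indicator_of_mem h]
      congr 1
      refine Finset.prod_congr rfl fun i _ => ?_
      rw [Set.indicator_of_mem (h i (Set.mem_univ i))]
    · rw [Set.indicator_of_notMem h]
      have : ∃ i, x i ∉ s i := by
        by_contra hc; push Not at hc; exact h fun i _ => hc i
      obtain ⟨i, hi⟩ := this
      rw [Finset.prod_eq_zero (Finset.mem_univ i) (Set.indicator_of_notMem hi _)]
      simp
  simp_rw [e]
  have hIntg' : ∀ i, Integrable ((s i).indicator (fun y => qw β (τ i) y / ∫ y, qw β (τ i) y)) :=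
    fun i => (hIntg i).indicator (hs i)
  have hnn' : ∀ i y, 0 ≤ (s i).indicator (fun y => qw β (τ i) y / ∫ y, qw β (τ i) y) y := fun i y =>
    Set.indicator_nonneg (fun y _ => hnn i y) y
  have hprodint : Integrable (fun x : Fin n → ℝ =>
      ∏ i, (s i).indicator (fun y => qw β (τ i) y / ∫ y, qw β (τ i) y) (x i)) volume :=
    Integrable.fintype_prod hIntg'
  rw [← ofReal_integral_eq_lintegral_ofReal hprodint
    (ae_of_all _ fun x => Finset.prod_nonneg fun i _ => hnn' i _),
    integral_fintype_prod_volume_eq_prod, ENNReal.ofReal_prod_of_nonneg]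
  · refine Finset.prod_congr rfl fun i _ => ?_
    rw [ofReal_integral_eq_lintegral_ofReal (hIntg' i) (ae_of_all _ fun x => hnn' i _)]
    unfold qP
    rw [withDensity_apply _ (hs i), ← lintegral_indicator (hs i)]
    congr 1; ext y
    by_cases h : y ∈ s i <;> simp [h]
  · exact fun i _ => integral_nonneg fun y => hnn' i y

lemma pi_integral {n : ℕ} {β : ℝ} (hβ : 0 < β) (τ : Fin n → ℝ) (hτ : ∀ i, 0 < τ i)
    (h : (Fin n → ℝ) → ℝ) :
    ∫ x, h x * ∏ i, qw β (τ i) (x i) =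
      (∏ i, ∫ y, qw β (τ i) y) * ∫ x, h x ∂(Measure.pi (fun i => qP β (τ i))) := by
  have hnn : ∀ i y, 0 ≤ qw β (τ i) y / ∫ y, qw β (τ i) y := fun i y =>
    div_nonneg (qw_nonneg _ _ _) (qw_Z_pos hβ (hτ i)).le
  rw [pi_dens hβ τ hτ, integral_withDensity_eq_integral_toReal_smul
    (by have := fun i => qw_meas β (τ i); fun_prop) (by simp), ← integral_const_mul]
  congr 1; ext x
  rw [ENNReal.toReal_ofReal (Finset.prod_nonneg fun i _ => hnn i _), Finset.prod_div_distrib]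
  have : 0 < ∏ i, ∫ y, qw β (τ i) y := Finset.prod_pos fun i _ => qw_Z_pos hβ (hτ i)
  simp only [smul_eq_mul]
  field_simp

lemma qw_max {β t c x : ℝ} (hβ : 0 < β) (hc : 0 < c) (hct : t * c ^ 2 = 1) (hx : 0 < x) :
    Real.exp (2 * β / c) * qw β t x = Real.exp (-(β * t * (x - c) ^ 2 / x)) := by
  rw [qw_pos hx, ← Real.exp_add]
  congr 1
  have ht' : t = (c ^ 2)⁻¹ := by field_simp; linarith
  rw [ht']
  field_simp
  ring

/-- Main probabilistic bound. -/
lemma core_bound {n : ℕ} {β : ℝ} (hβ : 0 < β) (τ c : Fin n → ℝ) (hc : ∀ i, 0 < c i)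
    (hct : ∀ i, τ i * c i ^ 2 = 1) (τ₀ c₀ : ℝ) (hc₀ : 0 < c₀) (hct₀ : τ₀ * c₀ ^ 2 = 1)
    (hsum : c₀ + ∑ i, c i = 1) (cm : ℝ) (hcm : ∀ i, c i ≤ cm)
    (b δ : ℝ) (hδ : 0 < δ) (hb : ∑ i, 2 * c i ^ 2 / β ≤ b)
    (hV : ∑ i, 2 * (1 + 2 * cm / β) / β * c i ^ 3 ≤ δ ^ 2 / 2)
    (hsmall : b + δ ≤ c₀ / 2) (k : Fin n) :
    let J : ((Fin n → ℝ) → ℝ) → ℝ := fun h =>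
      ∫ x, h x * ((∏ i, qw β (τ i) (x i)) * qw β τ₀ (1 - ∑ i, x i))
    0 ≤ J (fun x => x k ^ 2) / J (fun _ => 1) - (J (fun x => x k) / J (fun _ => 1)) ^ 2 ∧
    J (fun x => x k ^ 2) / J (fun _ => 1) - (J (fun x => x k) / J (fun _ => 1)) ^ 2
      ≤ 2 * (2 * (1 + 2 * cm / β) / β * cm ^ 3) / Real.exp (-(β * τ₀ * (b + δ) ^ 2 / (c₀ / 2))) := by
  intro J
  have hτ : ∀ i, 0 < τ i := fun i => by
    have := hct i
    have h2 : 0 < c i ^ 2 := by have := hc i; positivity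
    by_contra h
    nlinarith
  have hτ₀ : 0 < τ₀ := by
    have h2 : 0 < c₀ ^ 2 := by positivity
    by_contra h
    nlinarith
  have := fun i => qP_prob hβ (hτ i)
  set P := Measure.pi (fun i => qP β (τ i)) with hP
  set W : (Fin n → ℝ) → ℝ := fun x => Real.exp (2 * β / c₀) * qw β τ₀ (1 - ∑ i, x i) with hW
  set m : Fin n → ℝ := fun i => ∫ y, y ∂(qP β (τ i)) with hm
  have hmom := fun i => qP_moments hβ (hτ i) (c i) (hc i) (hct i)
  have hLp : ∀ i, MemLp (fun x : Fin n → ℝ => x i) 2 P := fun i =>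
    (qP_memLp hβ (hτ i)).comp_measurePreserving (measurePreserving_eval _ i)
  have hvar : ∀ i, ProbabilityTheory.variance (fun x : Fin n → ℝ => x i) P
      = ProbabilityTheory.variance (fun x : ℝ => x) (qP β (τ i)) := fun i =>
    (measurePreserving_eval (fun i => qP β (τ i)) i).variance_fun_comp
      (f := fun x : ℝ => x) (by fun_prop)
  have hmean : ∀ i, ∫ x, x i ∂P = m i := fun i =>
    integral_comp_eval (μ := fun i => qP β (τ i)) (i := i) (f := fun x : ℝ => x) (by fun_prop)
  have hvarle : ∀ i, ProbabilityTheory.variance (fun x : Fin n → ℝ => x i) P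
      ≤ 2 * (1 + 2 * cm / β) / β * c i ^ 3 := by
    intro i
    rw [hvar i]
    refine (hmom i).2.2.trans ?_
    have h1 : m i ≤ (1 + 2 * cm / β) * c i := by
      refine (hmom i).2.1.trans ?_
      have h3 := hc i
      have h4 := hcm i
      have : c i + 2 * c i ^ 2 / β = (1 + 2 * c i / β) * c i := by ring
      rw [this]; gcongr
    have h3 := hc i
    calc 2 * m i * c i ^ 2 / β ≤ 2 * ((1 + 2 * cm / β) * c i) * c i ^ 2 / β := by gcongr
      _ = _ := by ring
  have hSLp : MemLp (fun x : Fin n → ℝ => ∑ i, x i) 2 P := memLp_finsetSum _ fun i _ => hLp i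
  have hSmean : ∫ x, ∑ i, x i ∂P = ∑ i, m i := by
    rw [integral_finsetSum _ fun i _ => (hLp i).integrable (by norm_num)]
    exact Finset.sum_congr rfl fun i _ => hmean i
  have hSvar : ProbabilityTheory.variance (fun x : Fin n → ℝ => ∑ i, x i) P ≤ δ ^ 2 / 2 := by
    have hind : ProbabilityTheory.iIndepFun (fun i (x : Fin n → ℝ) => x i) P :=
      ProbabilityTheory.iIndepFun_pi (μ := fun i => qP β (τ i)) (X := fun i (x : ℝ) => x)
        (fun i => by fun_prop)
    have h1 := ProbabilityTheory.IndepFun.variance_sum (μ := P) (s := Finset.univ)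
      (X := fun i (x : Fin n → ℝ) => x i) (fun i _ => hLp i)
      (fun i _ j _ hij => hind.indepFun hij)
    have h2 : (∑ i, fun x : Fin n → ℝ => x i) = fun x : Fin n → ℝ => ∑ i, x i := by
      ext x; simp
    rw [h2] at h1
    rw [h1]
    exact (Finset.sum_le_sum fun i _ => hvarle i).trans hV
  have hW0 : ∀ x, 0 ≤ W x := fun x => mul_nonneg (Real.exp_pos _).le (qw_nonneg _ _ _)
  have hW1 : ∀ x, W x ≤ 1 := by
    intro x
    by_cases h : 0 < 1 - ∑ i, x i
    · simp only [hW]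
      rw [qw_max hβ hc₀ hct₀ h, Real.exp_le_one_iff]
      have : 0 ≤ β * τ₀ * (1 - ∑ i, x i - c₀) ^ 2 / (1 - ∑ i, x i) := by positivity
      linarith
    · simp [hW, qw_neg h]
  have hWm : Measurable W := by
    have := qw_meas β τ₀
    simp only [hW]
    fun_prop
  have hlow : ∀ x : Fin n → ℝ, |(∑ i, x i) - ∫ x : Fin n → ℝ, ∑ i, x i ∂P| < δ →
      Real.exp (-(β * τ₀ * (b + δ) ^ 2 / (c₀ / 2))) ≤ W x := by
    intro x hx
    rw [hSmean] at hx
    have h1 : ∑ i, c i ≤ ∑ i, m i := Finset.sum_le_sum fun i _ => (hmom i).1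
    have h2 : ∑ i, m i ≤ ∑ i, c i + b := by
      have : ∑ i, m i ≤ ∑ i, (c i + 2 * c i ^ 2 / β) := Finset.sum_le_sum fun i _ => (hmom i).2.1
      rw [Finset.sum_add_distrib] at this
      linarith
    rw [abs_lt] at hx
    have hy1 : 1 - ∑ i, x i - c₀ ≤ b + δ := by linarith [hx.1, hx.2]
    have hy2 : -(b + δ) ≤ 1 - ∑ i, x i - c₀ := by linarith [hx.1, hx.2]
    have hy3 : c₀ / 2 ≤ 1 - ∑ i, x i := by linarith
    have hy : 0 < 1 - ∑ i, x i := by linarith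
    simp only [hW]
    rw [qw_max hβ hc₀ hct₀ hy]
    apply Real.exp_le_exp.2
    apply neg_le_neg
    have : (1 - ∑ i, x i - c₀) ^ 2 ≤ (b + δ) ^ 2 := sq_le_sq' hy2 hy1
    gcongr
  obtain ⟨hD, hv0, hv1⟩ := cond_var_bound P (fun x => x k) W (fun x => ∑ i, x i) (hLp k) hSLp hWm
    hW0 hW1 δ _ hδ (Real.exp_pos _) hSvar hlow
  have hJ : ∀ h : (Fin n → ℝ) → ℝ, J h =
      ((∏ i, ∫ y, qw β (τ i) y) * (Real.exp (2 * β / c₀))⁻¹) * ∫ x, h x * W x ∂P := by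
    intro h
    simp only [J]
    have : ∀ x : Fin n → ℝ, h x * ((∏ i, qw β (τ i) (x i)) * qw β τ₀ (1 - ∑ i, x i))
       = (h x * qw β τ₀ (1 - ∑ i, x i)) * ∏ i, qw β (τ i) (x i) := fun x => by ring
    simp_rw [this]
    have h2 : ∫ x, h x * W x ∂P
        = Real.exp (2 * β / c₀) * ∫ x, h x * qw β τ₀ (1 - ∑ i, x i) ∂P := by
      rw [← integral_const_mul]
      refine integral_congr_ae (ae_of_all _ fun x => ?_)
      simp only [hW]
      ring
    rw [pi_integral hβ τ hτ (fun x => h x * qw β τ₀ (1 - ∑ i, x i)), ← hP, h2]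
    field_simp
  have hpos : 0 < (∏ i, ∫ y, qw β (τ i) y) * (Real.exp (2 * β / c₀))⁻¹ :=
    mul_pos (Finset.prod_pos fun i _ => qw_Z_pos hβ (hτ i)) (by positivity)
  rw [hJ, hJ, hJ, mul_div_mul_left _ _ hpos.ne', mul_div_mul_left _ _ hpos.ne']
  simp only [one_mul]
  refine ⟨hv0, hv1.trans ?_⟩
  have h1 := hvarle k
  have h3 := hc k
  have h4 := hcm k
  have h5 : 0 < cm := h3.trans_le h4
  have h2 : 2 * (1 + 2 * cm / β) / β * c k ^ 3 ≤ 2 * (1 + 2 * cm / β) / β * cm ^ 3 := by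
    gcongr
  have h6 := h1.trans h2
  gcongr


lemma flip_mp {m : ℕ} (j : Fin (m+1)) :
    MeasurePreserving (fun x : Fin (m+1) → ℝ => Function.update x j (1 - ∑ i, x i))
      volume volume := by
  have he := volume_preserving_piFinSuccAbove (fun _ : Fin (m+1) => ℝ) j
  have hs : MeasurePreserving (fun p : (Fin m → ℝ) × ℝ => (p.1, 1 - ∑ i, p.1 i - p.2))
      (volume.prod volume) (volume.prod volume) := by
    refine MeasurePreserving.skew_product (g := fun (z : Fin m → ℝ) (y : ℝ) => 1 - ∑ i, z i - y)
      (MeasurePreserving.id volume) (by fun_prop) (ae_of_all _ fun z => ?_)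
    exact (Measure.measurePreserving_sub_left volume (1 - ∑ i, z i)).map_eq
  have h1 : MeasurePreserving (Prod.swap : ℝ × (Fin m → ℝ) → _) (volume.prod volume)
    (volume.prod volume) := Measure.measurePreserving_swap
  have h2 : MeasurePreserving (Prod.swap : (Fin m → ℝ) × ℝ → _) (volume.prod volume)
    (volume.prod volume) := Measure.measurePreserving_swap
  have h := (he.symm).comp (h2.comp (hs.comp (h1.comp he)))
  suffices hfun : (fun x : Fin (m+1) → ℝ => Function.update x j (1 - ∑ i, x i)) =
      ((MeasurableEquiv.piFinSuccAbove (fun _ => ℝ) j).symm ∘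
      Prod.swap ∘ (fun p : (Fin m → ℝ) × ℝ => (p.1, 1 - ∑ i, p.1 i - p.2)) ∘ Prod.swap ∘
      (MeasurableEquiv.piFinSuccAbove (fun _ => ℝ) j)) by
    rw [hfun]; exact h
  ext x i
  change Function.update x j (1 - ∑ i, x i) i =
    j.insertNth (α := fun _ => ℝ) (1 - ∑ i, x (j.succAbove i) - x j) (fun i => x (j.succAbove i)) i
  have hsum := Fin.sum_univ_succAbove x j
  rcases eq_or_ne i j with rfl | hij
  · rw [Function.update_self, Fin.insertNth_apply_same, hsum]; ring
  · obtain ⟨i', rfl⟩ := Fin.exists_succAbove_eq hij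
    rw [Function.update_of_ne hij, Fin.insertNth_apply_succAbove]

lemma flip_sum {n : ℕ} (j : Fin n) (x : Fin n → ℝ) (y : ℝ) :
    ∑ i, Function.update x j y i = y + ∑ i, x i - x j := by
  rw [Finset.sum_update_of_mem (Finset.mem_univ j), ← Finset.add_sum_erase Finset.univ x (Finset.mem_univ j),
    Finset.sdiff_singleton_eq_erase]
  ring

lemma flip_integral {m : ℕ} (j : Fin (m+1)) (G : (Fin (m+1) → ℝ) → ℝ) :
    ∫ x, G x = ∫ x : Fin (m+1) → ℝ, G (Function.update x j (1 - ∑ i, x i)) := by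
  have hmp := flip_mp j
  have hinv : Function.Involutive
      (fun x : Fin (m+1) → ℝ => Function.update x j (1 - ∑ i, x i)) := by
    intro x
    simp only [flip_sum, Function.update_idem]
    have : 1 - (1 - ∑ i, x i + ∑ i, x i - x j) = x j := by ring
    rw [this, Function.update_eq_self]
  exact (hmp.integral_comp (MeasurableEquiv.ofInvolutive _ hinv hmp.measurable).measurableEmbedding
    G).symm

/-- index relabelling after the flip -/
def sg {n : ℕ} (j : Fin n) (i : Fin n) : ℕ := if i = j then n else (i : ℕ)

lemma sg_sum {n : ℕ} (j : Fin n) (h : ℕ → ℝ) :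
    h j + ∑ i, h (sg j i) = ∑ i ∈ Finset.range (n+1), h i := by
  rw [Finset.sum_range_succ, Finset.sum_range, ← Finset.add_sum_erase Finset.univ _ (Finset.mem_univ j),
    ← Finset.add_sum_erase Finset.univ (fun i : Fin n => h i) (Finset.mem_univ j)]
  have : ∑ i ∈ Finset.univ.erase j, h (sg j i) = ∑ i ∈ Finset.univ.erase j, h i := by
    refine Finset.sum_congr rfl fun i hi => ?_
    rw [sg, if_neg (Finset.ne_of_mem_erase hi)]
  rw [this]
  simp [sg]
  ring

lemma flip_integrand {n : ℕ} (β : ℝ) (τ : ℕ → ℝ) (j : Fin n) (x : Fin n → ℝ) :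
    (∏ i : Fin n, qw β (τ i) (Function.update x j (1 - ∑ i, x i) i))
      * qw β (τ n) (1 - ∑ i, Function.update x j (1 - ∑ i, x i) i)
    = (∏ i : Fin n, qw β (τ (sg j i)) (x i)) * qw β (τ j) (1 - ∑ i, x i) := by
  rw [flip_sum]
  have : 1 - (1 - ∑ i, x i + ∑ i, x i - x j) = x j := by ring
  rw [this, ← Finset.mul_prod_erase Finset.univ _ (Finset.mem_univ j),
    ← Finset.mul_prod_erase Finset.univ (fun i => qw β (τ (sg j i)) (x i)) (Finset.mem_univ j)]
  have h2 : ∏ i ∈ Finset.univ.erase j, qw β (τ i) (Function.update x j (1 - ∑ i, x i) i)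
      = ∏ i ∈ Finset.univ.erase j, qw β (τ (sg j i)) (x i) := by
    refine Finset.prod_congr rfl fun i hi => ?_
    rw [sg, if_neg (Finset.ne_of_mem_erase hi), Function.update_of_ne (Finset.ne_of_mem_erase hi)]
  rw [h2]
  simp [sg]
  ring

lemma coulombCoord_lt {n : ℕ} (i : Fin n) (x : Fin n → ℝ) :
    coulombCoord (n+1) (i + 1) x = x i := by
  unfold coulombCoord
  rw [dif_pos (by simp)]
  rfl

lemma coulombCoord_last {n : ℕ} (x : Fin n → ℝ) :
    coulombCoord (n+1) (n + 1) x = 1 - ∑ i, x i := by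
  unfold coulombCoord
  rw [dif_neg (by simp)]
  rfl

lemma sum_Icc_fin (n : ℕ) (φ : ℕ → ℝ) :
    ∑ k ∈ Finset.Icc 1 (n+1), φ k = ∑ i : Fin n, φ (i + 1) + φ (n+1) := by
  rw [← Finset.sum_range (fun i => φ (i+1)), Finset.sum_Icc_succ_top (by omega)]
  congr 1
  induction n with
  | zero => simp
  | succ k ih => rw [Finset.sum_range_succ, Finset.sum_Icc_succ_top (by omega), ih]

lemma coulombInt_eq_s5 {n : ℕ} (β F ε : ℝ) (τ : ℕ → ℝ) (hτ : ∀ i, β * τ i = F * (i + ε))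
    (g : (Fin n → ℝ) → ℝ) :
    coulombInt β F (n+1) g = Real.exp (F * (ε - 1)) *
      ∫ x, g x * ((∏ i : Fin n, qw β (τ i) (x i)) * qw β (τ n) (1 - ∑ i, x i)) := by
  have hdm : MeasurableSet (coulombDomain (n+1) : Set (Fin n → ℝ)) := by
    have e : (coulombDomain (n+1) : Set (Fin n → ℝ))
        = (⋂ i, {x : Fin n → ℝ | 0 < x i} ∩ {x | x i < 1}) ∩ {x | ∑ i, x i < 1} := by
      ext x
      simp [coulombDomain]
    rw [e]
    refine MeasurableSet.inter (MeasurableSet.iInter fun i => ?_) ?_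
    · exact (measurableSet_lt measurable_const (by fun_prop)).inter
        (measurableSet_lt (by fun_prop) measurable_const)
    · exact measurableSet_lt (by fun_prop) measurable_const
  unfold coulombInt
  rw [← integral_const_mul]
  change ∫ x in (coulombDomain (n+1) : Set (Fin n → ℝ)), _ = _
  rw [← integral_indicator hdm]
  refine integral_congr_ae (ae_of_all _ fun (x : Fin n → ℝ) => ?_)
  change (coulombDomain (n+1) : Set (Fin n → ℝ)).indicator _ x = _
  by_cases hx : x ∈ (coulombDomain (n+1) : Set (Fin n → ℝ))
  · rw [Set.indicator_of_mem hx]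
    have hx1 : ∀ i : Fin n, 0 < x i := fun i => (hx.1 i).1
    have hx2 : 0 < 1 - ∑ i, x i := sub_pos.2 hx.2
    have hprod : ∏ i : Fin n, qw β (τ i) (x i) =
        Real.exp (∑ i : Fin n, -(β * (1 / x i + τ i * x i))) := by
      rw [Real.exp_sum]
      exact Finset.prod_congr rfl fun i _ => qw_pos (hx1 i)
    have key : -∑ k ∈ Finset.Icc 1 (n + 1),
        (β / coulombCoord (n + 1) k x + F * (k : ℝ) * coulombCoord (n + 1) k x)
        = F * (ε - 1) + (∑ i : Fin n, -(β * (1 / x i + τ i * x i))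
          + -(β * (1 / (1 - ∑ i, x i) + τ n * (1 - ∑ i, x i)))) := by
      rw [sum_Icc_fin, coulombCoord_last]
      have h1 : ∀ i : Fin n, β / coulombCoord (n + 1) (i + 1) x
          + F * ((i + 1 : ℕ) : ℝ) * coulombCoord (n + 1) (i + 1) x
          = β * (1 / x i + τ i * x i) + (F * (1 - ε)) * x i := by
        intro i
        rw [coulombCoord_lt, mul_add, ← mul_assoc β (τ i), hτ]
        push_cast
        ring
      rw [Finset.sum_congr rfl fun i _ => h1 i, Finset.sum_add_distrib, ← Finset.mul_sum Finset.univ (fun i : Fin n => x i) (F * (1 - ε)),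
        Finset.sum_neg_distrib, mul_add β (1 / (1 - ∑ i, x i)), ← mul_assoc β (τ n), hτ]
      push_cast
      ring
    change g x * Real.exp _ = Real.exp (F * (ε - 1)) *
      (g x * ((∏ i : Fin n, qw β (τ i) (x i)) * qw β (τ n) (1 - ∑ i, x i)))
    rw [hprod, qw_pos hx2, key, Real.exp_add, Real.exp_add]
    ring
  · rw [Set.indicator_of_notMem hx]
    change 0 = Real.exp (F * (ε - 1)) *
      (g x * ((∏ i : Fin n, qw β (τ i) (x i)) * qw β (τ n) (1 - ∑ i, x i)))
    suffices h : (∏ i : Fin n, qw β (τ i) (x i)) * qw β (τ n) (1 - ∑ i, x i) = 0 by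
      rw [h]; ring
    by_contra hne
    apply hx
    have h1 := left_ne_zero_of_mul hne
    have h2 := right_ne_zero_of_mul hne
    have hp : ∀ i : Fin n, 0 < x i := by
      intro i
      by_contra h
      exact Finset.prod_ne_zero_iff.1 h1 i (Finset.mem_univ i) (qw_neg h)
    have hs : 0 < 1 - ∑ i, x i := by
      by_contra h
      exact h2 (qw_neg h)
    refine ⟨fun i => ⟨hp i, ?_⟩, sub_pos.1 hs⟩
    have := Finset.single_le_sum (f := fun i : Fin n => x i) (fun i _ => (hp i).le)
      (Finset.mem_univ i)
    exact lt_of_le_of_lt this (sub_pos.1 hs)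


lemma tilt_exists (N : ℕ) (hN : 1 ≤ N) : ∃ ε : ℝ, 1/16 ≤ ε ∧ ε ≤ 1 ∧
    ∑ i ∈ Finset.range N, 1 / √((i:ℝ) + ε) = 2 * √N := by
  have hcont : ContinuousOn (fun ε : ℝ => ∑ i ∈ Finset.range N, 1 / √((i:ℝ) + ε))
      (Set.Icc (1/16) 1) := by
    refine continuousOn_finsetSum _ fun i _ => ?_
    refine ContinuousOn.div continuousOn_const (by fun_prop) ?_
    intro x hx
    have : 0 < (i:ℝ) + x := by
      have h1 : (0:ℝ) ≤ i := Nat.cast_nonneg i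
      have := hx.1
      linarith
    exact (Real.sqrt_pos.2 this).ne'
  have hup : ∀ M : ℕ, ∑ i ∈ Finset.range M, 1 / √((i:ℝ) + 1) ≤ 2 * √M := by
    intro M
    induction M with
    | zero => simp
    | succ k ih =>
      rw [Finset.sum_range_succ]
      push_cast
      have h0 : (0:ℝ) ≤ k := Nat.cast_nonneg k
      have hp : 0 < √((k:ℝ) + 1) := Real.sqrt_pos.2 (by linarith)
      have hs := Real.sq_sqrt (show (0:ℝ) ≤ (k:ℝ) + 1 by linarith)
      have hs' := Real.sq_sqrt h0
      have : 1 / √((k:ℝ) + 1) ≤ 2 * √((k:ℝ) + 1) - 2 * √k := by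
        rw [div_le_iff₀ hp]
        nlinarith [sq_nonneg (√((k:ℝ) + 1) - √k)]
      linarith
  have hlo : ∀ M : ℕ, 2 * √((M:ℝ) + 1 + 1/16) + 1 ≤
      ∑ i ∈ Finset.range (M+1), 1 / √((i:ℝ) + 1/16) := by
    intro M
    induction M with
    | zero =>
      simp
      have h1 : √((16:ℝ)⁻¹) = 1/4 := by
        rw [show ((16:ℝ)⁻¹) = (1/4)^2 by norm_num]; exact Real.sqrt_sq (by norm_num)
      have h2 : √((1:ℝ) + 16⁻¹) ≤ 5/4 := by
        apply Real.sqrt_le_iff.2; norm_num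
      have h3 : √(16:ℝ) = 4 := by
        rw [show (16:ℝ) = 4^2 by norm_num]; exact Real.sqrt_sq (by norm_num)
      rw [h3]; linarith
    | succ k ih =>
      rw [Finset.sum_range_succ]
      push_cast
      have h0 : (0:ℝ) ≤ k := Nat.cast_nonneg k
      set a := (k:ℝ) + 1 + 1/16 with ha
      have e : (k:ℝ) + 1 + 1 + 1/16 = a + 1 := by rw [ha]; ring
      rw [e]
      have ha0 : 0 < a := by linarith
      have hp : 0 < √a := Real.sqrt_pos.2 ha0
      have hs := Real.sq_sqrt ha0.le
      have hs' := Real.sq_sqrt (show 0 ≤ a + 1 by linarith)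
      have : 2 * √(a+1) - 2 * √a ≤ 1 / √a := by
        rw [le_div_iff₀ hp]
        nlinarith [sq_nonneg (√(a+1) - √a)]
      linarith
  have hmem : 2 * √(N:ℝ) ∈ Set.Icc (∑ i ∈ Finset.range N, 1 / √((i:ℝ) + 1))
      (∑ i ∈ Finset.range N, 1 / √((i:ℝ) + 1/16)) := by
    refine ⟨hup N, ?_⟩
    obtain ⟨M, rfl⟩ : ∃ M, N = M + 1 := ⟨N - 1, by omega⟩
    refine le_trans ?_ (hlo M)
    have : √((M + 1 : ℕ):ℝ) ≤ √((M:ℝ) + 1 + 1/16) := by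
      apply Real.sqrt_le_sqrt; push_cast; linarith
    linarith
  obtain ⟨ε, hε, he⟩ := intermediate_value_Icc' (by norm_num) hcont hmem
  exact ⟨ε, hε.1, hε.2, he⟩

/-- constants -/
lemma psum (s : ℝ) (hs : 1 < s) : ∃ T > (0:ℝ), ∀ N : ℕ,
    ∑ i ∈ Finset.range N, ((i:ℝ) + 1) ^ (-s) ≤ T := by
  have h := (Real.summable_nat_rpow_inv (p := s)).2 hs
  have h' := (summable_nat_add_iff 1).2 h
  have hnn : ∀ i : ℕ, 0 ≤ (((i + 1 : ℕ) : ℝ) ^ s)⁻¹ := fun i => by positivity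
  refine ⟨∑' i : ℕ, (((i + 1 : ℕ) : ℝ) ^ s)⁻¹ + 1, by
    have : 0 ≤ ∑' i : ℕ, (((i + 1 : ℕ) : ℝ) ^ s)⁻¹ := tsum_nonneg hnn
    linarith, fun N => ?_⟩
  have := h'.sum_le_tsum (Finset.range N) (fun i _ => hnn i)
  refine le_trans (le_of_eq ?_) (this.trans (by linarith))
  refine Finset.sum_congr rfl fun i _ => ?_
  push_cast
  rw [Real.rpow_neg (by positivity)]

lemma sums_bound : ∃ T > (0:ℝ), ∀ (N : ℕ) (ε r : ℝ), 1/16 ≤ ε → 0 < r → r ^ 4 = N →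
    ∑ i ∈ Finset.range N, 1 / ((i:ℝ) + ε) ≤ T * r ∧
    ∑ i ∈ Finset.range N, 1 / (√((i:ℝ) + ε)) ^ 3 ≤ T := by
  obtain ⟨T1, hT1, h1⟩ := psum (5/4) (by norm_num)
  obtain ⟨T2, hT2, h2⟩ := psum (3/2) (by norm_num)
  refine ⟨16 * T1 + 64 * T2, by positivity, fun N ε r hε hr hrN => ⟨?_, ?_⟩⟩
  · have : ∀ i ∈ Finset.range N, 1 / ((i:ℝ) + ε) ≤ 16 * r * ((i:ℝ) + 1) ^ (-(5/4:ℝ)) := by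
      intro i hi
      have hi' : (i:ℝ) + 1 ≤ N := by exact_mod_cast Finset.mem_range.1 hi
      have h0 : (0:ℝ) ≤ i := Nat.cast_nonneg i
      have hp : (0:ℝ) < (i:ℝ) + 1 := by linarith
      have e1 : ((i:ℝ) + 1) ^ (1/4:ℝ) ≤ r := by
        have : r = (r ^ 4) ^ (1/4:ℝ) := by
          rw [← Real.rpow_natCast r 4, ← Real.rpow_mul hr.le]; norm_num
        rw [this, hrN]
        gcongr
      have e2 : ((i:ℝ) + 1) ^ (-(5/4:ℝ)) * ((i:ℝ) + 1) ^ (1/4:ℝ) = ((i:ℝ)+1)⁻¹ := by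
        rw [← Real.rpow_add hp, ← Real.rpow_neg_one]; norm_num
      have e3 : ((i:ℝ)+1)⁻¹ ≤ ((i:ℝ) + 1) ^ (-(5/4:ℝ)) * r := by
        rw [← e2]; gcongr
      have e4 : 1 / ((i:ℝ) + ε) ≤ 16 * ((i:ℝ)+1)⁻¹ := by
        rw [div_le_iff₀ (by linarith)]
        field_simp
        linarith
      nlinarith
    refine (Finset.sum_le_sum this).trans ?_
    rw [← Finset.mul_sum]
    calc 16 * r * _ ≤ 16 * r * T1 := by gcongr; exact h1 N
      _ ≤ _ := by nlinarith [mul_pos hT2 hr]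
  · have : ∀ i ∈ Finset.range N, 1 / (√((i:ℝ) + ε)) ^ 3 ≤ 64 * ((i:ℝ) + 1) ^ (-(3/2:ℝ)) := by
      intro i hi
      have h0 : (0:ℝ) ≤ i := Nat.cast_nonneg i
      have hp : (0:ℝ) < (i:ℝ) + 1 := by linarith
      have e1 : ((i:ℝ) + 1) ^ (-(3/2:ℝ)) = 1 / (√((i:ℝ) + 1)) ^ 3 := by
        rw [Real.sqrt_eq_rpow, ← Real.rpow_natCast, ← Real.rpow_mul hp.le, Real.rpow_neg hp.le]
        norm_num
      rw [e1]
      have e2 : √((i:ℝ) + 1) ≤ 4 * √((i:ℝ) + ε) := by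
        rw [Real.sqrt_le_left (by positivity), mul_pow, Real.sq_sqrt (by linarith)]
        linarith
      have h5 : 0 < √((i:ℝ) + 1) := Real.sqrt_pos.2 hp
      have h6 : 0 < √((i:ℝ) + ε) := Real.sqrt_pos.2 (by linarith)
      rw [mul_one_div, div_le_div_iff₀ (by positivity) (by positivity)]
      calc 1 * √((i:ℝ) + 1) ^ 3 ≤ 1 * (4 * √((i:ℝ) + ε)) ^ 3 := by gcongr
        _ = _ := by ring
    refine (Finset.sum_le_sum this).trans ?_
    rw [← Finset.mul_sum]
    have := h2 N
    linarith

set_option maxHeartbeats 4000000 in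
theorem main_aux (β : ℝ) (hβ : 0 < β) :
    ∃ C > (0:ℝ), ∃ N₀ : ℕ, ∀ N ≥ N₀, ∀ k : ℕ, 1 ≤ k → k ≤ N →
      0 ≤ condVar β N (4 * β * N) k ∧
      condVar β N (4 * β * N) k ≤ C * (N : ℝ) ^ (-(3:ℝ)/2) := by
  obtain ⟨T, hT, hsums⟩ := sums_bound
  set A := 2 * (1 + 4 / β) / β with hA
  have hApos : 0 < A := by positivity
  set B := T / (2 * β) with hB
  set D := A * T + 1 with hD
  have hBpos : 0 < B := by positivity
  have hDpos : 0 < D := by positivity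
  refine ⟨16 * A * Real.exp (64 * β * (B + D) ^ 2), by positivity,
    max 3 ⌈(8 * (B + D)) ^ 4⌉₊, fun N hN k hk1 hkN => ?_⟩
  have hN3 : 3 ≤ N := le_trans (le_max_left _ _) hN
  have hNbig : (8 * (B + D)) ^ 4 ≤ (N:ℝ) :=
    (Nat.le_ceil _).trans (by exact_mod_cast le_trans (le_max_right _ _) hN)
  obtain ⟨ε, hε1, hε2, hεs⟩ := tilt_exists N (by omega)
  have hN0 : (0:ℝ) < N := by exact_mod_cast (by omega : 0 < N)
  set r := √(√(N:ℝ)) with hr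
  have hsN : √(N:ℝ) = r ^ 2 := (Real.sq_sqrt (Real.sqrt_nonneg _)).symm
  have hr0 : 0 < r := Real.sqrt_pos.2 (Real.sqrt_pos.2 hN0)
  have hr4 : r ^ 4 = N := by
    rw [show r ^ 4 = (r^2)^2 by ring, ← hsN, Real.sq_sqrt hN0.le]
  have hrbig : 8 * (B + D) ≤ r := by
    rw [← hr4] at hNbig
    exact (pow_le_pow_iff_left₀ (by positivity) hr0.le (by norm_num)).1 hNbig
  have hr1 : 1 ≤ r := by
    have : 1 ≤ D := by rw [hD]; nlinarith
    linarith
  have hN32 : (N:ℝ) ^ (-(3:ℝ)/2) = 1 / r ^ 6 := by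
    rw [← hr4, ← Real.rpow_natCast r 4, ← Real.rpow_mul hr0.le, one_div, ← Real.rpow_natCast r 6,
      ← Real.rpow_neg hr0.le]
    norm_num
  obtain ⟨hs1, hs2⟩ := hsums N ε r hε1 hr0 hr4
  -- parameters
  set τ : ℕ → ℝ := fun i => 4 * N * (i + ε) with hτ
  set c : ℕ → ℝ := fun i => 1 / (2 * r ^ 2 * √((i:ℝ) + ε)) with hc
  have hie : ∀ i : ℕ, 0 < (i:ℝ) + ε := fun i => by
    have h0 : (0:ℝ) ≤ i := Nat.cast_nonneg i
    linarith
  have hsq : ∀ i : ℕ, 0 < √((i:ℝ) + ε) := fun i => Real.sqrt_pos.2 (hie i)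
  have hcpos : ∀ i, 0 < c i := fun i => by
    have := hsq i
    simp only [hc]; positivity
  have hct : ∀ i, τ i * c i ^ 2 = 1 := fun i => by
    have := hsq i
    have h2 := hie i
    simp only [hc, hτ]
    rw [div_pow, mul_pow, Real.sq_sqrt h2.le, ← hr4]
    field_simp
    norm_num
  have hcsum : ∑ i ∈ Finset.range N, c i = 1 := by
    have : ∀ i ∈ Finset.range N, c i = (2 * r ^ 2)⁻¹ * (1 / √((i:ℝ) + ε)) := fun i _ => by
      have := hsq i
      simp only [hc]; field_simp
    rw [Finset.sum_congr rfl this, ← Finset.mul_sum, hεs, hsN]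
    field_simp
  have hcm : ∀ i, c i ≤ 2 / r ^ 2 := fun i => by
    have h4 : 1/4 ≤ √((i:ℝ) + ε) := by
      apply Real.le_sqrt_of_sq_le
      have h0 : (0:ℝ) ≤ i := Nat.cast_nonneg i
      linarith
    simp only [hc]
    rw [div_le_div_iff₀ (by have := hsq i; positivity) (by positivity)]
    nlinarith [pow_pos hr0 2]
  have hcm2 : 2 / r ^ 2 ≤ 2 := by
    rw [div_le_iff₀ (by positivity)]
    nlinarith
  have hbsum : ∑ i ∈ Finset.range N, 2 * c i ^ 2 / β ≤ B / r ^ 3 := by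
    have : ∀ i ∈ Finset.range N, 2 * c i ^ 2 / β = (2 * β * r ^ 4)⁻¹ * (1 / ((i:ℝ) + ε)) := fun i _ => by
      have h2 := hie i
      simp only [hc]
      rw [div_pow, mul_pow, Real.sq_sqrt h2.le]
      field_simp
    rw [Finset.sum_congr rfl this, ← Finset.mul_sum]
    calc _ ≤ (2 * β * r ^ 4)⁻¹ * (T * r) := by gcongr
      _ = B / r ^ 3 := by rw [hB]; field_simp
  have hVsum : ∑ i ∈ Finset.range N, 2 * (1 + 2 * (2 / r ^ 2) / β) / β * c i ^ 3
      ≤ (D / r ^ 3) ^ 2 / 2 := by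
    have : ∀ i ∈ Finset.range N, 2 * (1 + 2 * (2 / r ^ 2) / β) / β * c i ^ 3
        ≤ A * (8 * r ^ 6)⁻¹ * (1 / (√((i:ℝ) + ε)) ^ 3) := fun i _ => by
      have h2 := hsq i
      have e : A * (8 * r ^ 6)⁻¹ * (1 / (√((i:ℝ) + ε)) ^ 3) = A * c i ^ 3 := by
        simp only [hc]
        field_simp
        norm_num
      rw [e]
      have h3 := hcpos i
      apply mul_le_mul_of_nonneg_right _ (by positivity)
      rw [hA]
      have : 2 * (2 / r ^ 2) ≤ 4 := by linarith
      gcongr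
    refine (Finset.sum_le_sum this).trans ?_
    rw [← Finset.mul_sum]
    calc _ ≤ A * (8 * r ^ 6)⁻¹ * T := by gcongr
      _ = (A * T / 8) * (1 / r ^ 6) := by field_simp
      _ ≤ (D ^ 2 / 2) * (1 / r ^ 6) := by
        have hAT := mul_pos hApos hT
        have hAD : A * T / 8 ≤ D ^ 2 / 2 := by
          rw [hD]; nlinarith [sq_nonneg (A * T)]
        exact mul_le_mul_of_nonneg_right hAD (by positivity)
      _ = _ := by field_simp
  obtain ⟨m, rfl⟩ : ∃ m, N = m + 1 + 1 + 1 := ⟨N - 3, by omega⟩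
  -- choice of eliminated index and tracked coordinate
  obtain ⟨j, i₀, hj1, hcoord⟩ : ∃ j i₀ : Fin (m+1+1), (j:ℕ) ≤ 1 ∧ ∀ x : Fin (m+1+1) → ℝ,
      coulombCoord (m+1+1+1) k (Function.update x j (1 - ∑ i, x i)) = x i₀ := by
    by_cases hkl : k = m + 1 + 1 + 1
    · refine ⟨0, 0, by simp, fun x => ?_⟩
      rw [hkl, coulombCoord_last, flip_sum]
      ring
    · obtain ⟨i, hi⟩ : ∃ i : Fin (m+1+1), k = i + 1 := ⟨⟨k - 1, by omega⟩, by simp; omega⟩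
      by_cases hi0 : i = 0
      · refine ⟨1, i, by simp, fun x => ?_⟩
        rw [hi, coulombCoord_lt, Function.update_of_ne]
        rw [hi0]; simp
      · refine ⟨0, i, by simp, fun x => ?_⟩
        rw [hi, coulombCoord_lt, Function.update_of_ne hi0]
  have hsg := sg_sum j
  have hj1' : (j:ℝ) ≤ 1 := by exact_mod_cast hj1
  have hj0 : (0:ℝ) ≤ (j:ℕ) := Nat.cast_nonneg _
  have hc0low : 1 / (4 * r ^ 2) ≤ c j := by
    simp only [hc]
    have : √((j:ℝ) + ε) ≤ 2 := by
      apply Real.sqrt_le_iff.2; constructor <;> linarith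
    have h2 := hsq j
    apply one_div_le_one_div_of_le (by positivity)
    calc 2 * r ^ 2 * √((j:ℝ) + ε) ≤ 2 * r ^ 2 * 2 := by gcongr
      _ = 4 * r ^ 2 := by ring
  have hbpos : ∀ i, 0 ≤ 2 * c i ^ 2 / β := fun i => by positivity
  have hVpos : ∀ i, 0 ≤ 2 * (1 + 2 * (2 / r ^ 2) / β) / β * c i ^ 3 := fun i => by
    have := hcpos i
    positivity
  have hsmall : B / r ^ 3 + D / r ^ 3 ≤ 1 / (8 * r ^ 2) := by
    rw [← add_div, div_le_div_iff₀ (by positivity) (by positivity)]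
    calc (B + D) * (8 * r ^ 2) = (8 * (B + D)) * r ^ 2 := by ring
      _ ≤ r * r ^ 2 := by gcongr
      _ = 1 * r ^ 3 := by ring
  have hcore := core_bound hβ (fun i => τ (sg j i)) (fun i => c (sg j i)) (fun i => hcpos _)
    (fun i => hct _) (τ j) (c j) (hcpos j) (hct j) (by rw [hsg c]; exact hcsum) (2 / r ^ 2)
    (fun i => hcm _) (B / r ^ 3) (D / r ^ 3) (by positivity)
    (by have := hsg (fun i => 2 * c i ^ 2 / β)
        have h2 := hbpos j
        linarith)
    (by have := hsg (fun i => 2 * (1 + 2 * (2 / r ^ 2) / β) / β * c i ^ 3)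
        have h2 := hVpos j
        linarith)
    (by have : 1 / (8 * r ^ 2) = 1 / (4 * r ^ 2) / 2 := by field_simp; norm_num
        linarith) i₀
  have hI : ∀ g : (Fin (m+1+1) → ℝ) → ℝ, coulombInt β (4 * β * ((m+1+1+1 : ℕ):ℝ)) (m+1+1+1) g
      = Real.exp (4 * β * ((m+1+1+1 : ℕ):ℝ) * (ε - 1)) *
        ∫ x, g (Function.update x j (1 - ∑ i, x i)) *
          ((∏ i, qw β (τ (sg j i)) (x i)) * qw β (τ j) (1 - ∑ i, x i)) := by
    intro g
    rw [coulombInt_eq_s5 β _ ε τ (fun i => by simp only [hτ]; ring) g, flip_integral j]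
    simp_rw [flip_integrand]
  have hE := Real.exp_pos (4 * β * ((m+1+1+1 : ℕ):ℝ) * (ε - 1))
  have hcv : condVar β (m+1+1+1) (4 * β * ((m+1+1+1 : ℕ):ℝ)) k =
      (∫ x : Fin (m+1+1) → ℝ, x i₀ ^ 2 * ((∏ i, qw β (τ (sg j i)) (x i)) * qw β (τ j) (1 - ∑ i, x i)))
        / (∫ x : Fin (m+1+1) → ℝ, 1 * ((∏ i, qw β (τ (sg j i)) (x i)) * qw β (τ j) (1 - ∑ i, x i)))
      - ((∫ x : Fin (m+1+1) → ℝ, x i₀ * ((∏ i, qw β (τ (sg j i)) (x i)) * qw β (τ j) (1 - ∑ i, x i)))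
        / (∫ x : Fin (m+1+1) → ℝ,
          1 * ((∏ i, qw β (τ (sg j i)) (x i)) * qw β (τ j) (1 - ∑ i, x i)))) ^ 2 := by
    unfold condVar condMean
    have e1 := hI (fun _ => 1)
    have e2 := hI (fun x => coulombCoord (m+1+1+1) k x)
    have e3 := hI (fun x => coulombCoord (m+1+1+1) k x ^ 2)
    simp_rw [hcoord] at e2 e3
    refine Eq.trans (congrArg₂ (· - ·) (congrArg₂ (· / ·) e3 e1)
      (congrArg (· ^ 2) (congrArg₂ (· / ·) e2 e1))) ?_
    rw [mul_div_mul_left _ _ hE.ne', mul_div_mul_left _ _ hE.ne']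
  simp only at hcore
  rw [hcv]
  refine ⟨hcore.1, hcore.2.trans ?_⟩
  rw [hN32, Real.exp_neg, div_inv_eq_mul]
  have hA' : 2 * (1 + 2 * (2 / r ^ 2) / β) / β ≤ A := by
    rw [hA]
    have : 2 * (2 / r ^ 2) ≤ 4 := by linarith
    gcongr
  have hexp : β * τ j * (B / r ^ 3 + D / r ^ 3) ^ 2 / (c j / 2) ≤ 64 * β * (B + D) ^ 2 := by
    have ht8 : τ j ≤ 8 * r ^ 4 := by
      simp only [hτ]
      rw [hr4]
      have hj2 : (j:ℝ) + ε ≤ 2 := by linarith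
      calc 4 * ((m+1+1+1 : ℕ):ℝ) * ((j:ℝ) + ε) ≤ 4 * ((m+1+1+1 : ℕ):ℝ) * 2 := by gcongr
        _ = 8 * ((m+1+1+1 : ℕ):ℝ) := by ring
    calc _ ≤ β * (8 * r ^ 4) * (B / r ^ 3 + D / r ^ 3) ^ 2 / (1 / (4 * r ^ 2) / 2) := by
          gcongr
      _ = _ := by field_simp; ring
  calc _ ≤ 2 * (A * (2 / r ^ 2) ^ 3) * Real.exp (64 * β * (B + D) ^ 2) := by
        gcongr
    _ = _ := by field_simp; ring

/-- Critical force `F = 4βN`: the conditional variance is `O(N^{−3/2})` uniformly in `k`. -/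
theorem var_spacing_critical (β : ℝ) (hβ : 0 < β) :
    ∃ C > (0:ℝ), ∃ N₀ : ℕ, ∀ N ≥ N₀, ∀ k : ℕ, 1 ≤ k → k ≤ N →
      0 ≤ condVar β N (4 * β * N) k ∧
      condVar β N (4 * β * N) k ≤ C * (N : ℝ) ^ (-(3:ℝ)/2) := by
  exact main_aux β hβ
end
end
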